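/- arXiv:1709.01358 — 2 statements merged into one kernel-verified Lean document; each statement's English description precedes it below -/
import Mathlib

section
/- Let (W,S) be the Coxeter system of type E_7: S = {1,...,7} with m(1,3) = m(3,4) = m(4,5) = m(5,6) = m(6,7) = m(2,4) = 3 and all other pairs commuting (m = 2). Then the homology of the weighted complex C_*(W) is: H_0 ≅ R/(Φ_2); H_1 = H_2 = H_3 = 0; H_4 ≅ R/(Φ_6); H_5 ≅ R/(Φ_6); H_6 ≅ R/(Φ_2) ⊕ R/(Φ_6) ⊕ R/(Φ_14) ⊕ R/(Φ_18); and H_k = 0 for all k ≥ 7. -/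
open Polynomial CoxeterSystem

set_option synthInstance.maxHeartbeats 1000000
set_option maxHeartbeats 1000000

noncomputable section

/-- The ring `R = ℚ[q,q⁻¹]` of Laurent polynomials over `ℚ`. -/
abbrev R : Type := LaurentPolynomial ℚ

/-- The image of the `d`-th cyclotomic polynomial `Φ_d` in `R`. -/
def cyc (d : ℕ) : R := Polynomial.toLaurent (Polynomial.cyclotomic d ℚ)

/-- The `R`-module `R/(Φ_d)`. -/
abbrev CycQuot (d : ℕ) := R ⧸ Ideal.span {cyc d}

variable {B : Type*} [Fintype B] [LinearOrder B] {W : Type*} [Group W]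
  {M : CoxeterMatrix B} (cs : CoxeterSystem M W)

/-- The standard parabolic subgroup `W_σ` generated by `σ ⊆ S`. -/
def parabolic (σ : Finset B) : Subgroup W := Subgroup.closure (cs.simple '' σ)

/-- The Poincaré polynomial `W_σ(q) = Σ_{w ∈ W_σ} q^{ℓ(w)}` of the standard parabolic
subgroup `W_σ` (defined to be `0` if `W_σ` is infinite). -/
def poin (σ : Finset B) : ℚ[X] :=
  letI := Classical.dec ((parabolic cs σ : Set W).Finite)
  if h : (parabolic cs σ : Set W).Finite then ∑ w ∈ h.toFinset, X ^ cs.length w else 0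

/-- The set of simplices `σ ∈ K_W` with `|σ| = k`, i.e. the subsets of `S` of
cardinality `k` generating a finite standard parabolic subgroup. -/
abbrev KW (k : ℕ) := {σ : Finset B // σ.card = k ∧ (parabolic cs σ : Set W).Finite}

noncomputable instance (k : ℕ) : Fintype (KW cs k) := Fintype.ofFinite _

/-- The coefficient of `e_τ` in `∂ e_σ`: it is
`(−1)^{#{t ∈ σ : t < s}} · W_σ(q)/W_{σ∖{s}}(q)` if `τ = σ ∖ {s}` for some `s ∈ σ`,
and `0` otherwise. -/
def bcoeff (σ τ : Finset B) : R :=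
  ∑ s ∈ σ, if τ = σ.erase s then
      (-1 : R) ^ (σ.filter (fun t => t < s)).card *
        Polynomial.toLaurent (poin cs σ / poin cs τ)
    else 0

/-- The boundary map `∂ : C_{k+1} → C_k` of the weighted complex `C_*(W)`, where
`C_k = ⊕_{σ ∈ K_W, |σ| = k} R·e_σ`. -/
def bdry (k : ℕ) : (KW cs (k + 1) → R) →ₗ[R] (KW cs k → R) :=
  Matrix.mulVecLin (Matrix.of fun (τ : KW cs k) (σ : KW cs (k + 1)) => bcoeff cs σ.1 τ.1)

/-- The submodule of cycles in degree `k` of the weighted complex. -/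
def cycles : (k : ℕ) → Submodule R (KW cs k → R)
  | 0 => ⊤
  | (k + 1) => LinearMap.ker (bdry cs k)

/-- The `k`-th homology `H_k(C_*(W))` of the weighted complex: cycles modulo boundaries. -/
abbrev Hgy (k : ℕ) :=
  cycles cs k ⧸ Submodule.comap (cycles cs k).subtype (LinearMap.range (bdry cs k))

end

namespace E7

/-- The Cartan matrix of type `E₇`. -/
def cartan (i j : Fin 7) : ℤ :=
  if i = j then 2
  else if (i.val, j.val) ∈ [(0, 2), (1, 3), (2, 3), (3, 4), (4, 5), (5, 6)] ∨
    (j.val, i.val) ∈ [(0, 2), (1, 3), (2, 3), (3, 4), (4, 5), (5, 6)] then -1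
  else 0

/-- The action of the `i`-th simple reflection on weights, in the basis of fundamental weights. -/
def fire (i : Fin 7) (x : Fin 7 → ℤ) : Fin 7 → ℤ := fun j => x j - cartan i j * x i

lemma cartan_self (i : Fin 7) : cartan i i = 2 := by simp [cartan]

lemma fire_fire (i : Fin 7) (x : Fin 7 → ℤ) : fire i (fire i x) = x := by
  funext j
  simp only [fire, cartan_self]
  ring

lemma fire_self (i : Fin 7) (x : Fin 7 → ℤ) : fire i x i = -x i := by
  simp only [fire, cartan_self]
  ring

lemma fire_of_eq_zero {i : Fin 7} {x : Fin 7 → ℤ} (h : x i = 0) : fire i x = x := by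
  funext j
  simp [fire, h]

/-- The Coxeter matrix is that of type `E₇`. -/
def IsE7 (M : CoxeterMatrix (Fin 7)) : Prop :=
  ∀ i j : Fin 7, i.val < j.val →
    M.M i j = if (i.val, j.val) ∈
      ([(0, 2), (1, 3), (2, 3), (3, 4), (4, 5), (5, 6)] : List (ℕ × ℕ)) then 3 else 2

variable {W : Type*} [Group W] {M : CoxeterMatrix (Fin 7)}

lemma entry_cases (hM : IsE7 M) {i j : Fin 7} (hij : i ≠ j) :
    (M.M i j = 2 ∧ cartan i j = 0 ∧ cartan j i = 0) ∨
      (M.M i j = 3 ∧ cartan i j = -1 ∧ cartan j i = -1) := by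
  have key : ∀ i j : Fin 7, i.val < j.val →
      ((if (i.val, j.val) ∈
        ([(0, 2), (1, 3), (2, 3), (3, 4), (4, 5), (5, 6)] : List (ℕ × ℕ)) then 3 else 2) = 2 ∧
          cartan i j = 0 ∧ cartan j i = 0) ∨
      ((if (i.val, j.val) ∈
        ([(0, 2), (1, 3), (2, 3), (3, 4), (4, 5), (5, 6)] : List (ℕ × ℕ)) then 3 else 2) = 3 ∧
          cartan i j = -1 ∧ cartan j i = -1) := by
    decide
  rcases lt_or_gt_of_ne (fun h => hij (Fin.ext h) : i.val ≠ j.val) with h | h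
  · rw [hM i j h]
    exact key i j h
  · have hs : M.M i j = M.M j i := M.symmetric i j
    rw [hs, hM j i h]
    rcases key j i h with ⟨a, b, c⟩ | ⟨a, b, c⟩
    · exact Or.inl ⟨a, c, b⟩
    · exact Or.inr ⟨a, c, b⟩

lemma fire_isLiftable (hM : IsE7 M) :
    M.IsLiftable (G := Function.End (Fin 7 → ℤ)) fire := by
  intro i j
  by_cases hij : i = j
  · subst hij
    have h1 : M.M i i = 1 := M.diagonal i
    rw [h1, pow_one]
    funext x
    exact fire_fire i x
  · rcases entry_cases hM hij with ⟨h, h1, h2⟩ | ⟨h, h1, h2⟩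
    · rw [h]
      funext x k
      change fire i (fire j (fire i (fire j x))) k = x k
      simp only [fire, cartan_self, h1, h2]
      ring
    · rw [h]
      funext x k
      change fire i (fire j (fire i (fire j (fire i (fire j x))))) k = x k
      simp only [fire, cartan_self, h1, h2]
      ring

section Coxeter

variable (cs : CoxeterSystem M W) (hM : IsE7 M)

/-- The action of an `E₇` Coxeter group on its weight lattice. -/
noncomputable def act : W →* Function.End (Fin 7 → ℤ) :=
  cs.lift ⟨fire, fire_isLiftable hM⟩

lemma act_simple_mul (i : Fin 7) (w : W) (y : Fin 7 → ℤ) :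
    act cs hM (cs.simple i * w) y = fire i (act cs hM w y) := by
  rw [map_mul]
  change act cs hM (cs.simple i) (act cs hM w y) = _
  exact congrFun (cs.lift_apply_simple (fire_isLiftable hM) i) _

lemma act_one (y : Fin 7 → ℤ) : act cs hM 1 y = y := by
  rw [map_one]; rfl

lemma act_inv_of_fixed {w : W} {y : Fin 7 → ℤ} (h : act cs hM w y = y) :
    act cs hM w⁻¹ y = y := by
  have : act cs hM (w⁻¹ * w) y = act cs hM w⁻¹ (act cs hM w y) := by rw [map_mul]; rfl
  rw [inv_mul_cancel, act_one, h] at this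
  exact this.symm

theorem act_nonneg_of_length_lt (n : ℕ) : ∀ (w : W), cs.length w = n → ∀ i : Fin 7,
    cs.length w < cs.length (cs.simple i * w) →
    ∀ y : Fin 7 → ℤ, (∀ j, 0 ≤ y j) → 0 ≤ act cs hM w y i := by
  induction n using Nat.strong_induction_on with
  | _ n ih =>
    intro w hw i hi y hy
    by_cases h1 : w = 1
    · subst h1
      rw [act_one]
      exact hy i
    obtain ⟨j, hj⟩ := cs.exists_leftDescent_of_ne_one h1
    clear h1
    rw [cs.isLeftDescent_iff] at hj
    obtain ⟨v, rfl⟩ : ∃ v, w = cs.simple j * v := ⟨cs.simple j * w, by simp⟩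
    rw [cs.simple_mul_simple_cancel_left] at hj
    have hij : i ≠ j := by
      rintro rfl
      rw [cs.simple_mul_simple_cancel_left] at hi
      omega
    have hvj := ih _ (by omega) v rfl j (by omega) y hy
    rw [act_simple_mul]
    rcases entry_cases hM hij with ⟨h, h1, h2⟩ | ⟨h, h1, h2⟩
    · have hcomm : cs.simple i * cs.simple j = cs.simple j * cs.simple i := by
        have := cs.simple_mul_simple_pow i j
        rw [h, pow_two] at this
        have e := eq_inv_of_mul_eq_one_left this
        rwa [mul_inv_rev, cs.inv_simple, cs.inv_simple] at e
      have e : cs.length (cs.simple i * (cs.simple j * v)) ≤ cs.length (cs.simple i * v) + 1 := by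
        rw [← mul_assoc, hcomm, mul_assoc]
        have := cs.length_mul_le (cs.simple j) (cs.simple i * v)
        rw [cs.length_simple] at this
        omega
      have hne := cs.length_simple_mul v i
      have hvi := ih _ (by omega) v rfl i (by omega) y hy
      simpa [fire, h2] using hvi
    · have hbraid : cs.simple i * cs.simple j * cs.simple i =
          cs.simple j * cs.simple i * cs.simple j := by
        have := cs.simple_mul_simple_pow i j
        rw [h] at this
        have e : (cs.simple i * cs.simple j * cs.simple i) *
            (cs.simple j * cs.simple i * cs.simple j) = 1 := by
          rw [← this]; simp only [pow_succ, pow_zero, one_mul, mul_assoc]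
        have e := eq_inv_of_mul_eq_one_left e
        simpa [mul_inv_rev, mul_assoc] using e
      have hval : fire j (act cs hM v y) i = act cs hM v y i + act cs hM v y j := by
        simp [fire, h2]
      rw [hval]
      rcases cs.length_simple_mul v i with hvi | hvi
      · have := ih _ (by omega) v rfl i (by omega) y hy
        omega
      · obtain ⟨u, rfl⟩ : ∃ u, v = cs.simple i * u := ⟨cs.simple i * v, by simp⟩
        rw [cs.simple_mul_simple_cancel_left] at hvi
        have e : cs.length (cs.simple i * (cs.simple j * (cs.simple i * u))) ≤
            cs.length (cs.simple j * u) + 2 := by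
          have e1 : cs.simple i * (cs.simple j * (cs.simple i * u)) =
              cs.simple j * (cs.simple i * (cs.simple j * u)) := by
            simpa [mul_assoc] using congrArg (· * u) hbraid
          rw [e1]
          have a1 := cs.length_simple_mul (cs.simple i * (cs.simple j * u)) j
          have a2 := cs.length_simple_mul (cs.simple j * u) i
          omega
        have hne := cs.length_simple_mul u j
        have hu := ih _ (by omega) u rfl j (by omega) y hy
        have hval : act cs hM (cs.simple i * u) y i + act cs hM (cs.simple i * u) y j =
            act cs hM u y j := by
          simp only [act_simple_mul, fire, h1, cartan_self]
          ring
        rw [hval]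
        exact hu

theorem act_nonpos_of_isLeftDescent {w : W} {i : Fin 7} (h : cs.IsLeftDescent w i)
    {y : Fin 7 → ℤ} (hy : ∀ j, 0 ≤ y j) : act cs hM w y i ≤ 0 := by
  have := act_nonneg_of_length_lt cs hM _ (cs.simple i * w) rfl i
    (by rw [cs.simple_mul_simple_cancel_left]; exact h) y hy
  rw [act_simple_mul, fire_self] at this
  omega

lemma act_eq_self_of_mem_parabolic {σ : Finset (Fin 7)} {w : W}
    (hw : w ∈ parabolic cs σ)
    {y : Fin 7 → ℤ} (hy : ∀ j ∈ σ, y j = 0) : act cs hM w y = y := by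
  induction hw using Subgroup.closure_induction with
  | mem x hx =>
    obtain ⟨i, hi, rfl⟩ := hx
    have := act_simple_mul cs hM i 1 y
    rw [mul_one, act_one] at this
    rw [this, fire_of_eq_zero (hy i hi)]
  | one => exact act_one cs hM y
  | mul a b _ _ ha hb =>
    rw [map_mul]
    change act cs hM a (act cs hM b y) = y
    rw [hb, ha]
  | inv a _ ha => exact act_inv_of_fixed cs hM ha

lemma simple_mem_parabolic {σ : Finset (Fin 7)} {i : Fin 7} (hi : i ∈ σ) :
    cs.simple i ∈ parabolic cs σ :=
  Subgroup.subset_closure ⟨i, hi, rfl⟩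

lemma parabolic_mono {σ τ : Finset (Fin 7)} (h : σ ⊆ τ) : parabolic cs σ ≤ parabolic cs τ :=
  Subgroup.closure_mono (Set.image_mono (by exact_mod_cast h))

theorem mem_of_isLeftDescent (hM : IsE7 M) {σ : Finset (Fin 7)} {w : W}
    (hw : w ∈ parabolic cs σ)
    {i : Fin 7} (h : cs.IsLeftDescent w i) : i ∈ σ := by
  by_contra hi
  have h1 := act_nonpos_of_isLeftDescent cs hM h (y := fun j => if j ∈ σ then 0 else 1)
    (fun j => by split_ifs <;> simp)
  rw [act_eq_self_of_mem_parabolic cs hM hw (fun j hj => by simp [hj])] at h1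
  simp [hi] at h1

theorem mem_parabolic_erase {σ : Finset (Fin 7)} {s : Fin 7} (n : ℕ) : ∀ w : W,
    cs.length w = n → w ∈ parabolic cs σ → act cs hM w (Pi.single s 1) = Pi.single s 1 →
    w ∈ parabolic cs (σ.erase s) := by
  induction n using Nat.strong_induction_on with
  | _ n ih =>
    intro w hn hw hfix
    by_cases h1 : w = 1
    · rw [h1]; exact one_mem _
    obtain ⟨i, hi⟩ := cs.exists_leftDescent_of_ne_one h1
    have hiσ := mem_of_isLeftDescent cs hM hw hi
    have hle := act_nonpos_of_isLeftDescent cs hM hi (y := Pi.single s 1)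
      (fun j => by by_cases h : j = s <;> simp [h])
    rw [hfix] at hle
    have his : i ≠ s := by
      rintro rfl
      simp at hle
    have hmem := ih _ (hn ▸ hi) (cs.simple i * w) rfl
      (mul_mem (simple_mem_parabolic cs hiσ) hw)
      (by rw [act_simple_mul, hfix, fire_of_eq_zero (by simp [his])])
    have := mul_mem (simple_mem_parabolic cs (Finset.mem_erase.2 ⟨his, hiσ⟩)) hmem
    rwa [cs.simple_mul_simple_cancel_left] at this

/-- `p` is the length generating polynomial of the finite subset `A` of `W`. -/
def HasGen (A : Set W) (p : ℚ[X]) : Prop :=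
  ∃ T : Finset W, (T : Set W) = A ∧ ∑ w ∈ T, X ^ cs.length w = p

/-- The elements of `W_σ` moving the `s`-th fundamental weight to `x`. -/
def fiber (σ : Finset (Fin 7)) (s : Fin 7) (x : Fin 7 → ℤ) : Set W :=
  {w | w ∈ parabolic cs σ ∧ act cs hM w (Pi.single s 1) = x}

lemma fiber_base {σ : Finset (Fin 7)} {s : Fin 7} :
    fiber cs hM σ s (Pi.single s 1) = (parabolic cs (σ.erase s) : Set W) := by
  ext w
  constructor
  · rintro ⟨h1, h2⟩
    exact mem_parabolic_erase cs hM _ w rfl h1 h2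
  · intro hw
    refine ⟨parabolic_mono cs (Finset.erase_subset _ _) hw,
      act_eq_self_of_mem_parabolic cs hM hw fun j hj => ?_⟩
    simp [(Finset.mem_erase.1 hj).1]

lemma hasGen_fire {σ : Finset (Fin 7)} {s i : Fin 7} (hi : i ∈ σ) {x : Fin 7 → ℤ} (hx : 0 < x i)
    {p : ℚ[X]} (h : HasGen cs (fiber cs hM σ s x) p) :
    HasGen cs (fiber cs hM σ s (fire i x)) (X * p) := by
  classical
  obtain ⟨T, hT, rfl⟩ := h
  refine ⟨T.image (cs.simple i * ·), ?_, ?_⟩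
  · ext w
    simp only [Finset.coe_image, Set.mem_image, hT]
    constructor
    · rintro ⟨v, ⟨h1, h2⟩, rfl⟩
      exact ⟨mul_mem (simple_mem_parabolic cs hi) h1, by rw [act_simple_mul, h2]⟩
    · rintro ⟨h1, h2⟩
      exact ⟨cs.simple i * w, ⟨mul_mem (simple_mem_parabolic cs hi) h1,
        by rw [act_simple_mul, h2, fire_fire]⟩, by simp⟩
  · rw [Finset.sum_image (fun a _ b _ h => mul_left_cancel h), Finset.mul_sum]
    refine Finset.sum_congr rfl fun w hw => ?_
    have hw' : w ∈ fiber cs hM σ s x := by rw [← hT]; exact hw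
    have hnd : ¬ cs.IsLeftDescent w i := fun hd => by
      have := act_nonpos_of_isLeftDescent cs hM hd (y := Pi.single s 1)
        (fun j => by by_cases h : j = s <;> simp [h])
      rw [hw'.2] at this
      omega
    rw [cs.not_isLeftDescent_iff.1 hnd, pow_succ']

lemma hasGen_union {A B : Set W} {p q : ℚ[X]} (hA : HasGen cs A p) (hB : HasGen cs B q)
    (hd : Disjoint A B) : HasGen cs (A ∪ B) (p + q) := by
  classical
  obtain ⟨S, rfl, rfl⟩ := hA
  obtain ⟨T, rfl, rfl⟩ := hB
  exact ⟨S ∪ T, by simp, Finset.sum_union (by exact_mod_cast hd)⟩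

lemma hasGen_empty : HasGen cs (∅ : Set W) 0 := ⟨∅, by simp, by simp⟩

lemma poin_eq_of_hasGen {σ : Finset (Fin 7)} {p : ℚ[X]}
    (h : HasGen cs (parabolic cs σ : Set W) p) :
    (parabolic cs σ : Set W).Finite ∧ poin cs σ = p := by
  obtain ⟨T, hT, rfl⟩ := h
  have hf : (parabolic cs σ : Set W).Finite := hT ▸ T.finite_toSet
  refine ⟨hf, ?_⟩
  rw [poin, dif_pos hf]
  congr 1
  ext w
  rw [Set.Finite.mem_toFinset, ← hT]
  simp

end Coxeter

end E7

namespace E7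

section Orbits

/-- Computable version of `fire`, on lists of coordinates. -/
def fireL (i : Fin 7) (l : List ℤ) : List ℤ :=
  (List.finRange 7).map fun j : Fin 7 => l.getD j 0 - cartan i j * l.getD i 0

/-- The weight with a given list of coordinates. -/
def toVec (l : List ℤ) : Fin 7 → ℤ := fun i => l.getD i 0

lemma toVec_fireL (i : Fin 7) (l : List ℤ) : toVec (fireL i l) = fire i (toVec l) := by
  funext j
  simp [toVec, fireL, fire, List.getD_eq_getElem?_getD]

lemma toVec_injOn {l l' : List ℤ} (h : l.length = 7) (h' : l'.length = 7)
    (e : toVec l = toVec l') : l = l' := by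
  refine List.ext_getElem (by rw [h, h']) fun n h1 h2 => ?_
  have := congrFun e ⟨n, by omega⟩
  rwa [toVec, toVec, List.getD_eq_getElem _ _ h1, List.getD_eq_getElem _ _ h2] at this

/-- The weights obtained from those in `L` by reflections in `σ` lowering them. -/
def nextLevel (σ : List (Fin 7)) (L : List (List ℤ)) : List (List ℤ) :=
  (L.flatMap fun x => (σ.filter fun i => 0 < x.getD i 0).map fun i => fireL i x).dedup

/-- The levels of the orbit of `L`, at most `n` of them. -/
def levels (σ : List (Fin 7)) : ℕ → List (List ℤ) → List (List (List ℤ))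
  | 0, _ => []
  | _ + 1, [] => []
  | n + 1, x :: L => (x :: L) :: levels σ n (nextLevel σ (x :: L))

/-- The polynomial with given coefficients. -/
noncomputable def toPoly : List ℕ → ℚ[X]
  | [] => 0
  | a :: l => (a : ℚ[X]) + X * toPoly l

/-- Addition of coefficient lists. -/
def addL : List ℕ → List ℕ → List ℕ
  | [], l => l
  | l, [] => l
  | a :: l, b :: l' => (a + b) :: addL l l'

/-- Multiplication of coefficient lists. -/
def mulL : List ℕ → List ℕ → List ℕ
  | [], _ => []
  | a :: l, l' => addL (l'.map (a * ·)) (0 :: mulL l l')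

lemma toPoly_addL : ∀ l l' : List ℕ, toPoly (addL l l') = toPoly l + toPoly l'
  | [], l => by simp [addL, toPoly]
  | a :: l, [] => by simp [addL, toPoly]
  | a :: l, b :: l' => by
    simp only [addL, toPoly, toPoly_addL l l', Nat.cast_add]
    ring

lemma toPoly_map (a : ℕ) : ∀ l : List ℕ, toPoly (l.map (a * ·)) = (a : ℚ[X]) * toPoly l
  | [] => by simp [toPoly]
  | b :: l => by
    simp only [List.map_cons, toPoly, toPoly_map a l, Nat.cast_mul]
    ring

lemma toPoly_mulL : ∀ l l' : List ℕ, toPoly (mulL l l') = toPoly l * toPoly l'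
  | [], l => by simp [mulL, toPoly]
  | a :: l, l' => by
    simp only [mulL, toPoly, toPoly_addL, toPoly_map, toPoly_mulL l l', Nat.cast_zero]
    ring

lemma toPoly_replicate (n : ℕ) :
    toPoly (List.replicate n 1) = ∑ i ∈ Finset.range n, (X : ℚ[X]) ^ i := by
  induction n with
  | zero => simp [toPoly]
  | succ n ih =>
    rw [List.replicate_succ, toPoly, ih, Finset.sum_range_succ', Finset.mul_sum]
    simp only [pow_succ', pow_zero, Nat.cast_one]
    ring

variable {W : Type*} [Group W] {M : CoxeterMatrix (Fin 7)}
  (cs : CoxeterSystem M W) (hM : IsE7 M)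

lemma hasGen_biUnion {σ : Finset (Fin 7)} {s : Fin 7} {p : ℚ[X]} :
    ∀ L : List (List ℤ), (∀ x ∈ L, x.length = 7) → L.Nodup →
    (∀ x ∈ L, HasGen cs (fiber cs hM σ s (toVec x)) p) →
    HasGen cs (⋃ x ∈ L, fiber cs hM σ s (toVec x)) ((L.length : ℚ[X]) * p)
  | [], _, _, _ => by simpa using hasGen_empty cs
  | x :: L, hl, hn, h => by
    have h1 := hasGen_union cs (h x (by simp))
      (hasGen_biUnion L (fun y hy => hl y (by simp [hy])) (List.nodup_cons.1 hn).2
        (fun y hy => h y (by simp [hy]))) (by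
      rw [Set.disjoint_left]
      intro w hw hw'
      simp only [Set.mem_iUnion] at hw'
      obtain ⟨y, hy, hwy⟩ := hw'
      have : x = y := toVec_injOn (hl x (by simp)) (hl y (by simp [hy])) (hw.2.symm.trans hwy.2)
      exact (List.nodup_cons.1 hn).1 (this ▸ hy))
    convert h1 using 1
    · ext w; simp
    · push_cast [List.length_cons]; ring

lemma hasGen_levels {σ : List (Fin 7)} {s : Fin 7} : ∀ (n : ℕ) (L : List (List ℤ)) (p : ℚ[X]),
    (∀ x ∈ (levels σ n L).flatten, x.length = 7) → (levels σ n L).flatten.Nodup →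
    (∀ x ∈ L, HasGen cs (fiber cs hM σ.toFinset s (toVec x)) p) →
    HasGen cs (⋃ x ∈ (levels σ n L).flatten, fiber cs hM σ.toFinset s (toVec x))
      (toPoly ((levels σ n L).map List.length) * p)
  | 0, L, p, _, _, _ => by simpa [levels, toPoly] using hasGen_empty cs
  | _ + 1, [], p, _, _, _ => by simpa [levels, toPoly] using hasGen_empty cs
  | n + 1, x₀ :: L₀, p, hl, hn, h => by
    set L := x₀ :: L₀ with hL
    simp only [hL, levels, List.flatten_cons, List.mem_append, List.nodup_append] at hl hn
    have h1 := hasGen_biUnion cs hM L (fun x hx => hl x (Or.inl hx)) hn.1 h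
    have h2 := hasGen_levels n (nextLevel σ L) (X * p) (fun x hx => hl x (Or.inr hx)) hn.2.1 (by
      intro x hx
      simp only [nextLevel, List.mem_dedup, List.mem_flatMap, List.mem_map, List.mem_filter,
        decide_eq_true_eq] at hx
      obtain ⟨y, hy, i, ⟨hi, hpos⟩, rfl⟩ := hx
      rw [toVec_fireL]
      exact hasGen_fire cs hM (by simpa using hi) hpos (h y hy))
    have h3 := hasGen_union cs h1 h2 (by
      rw [Set.disjoint_left]
      intro w hw hw'
      simp only [Set.mem_iUnion] at hw hw'
      obtain ⟨x, hx, hwx⟩ := hw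
      obtain ⟨y, hy, hwy⟩ := hw'
      exact hn.2.2 x hx y hy
        (toVec_injOn (hl x (Or.inl hx)) (hl y (Or.inr hy)) (hwx.2.symm.trans hwy.2)))
    convert h3 using 1
    · ext w
      simp only [hL, levels, List.flatten_cons, List.mem_append, Set.mem_iUnion, Set.mem_union]
      constructor
      · rintro ⟨x, hx | hx, hw⟩
        exacts [Or.inl ⟨x, hx, hw⟩, Or.inr ⟨x, hx, hw⟩]
      · rintro (⟨x, hx, hw⟩ | ⟨x, hx, hw⟩)
        exacts [⟨x, Or.inl hx, hw⟩, ⟨x, Or.inr hx, hw⟩]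
    · simp only [hL, levels, List.map_cons, toPoly]
      ring

/-- The coordinates of the `s`-th fundamental weight. -/
def baseL (s : Fin 7) : List ℤ := (List.finRange 7).map fun j : Fin 7 => if j = s then 1 else 0

lemma toVec_baseL (s : Fin 7) : toVec (baseL s) = Pi.single s 1 := by
  funext j
  simp [toVec, baseL, List.getD_eq_getElem?_getD, Pi.single_apply]

/-- The orbit of the `s`-th fundamental weight under `W_σ`, by levels. -/
def orbitLevels (σ : List (Fin 7)) (s : Fin 7) : List (List (List ℤ)) := levels σ 28 [baseL s]

/-- The list `orbitLevels σ s` is free of repetitions and closed under the reflections in `σ`. -/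
def orbitClosed (σ : List (Fin 7)) (s : Fin 7) : Bool :=
  let X := (orbitLevels σ s).flatten
  X.all (fun x => x.length == 7) && decide X.Nodup &&
    X.all fun x => σ.all fun i => X.contains (fireL i x)

theorem hasGen_parabolic (hM : IsE7 M) {σ : List (Fin 7)} {s : Fin 7} {p : ℚ[X]}
    (hc : orbitClosed σ s = true)
    (h : HasGen cs (parabolic cs (σ.toFinset.erase s) : Set W) p) :
    HasGen cs (parabolic cs σ.toFinset : Set W)
      (toPoly ((orbitLevels σ s).map List.length) * p) := by
  simp only [orbitClosed, Bool.and_eq_true, List.all_eq_true, beq_iff_eq, decide_eq_true_eq,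
    List.contains_iff_mem] at hc
  obtain ⟨⟨hl, hn⟩, hcl⟩ := hc
  have h1 := hasGen_levels cs hM 28 [baseL s] p hl hn (by
    intro x hx
    rw [List.mem_singleton.1 hx, toVec_baseL, fiber_base]
    exact h)
  refine (congrArg (HasGen cs · _) ?_).mpr h1
  ext w
  simp only [Set.mem_iUnion]
  constructor
  · intro hw
    suffices ∃ x ∈ (orbitLevels σ s).flatten, act cs hM w (Pi.single s 1) = toVec x by
      obtain ⟨x, hx, e⟩ := this
      exact ⟨x, hx, hw, e⟩
    induction hw using Subgroup.closure_induction_left with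
    | one =>
      refine ⟨baseL s, ?_, by rw [act_one, toVec_baseL]⟩
      simp [orbitLevels, levels]
    | mul_left x hx y _ ih =>
      obtain ⟨i, hi, rfl⟩ := hx
      obtain ⟨v, hv, e⟩ := ih
      exact ⟨fireL i v, hcl v hv i (by simpa using hi), by rw [act_simple_mul, e, toVec_fireL]⟩
    | inv_mul_cancel x hx y _ ih =>
      obtain ⟨i, hi, rfl⟩ := hx
      obtain ⟨v, hv, e⟩ := ih
      rw [cs.inv_simple]
      exact ⟨fireL i v, hcl v hv i (by simpa using hi), by rw [act_simple_mul, e, toVec_fireL]⟩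
  · rintro ⟨x, _, hw⟩
    exact hw.1

end Orbits

end E7

namespace E7

/-- The degrees of the parabolic subgroup with a given bit mask. -/
def deg (m : ℕ) : List ℕ :=
  ([[], [2], [2], [2,2], [2], [2,3], [2,2], [2,2,3],
   [2], [2,2], [2,3], [2,2,3], [2,3], [2,3,4], [2,3,4], [2,3,4,5],
   [2], [2,2], [2,2], [2,2,2], [2,2], [2,2,3], [2,2,2], [2,2,2,3],
   [2,3], [2,2,3], [2,3,4], [2,2,3,4], [2,3,4], [2,3,4,5], [2,4,4,6], [2,4,5,6,8],
   [2], [2,2], [2,2], [2,2,2], [2,2], [2,2,3], [2,2,2], [2,2,2,3],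
   [2,2], [2,2,2], [2,2,3], [2,2,2,3], [2,2,3], [2,2,3,4], [2,2,3,4], [2,2,3,4,5],
   [2,3], [2,2,3], [2,2,3], [2,2,2,3], [2,2,3], [2,2,3,3], [2,2,2,3], [2,2,2,3,3],
   [2,3,4], [2,2,3,4], [2,3,4,5], [2,2,3,4,5], [2,3,4,5], [2,3,4,5,6], [2,4,5,6,8], [2,5,6,8,9,12],
   [2], [2,2], [2,2], [2,2,2], [2,2], [2,2,3], [2,2,2], [2,2,2,3],
   [2,2], [2,2,2], [2,2,3], [2,2,2,3], [2,2,3], [2,2,3,4], [2,2,3,4], [2,2,3,4,5],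
   [2,2], [2,2,2], [2,2,2], [2,2,2,2], [2,2,2], [2,2,2,3], [2,2,2,2], [2,2,2,2,3],
   [2,2,3], [2,2,2,3], [2,2,3,4], [2,2,2,3,4], [2,2,3,4], [2,2,3,4,5], [2,2,4,4,6], [2,2,4,5,6,8],
   [2,3], [2,2,3], [2,2,3], [2,2,2,3], [2,2,3], [2,2,3,3], [2,2,2,3], [2,2,2,3,3],
   [2,2,3], [2,2,2,3], [2,2,3,3], [2,2,2,3,3], [2,2,3,3], [2,2,3,3,4], [2,2,3,3,4], [2,2,3,3,4,5],
   [2,3,4], [2,2,3,4], [2,2,3,4], [2,2,2,3,4], [2,2,3,4], [2,2,3,3,4], [2,2,2,3,4], [2,2,2,3,3,4],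
   [2,3,4,5], [2,2,3,4,5], [2,3,4,5,6], [2,2,3,4,5,6], [2,3,4,5,6], [2,3,4,5,6,7], [2,4,6,6,8,10],
   [2,6,8,10,12,14,18]] : List (List ℕ)).getD m []

/-- The subset of `S` with a given bit mask. -/
def bits (m : ℕ) : List (Fin 7) := (List.finRange 7).filter fun i : Fin 7 => m.testBit i

/-- The coefficients of the product of the `q`-integers in a list. -/
def qprod : List ℕ → List ℕ
  | [] => [1]
  | n :: l => mulL (List.replicate n 1) (qprod l)

/-- The check of the inductive step of the computation of Poincaré polynomials. -/
def stepCheck (m : ℕ) : Bool :=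
  let s : Fin 7 := Fin.ofNat 7 m.log2
  decide ((bits m).toFinset.erase s = (bits (m - 2 ^ m.log2)).toFinset) &&
  orbitClosed (bits m) s &&
    mulL ((orbitLevels (bits m) s).map List.length) (qprod (deg (m - 2 ^ m.log2))) == qprod (deg m)

set_option maxRecDepth 100000 in
lemma stepCheck_all : ∀ m < 128, m ≠ 0 → stepCheck m = true := by
  decide +kernel

end E7

namespace E7

section Poincare

variable {W : Type*} [Group W] {M : CoxeterMatrix (Fin 7)}
  (cs : CoxeterSystem M W)

theorem hasGen_parabolic_bits (hM : IsE7 M) (m : ℕ) (hm : m < 128) :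
    HasGen cs (parabolic cs (bits m).toFinset : Set W) (toPoly (qprod (deg m))) := by
  induction m using Nat.strong_induction_on with
  | _ m ih =>
    by_cases h0 : m = 0
    · subst h0
      have h1 : parabolic cs (bits 0).toFinset = ⊥ := by
        have : bits 0 = [] := by decide
        simp [parabolic, this]
      refine ⟨{1}, by simp [h1], ?_⟩
      have : qprod (deg 0) = [1] := by decide
      simp [this, toPoly]
    · have hs := stepCheck_all m hm h0
      simp only [stepCheck, Bool.and_eq_true, beq_iff_eq, decide_eq_true_eq] at hs
      obtain ⟨⟨h1, h2⟩, h3⟩ := hs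
      have hlt : m - 2 ^ m.log2 < m := Nat.sub_lt (Nat.pos_of_ne_zero h0) (by positivity)
      have := ih _ hlt (by omega)
      rw [← h1] at this
      have := hasGen_parabolic cs hM h2 this
      rwa [← toPoly_mulL, h3] at this

/-- The indices of the cyclotomic polynomials dividing the Poincaré polynomial of `E₇`. -/
def indices : Finset ℕ := {2, 3, 4, 5, 6, 7, 8, 9, 10, 12, 14, 18}

/-- The `Φ_d`-weight of the simplex with bit mask `m`. -/
def wt (d m : ℕ) : ℕ := (deg m).countP (d ∣ ·)

/-- The Poincaré polynomial of the simplex with bit mask `m`, as an element of `R`. -/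
noncomputable def weight (m : ℕ) : R := ∏ d ∈ indices, cyc d ^ wt d m

lemma toPoly_replicate_eq_prod {n : ℕ} (hn : n ∈ indices) :
    Polynomial.toLaurent (toPoly (List.replicate n 1)) =
      ∏ d ∈ indices, if d ∣ n then cyc d else 1 := by
  have h : n.divisors.erase 1 = indices.filter (· ∣ n) := by
    revert n
    decide +kernel
  have hpos : 0 < n := by
    revert n
    decide
  rw [toPoly_replicate, ← prod_cyclotomic_eq_geom_sum hpos, h, map_prod, Finset.prod_filter]
  rfl

lemma toPoly_qprod : ∀ l : List ℕ, (∀ n ∈ l, n ∈ indices) →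
    Polynomial.toLaurent (toPoly (qprod l)) = ∏ d ∈ indices, cyc d ^ l.countP (d ∣ ·)
  | [], _ => by simp [qprod, toPoly]
  | n :: l, h => by
    rw [qprod, toPoly_mulL, map_mul, toPoly_replicate_eq_prod (h n (by simp)),
      toPoly_qprod l fun k hk => h k (by simp [hk]), ← Finset.prod_mul_distrib]
    refine Finset.prod_congr rfl fun d _ => ?_
    rw [List.countP_cons, pow_add, mul_comm]
    by_cases hd : d ∣ n <;> simp [hd]

lemma deg_mem_indices : ∀ m < 128, ∀ n ∈ deg m, n ∈ indices := by decide +kernel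

theorem poin_bits (hM : IsE7 M) (m : ℕ) (hm : m < 128) :
    (parabolic cs (bits m).toFinset : Set W).Finite ∧
      Polynomial.toLaurent (poin cs (bits m).toFinset) = weight m := by
  obtain ⟨h1, h2⟩ := poin_eq_of_hasGen cs (hasGen_parabolic_bits cs hM m hm)
  exact ⟨h1, by rw [h2, toPoly_qprod _ (deg_mem_indices m hm)]; rfl⟩

lemma cyc_ne_zero (d : ℕ) : cyc d ≠ 0 := by
  rw [cyc, Ne, Polynomial.toLaurent_eq_zero]
  exact cyclotomic_ne_zero d ℚ

lemma weight_ne_zero (m : ℕ) : weight m ≠ 0 :=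
  Finset.prod_ne_zero_iff.2 fun d _ => pow_ne_zero _ (cyc_ne_zero d)

lemma isCoprime_cyc {d e : ℕ} (h : d ≠ e) : IsCoprime (cyc d) (cyc e) :=
  (cyclotomic.isCoprime_rat h).map Polynomial.toLaurent

/-- The bit mask of a subset of `S`. -/
def mask (σ : Finset (Fin 7)) : ℕ := ∑ i ∈ σ, 2 ^ i.val

lemma mask_lt (σ : Finset (Fin 7)) : mask σ < 128 := by
  revert σ; decide +kernel

lemma bits_mask (σ : Finset (Fin 7)) : (bits (mask σ)).toFinset = σ := by
  revert σ; decide +kernel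

lemma mask_injective : Function.Injective mask := fun σ τ h => by
  rw [← bits_mask σ, h, bits_mask]

lemma mask_bits : ∀ m < 128, mask (bits m).toFinset = m := by decide +kernel

theorem poin_mask (hM : IsE7 M) (σ : Finset (Fin 7)) :
    (parabolic cs σ : Set W).Finite ∧ Polynomial.toLaurent (poin cs σ) = weight (mask σ) := by
  have := poin_bits cs hM (mask σ) (mask_lt σ)
  rwa [bits_mask] at this

end Poincare

end E7

namespace E7

section Contraction

/-- The chain represented by a list of pairs (integer coefficient, simplex). -/
noncomputable def vec (l : List (ℤ × ℕ)) : ℕ →₀ R :=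
  (l.map fun p => Finsupp.single p.2 (p.1 : R)).sum

/-- The linear extension of a map from simplices to chains, on lists. -/
def extend (T : ℕ → List (ℤ × ℕ)) (l : List (ℤ × ℕ)) : List (ℤ × ℕ) :=
  l.flatMap fun p => (T p.2).map fun r => (p.1 * r.1, r.2)

/-- The linear extension of a map from simplices to chains. -/
noncomputable def lin (T : ℕ → List (ℤ × ℕ)) : (ℕ →₀ R) →ₗ[R] (ℕ →₀ R) :=
  Finsupp.linearCombination R fun m => vec (T m)

/-- The coefficient of a simplex in the chain represented by a list. -/
def coeffAt (m : ℕ) (l : List (ℤ × ℕ)) : ℤ := (l.map fun p => if p.2 = m then p.1 else 0).sum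

lemma vec_nil : vec [] = 0 := rfl

lemma vec_cons (p : ℤ × ℕ) (l : List (ℤ × ℕ)) :
    vec (p :: l) = Finsupp.single p.2 (p.1 : R) + vec l := by
  simp [vec]

lemma vec_append (l l' : List (ℤ × ℕ)) : vec (l ++ l') = vec l + vec l' := by
  simp [vec]

lemma vec_map_smul (a : ℤ) (l : List (ℤ × ℕ)) :
    vec (l.map fun r => (a * r.1, r.2)) = (a : R) • vec l := by
  induction l with
  | nil => simp [vec_nil]
  | cons p l ih =>
    rw [List.map_cons, vec_cons, vec_cons, ih, smul_add, Finsupp.smul_single]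
    simp

lemma lin_single (T : ℕ → List (ℤ × ℕ)) (m : ℕ) (a : R) :
    lin T (Finsupp.single m a) = a • vec (T m) := by
  simp [lin]

lemma lin_vec (T : ℕ → List (ℤ × ℕ)) (l : List (ℤ × ℕ)) : lin T (vec l) = vec (extend T l) := by
  induction l with
  | nil => simp [extend, vec_nil]
  | cons p l ih =>
    have : extend T (p :: l) = ((T p.2).map fun r => (p.1 * r.1, r.2)) ++ extend T l := by
      simp [extend]
    rw [this, vec_append, vec_cons, map_add, ih, lin_single, vec_map_smul]

lemma vec_apply (l : List (ℤ × ℕ)) (m : ℕ) : vec l m = (coeffAt m l : R) := by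
  induction l with
  | nil => simp [vec_nil, coeffAt]
  | cons p l ih =>
    rw [vec_cons, Finsupp.add_apply, ih, Finsupp.single_apply]
    simp only [coeffAt, List.map_cons, List.sum_cons, Int.cast_add]
    congr 1
    split_ifs <;> simp

lemma coeffAt_of_notMem {l : List (ℤ × ℕ)} {m : ℕ} (h : ∀ p ∈ l, p.2 ≠ m) : coeffAt m l = 0 := by
  induction l with
  | nil => rfl
  | cons p l ih =>
    have h1 : p.2 ≠ m := h p (by simp)
    have h2 := ih fun p hp => h p (by simp [hp])
    simp only [coeffAt] at h2
    simp [coeffAt, h1, h2]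

lemma vec_eq_zero {l : List (ℤ × ℕ)} (h : ∀ p ∈ l, coeffAt p.2 l = 0) : vec l = 0 := by
  ext1 m
  rw [vec_apply]
  by_cases hm : ∃ p ∈ l, p.2 = m
  · obtain ⟨p, hp, rfl⟩ := hm
    simp [h p hp]
  · push Not at hm
    simp [coeffAt_of_notMem hm]

lemma lin_apply_eq (T : ℕ → List (ℤ × ℕ)) (z : ℕ →₀ R) :
    lin T z = z.sum fun m a => a • vec (T m) := rfl

lemma eq_zero_of_single {f : (ℕ →₀ R) →ₗ[R] (ℕ →₀ R)} {z : ℕ →₀ R}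
    (h : ∀ m, z m ≠ 0 → f (Finsupp.single m 1) = 0) : f z = 0 := by
  conv_lhs => rw [← Finsupp.sum_single z]
  rw [map_finsuppSum]
  refine Finset.sum_eq_zero fun m hm => ?_
  have : Finsupp.single m (z m) = z m • Finsupp.single m (1 : R) := by simp
  change f (Finsupp.single m (z m)) = 0
  rw [this, map_smul, h m (by simpa using hm), smul_zero]

/-- The number of elements of the simplex with bit mask `m`. -/
def size (m : ℕ) : ℕ := (bits m).length

/-- The simplicial boundary of a simplex. -/
def faces (m : ℕ) : List (ℤ × ℕ) :=
  (bits m).map fun s => ((-1) ^ (bits m).countP (· < s), m - 2 ^ s.val)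

/-- Tables of contractions of the simplicial chain complex of the full simplex, one for each
element of `indices`: the entry at `m` is a list of simplices, with signs, of one dimension more. -/
def table : ℕ → List (List ℤ)
  | 2 =>
    [[1], [], [5,-10,12], [11,-13], [5], [], [7,-11,13], [], [5,12], [-13], [], [], [], [], [15],
     [], [5,12,24], [-13,-25], [-26], [27], [-13,21,-25], [], [23,-27], [], [], [], [], [], [29],
     [], [31], [], [5,12,24,48], [-13,-25,-49], [-13,-25,37,-42,44,-49], [43,-45],
     [-13,-25,37,-49], [], [39,-43,45], [], [-13,-25,37,44,-49], [-45], [], [], [], [], [47], [],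
     [], [], [29,53,-58,60], [59,-61], [53], [], [55,-59,61], [], [29,53,60], [-61], [], [], [],
     [], [63], [], [5,12,24,48,96], [-13,-25,-49,-97], [-13,-25,-49,69,-74,76,-97], [75,-77],
     [-13,-25,-49,69,-97], [], [71,-75,77], [], [-13,-25,-49,69,76,-97], [-77], [], [], [], [],
     [79], [], [-13,-25,-49,69,76,88,-97], [-77,-89], [-90], [91], [-77,85,-89], [], [87,-91], [],
     [], [], [], [], [93], [], [95], [], [], [], [101,-106,108], [107,-109], [101], [],
     [103,-107,109], [], [101,108], [-109], [], [], [], [], [111], [], [29,53,60,101,108,120],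
     [-61,-109,-121], [-122], [123], [-61,-109,117,-121], [], [119,-123], [], [], [], [], [],
     [125], [], [127], []]
  | 3 =>
    [[1], [], [3], [], [3,6], [-7], [], [], [9], [], [11], [], [7,13], [], [15], [], [17], [],
     [19], [], [19,22], [-23], [], [], [25], [], [27], [], [23,29], [], [31], [], [33], [], [35],
     [], [35,38], [-39], [], [], [41], [], [43], [], [39,45], [], [47], [], [49], [], [51], [],
     [51,54], [-55], [], [], [57], [], [59], [], [-31,47,59,62], [-95,111,-119,123,-125,126], [],
     [127], [65], [], [67], [], [67,70], [-71], [], [], [73], [], [75], [], [71,77], [], [79], [],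
     [81], [], [83], [], [83,86], [-87], [], [], [89], [], [91], [], [87,93], [], [95], [], [97],
     [], [99], [], [99,102], [-103], [], [], [105], [], [107], [], [103,109], [], [111], [], [113],
     [], [115], [], [115,118], [-119], [], [], [121], [], [123], [], [-95,111,123,126], [], [], []]
  | 4 =>
    [[1], [], [3], [], [5], [], [7], [], [9], [], [11], [], [37,-41,44], [-45], [15,-45], [], [17],
     [], [19], [], [21], [], [23], [], [25], [], [27], [], [29,-45], [], [31], [], [33], [], [35],
     [], [37], [], [39], [], [41], [], [43], [], [], [], [47], [], [49], [], [51], [], [53], [],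
     [55], [], [57], [], [59], [], [61], [], [63], [], [65], [], [67], [], [69], [], [71], [],
     [73], [], [75], [], [101,-105,108], [-109], [79,-109], [], [81], [], [83], [], [85], [], [87],
     [], [89], [], [91], [], [93,-109], [], [95], [], [97], [], [99], [], [101], [], [103], [],
     [105], [], [107], [], [], [], [111], [], [113], [], [115], [], [117], [], [119], [], [121],
     [], [123], [], [125], [], [127], []]
  | 5 =>
    [[64], [-65], [-66], [67], [-68], [69], [70], [-71], [-72], [73], [74], [-75], [76], [-77],
     [-78], [79], [-80], [81], [82], [-83], [84], [-85], [-86], [87], [88], [-89], [-90], [91],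
     [-92], [93], [94], [-95], [-96], [97], [98], [-99], [100], [-101], [-102], [103], [104],
     [-105], [-106], [107], [-108], [109], [110], [-111], [112], [-113], [-114], [115], [-116],
     [117], [118], [-119], [57,-89,105,-113], [], [-121,122], [-123], [-121,124], [-125], [-126],
     [127], [], [], [], [], [], [], [], [], [], [], [], [], [], [], [], [], [], [], [], [], [], [],
     [], [], [], [], [], [], [], [], [], [], [], [], [], [], [], [], [], [], [], [], [], [], [],
     [], [], [], [], [], [], [], [], [], [], [], [121], [], [], [], [], [], [], []]
  | 6 =>
    [[1], [], [3], [], [5], [], [7], [], [9], [], [11], [], [13], [], [15], [], [17], [], [19], [],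
     [21], [], [23], [], [25], [], [27], [], [29], [], [31], [], [33], [], [35], [], [37], [],
     [39], [], [41], [], [43], [], [45], [], [47], [], [49], [], [51], [], [53], [], [55], [],
     [57], [], [59], [], [61], [], [63], [], [65], [], [67], [], [69], [], [71], [], [73], [],
     [75], [], [77], [], [79], [], [81], [], [83], [], [85], [], [87], [], [89], [], [91], [],
     [93], [], [95], [], [97], [], [99], [], [101], [], [103], [], [105], [], [107], [], [109], [],
     [111], [], [113], [], [115], [], [117], [], [119], [], [121], [], [123], [], [125], [], [127],
     []]
  | 7 =>
    [[1], [], [3], [], [5], [], [7], [], [9], [], [11], [], [13], [], [15], [], [17], [], [19], [],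
     [21], [], [23], [], [25], [], [27], [], [29], [], [31], [], [33], [], [35], [], [37], [],
     [39], [], [41], [], [43], [], [45], [], [47], [], [49], [], [51], [], [53], [], [55], [],
     [57], [], [59], [], [61], [], [63], [], [65], [], [67], [], [69], [], [71], [], [73], [],
     [75], [], [77], [], [79], [], [81], [], [83], [], [85], [], [87], [], [89], [], [91], [],
     [93], [], [95], [], [97], [], [99], [], [101], [], [103], [], [105], [], [107], [], [109], [],
     [111], [], [113], [], [115], [], [117], [], [119], [], [121], [], [123], [],
     [63,-95,111,-119,123,126], [-127], [], []]
  | 8 =>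
    [[64], [-65], [-66], [67], [-68], [69], [70], [-71], [-72], [73], [74], [-75], [76], [-77],
     [-78], [79], [-80], [81], [82], [-83], [84], [-85], [-86], [87], [88], [-89], [-90], [91],
     [-92], [93], [94], [-95], [-96], [97], [98], [-99], [100], [-101], [-102], [103], [104],
     [-105], [-106], [107], [-108], [109], [110], [-111], [112], [-113], [-114], [115], [-116],
     [117], [118], [-119], [-120], [121], [122], [-123], [124], [-125], [-126], [127], [], [], [],
     [], [], [], [], [], [], [], [], [], [], [], [], [], [], [], [], [], [], [], [], [], [], [],
     [], [], [], [], [], [], [], [], [], [], [], [], [], [], [], [], [], [], [], [], [], [], [],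
     [], [], [], [], [], [], [], [], [], [], [], [], [], [], []]
  | 9 =>
    [[64], [-65], [-66], [67], [-68], [69], [70], [-71], [-72], [73], [74], [-75], [76], [-77],
     [-78], [79], [-80], [81], [82], [-83], [84], [-85], [-86], [87], [88], [-89], [-90], [91],
     [-92], [93], [94], [-95], [-96], [97], [98], [-99], [100], [-101], [-102], [103], [104],
     [-105], [-106], [107], [-108], [109], [110], [-111], [112], [-113], [-114], [115], [-116],
     [117], [118], [-119], [-120], [121], [122], [-123], [124], [-125], [-126], [127], [], [], [],
     [], [], [], [], [], [], [], [], [], [], [], [], [], [], [], [], [], [], [], [], [], [], [],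
     [], [], [], [], [], [], [], [], [], [], [], [], [], [], [], [], [], [], [], [], [], [], [],
     [], [], [], [], [], [], [], [], [], [], [], [], [], [], []]
  | 10 =>
    [[1], [], [3], [], [5], [], [7], [], [9], [], [11], [], [13], [], [15], [], [17], [], [19], [],
     [21], [], [23], [], [25], [], [27], [], [29], [], [31], [], [33], [], [35], [], [37], [],
     [39], [], [41], [], [43], [], [45], [], [47], [], [49], [], [51], [], [53], [], [55], [],
     [57], [], [59], [], [61], [], [63], [], [65], [], [67], [], [69], [], [71], [], [73], [],
     [75], [], [77], [], [79], [], [81], [], [83], [], [85], [], [87], [], [89], [], [91], [],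
     [93], [], [95], [], [97], [], [99], [], [101], [], [103], [], [105], [], [107], [], [109], [],
     [111], [], [113], [], [115], [], [117], [], [119], [], [121], [], [123], [], [125], [], [127],
     []]
  | 12 =>
    [[64], [-65], [-66], [67], [-68], [69], [70], [-71], [-72], [73], [74], [-75], [76], [-77],
     [-78], [79], [-80], [81], [82], [-83], [84], [-85], [-86], [87], [88], [-89], [-90], [91],
     [-92], [93], [94], [-95], [-96], [97], [98], [-99], [100], [-101], [-102], [103], [104],
     [-105], [-106], [107], [-108], [109], [110], [-111], [112], [-113], [-114], [115], [-116],
     [117], [118], [-119], [-120], [121], [122], [-123], [124], [-125], [-126], [127], [], [], [],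
     [], [], [], [], [], [], [], [], [], [], [], [], [], [], [], [], [], [], [], [], [], [], [],
     [], [], [], [], [], [], [], [], [], [], [], [], [], [], [], [], [], [], [], [], [], [], [],
     [], [], [], [], [], [], [], [], [], [], [], [], [], [], []]
  | 14 =>
    [[1], [], [3], [], [5], [], [7], [], [9], [], [11], [], [13], [], [15], [], [17], [], [19], [],
     [21], [], [23], [], [25], [], [27], [], [29], [], [31], [], [33], [], [35], [], [37], [],
     [39], [], [41], [], [43], [], [45], [], [47], [], [49], [], [51], [], [53], [], [55], [],
     [57], [], [59], [], [61], [], [63], [], [65], [], [67], [], [69], [], [71], [], [73], [],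
     [75], [], [77], [], [79], [], [81], [], [83], [], [85], [], [87], [], [89], [], [91], [],
     [93], [], [95], [], [97], [], [99], [], [101], [], [103], [], [105], [], [107], [], [109], [],
     [111], [], [113], [], [115], [], [117], [], [119], [], [121], [], [123], [], [125], [], [127],
     []]
  | _ =>
    [[1], [], [3], [], [5], [], [7], [], [9], [], [11], [], [13], [], [15], [], [17], [], [19], [],
     [21], [], [23], [], [25], [], [27], [], [29], [], [31], [], [33], [], [35], [], [37], [],
     [39], [], [41], [], [43], [], [45], [], [47], [], [49], [], [51], [], [53], [], [55], [],
     [57], [], [59], [], [61], [], [63], [], [65], [], [67], [], [69], [], [71], [], [73], [],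
     [75], [], [77], [], [79], [], [81], [], [83], [], [85], [], [87], [], [89], [], [91], [],
     [93], [], [95], [], [97], [], [99], [], [101], [], [103], [], [105], [], [107], [], [109], [],
     [111], [], [113], [], [115], [], [117], [], [119], [], [121], [], [123], [], [125], [], [127],
     []]

/-- The contraction adapted to the `Φ_d`-weights. -/
def contr (d m : ℕ) : List (ℤ × ℕ) := ((table d).getD m []).map fun a => (a.sign, a.natAbs)

/-- The homotopy identity at the simplex `m`. -/
def homotopyCheck (d m : ℕ) : Bool :=
  let l := (-1, m) :: (extend faces (contr d m) ++ extend (contr d) (faces m))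
  l.all fun p => coeffAt p.2 l == 0

set_option maxRecDepth 100000 in
lemma homotopyCheck_all : ∀ d ∈ indices, ∀ m < 128, homotopyCheck d m = true := by
  decide +kernel

/-- The simplicial boundary of the simplicial boundary. -/
lemma faces_faces : ∀ m < 128, ∀ p ∈ extend faces (faces m),
    coeffAt p.2 (extend faces (faces m)) = 0 := by
  decide +kernel

lemma faces_size : ∀ m < 128, ∀ p ∈ faces m, p.2 < 128 ∧ size p.2 + 1 = size m := by
  decide +kernel

lemma wt_faces : ∀ d ∈ indices, ∀ m < 128, ∀ p ∈ faces m, wt d p.2 ≤ wt d m := by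
  decide +kernel

lemma wt_le : ∀ d ∈ indices, ∀ m < 128, wt d m ≤ wt d 127 := by
  decide +kernel

set_option maxRecDepth 100000 in
lemma contr_size : ∀ d ∈ indices, ∀ m < 128, ∀ p ∈ contr d m,
    p.2 < 128 ∧ size p.2 = size m + 1 := by
  decide +kernel

set_option maxRecDepth 100000 in
lemma wt_contr : ∀ d ∈ indices, ∀ m < 128, ∀ p ∈ contr d m,
    wt d p.2 ≤ wt d m ∨ (d = 6 ∧ m = 60) ∨ (d = 6 ∧ m = 62) ∨ m = 0 ∨ m = 126 := by
  decide +kernel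

end Contraction

end E7

namespace E7

section WeightedChains

/-- The boundary map on simplicial chains with coefficients in `R`. -/
noncomputable abbrev bd : (ℕ →₀ R) →ₗ[R] (ℕ →₀ R) := lin faces

/-- The chains of degree `k` all of whose coefficients are divisible by the weight of the
corresponding simplex. -/
noncomputable def chains (k : ℕ) : Submodule R (ℕ →₀ R) where
  carrier := {z | ∀ m, (z m ≠ 0 → m < 128 ∧ size m = k) ∧ weight m ∣ z m}
  zero_mem' := fun m => by simp
  add_mem' := fun {y z} hy hz m => by
    refine ⟨fun h => ?_, dvd_add (hy m).2 (hz m).2⟩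
    by_cases h0 : y m = 0
    · exact (hz m).1 fun h1 => h (by simp [h0, h1])
    · exact (hy m).1 h0
  smul_mem' := fun r z hz m =>
    ⟨fun h => (hz m).1 (right_ne_zero_of_mul h), (hz m).2.mul_left r⟩

/-- The cycles among the weighted chains. -/
noncomputable def cyclesC (k : ℕ) : Submodule R (ℕ →₀ R) := chains k ⊓ LinearMap.ker bd

/-- The boundaries of the weighted chains. -/
noncomputable def boundariesC (k : ℕ) : Submodule R (ℕ →₀ R) := (chains (k + 1)).map bd

lemma single_mem_chains {k m : ℕ} {a : R} (hm : m < 128) (hk : size m = k) (ha : weight m ∣ a) :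
    Finsupp.single m a ∈ chains k := by
  intro n
  rw [Finsupp.single_apply]
  split_ifs with h
  · subst h
    exact ⟨fun _ => ⟨hm, hk⟩, ha⟩
  · simp

lemma smul_vec_mem_chains {k : ℕ} {a : R} : ∀ {l : List (ℤ × ℕ)},
    (∀ p ∈ l, p.2 < 128 ∧ size p.2 = k ∧ weight p.2 ∣ a) → a • vec l ∈ chains k
  | [], _ => by simp [vec_nil]
  | p :: l, h => by
    obtain ⟨h1, h2, h3⟩ := h p (by simp)
    rw [vec_cons, smul_add, Finsupp.smul_single]
    exact add_mem (single_mem_chains h1 h2 (h3.mul_right _))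
      (smul_vec_mem_chains fun p hp => h p (by simp [hp]))

lemma smul_lin_mem_chains {T : ℕ → List (ℤ × ℕ)} {k : ℕ} {a : R} {z : ℕ →₀ R}
    (h : ∀ m, z m ≠ 0 → ∀ p ∈ T m, p.2 < 128 ∧ size p.2 = k ∧ weight p.2 ∣ a * z m) :
    a • lin T z ∈ chains k := by
  rw [lin_apply_eq, Finsupp.smul_sum]
  refine Submodule.sum_mem _ fun m hm => ?_
  change a • z m • vec (T m) ∈ chains k
  rw [smul_smul]
  exact smul_vec_mem_chains (h m (by simpa using hm))

lemma cyc_pow_dvd_weight {d : ℕ} (hd : d ∈ indices) (m : ℕ) : cyc d ^ wt d m ∣ weight m :=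
  Finset.dvd_prod_of_mem _ hd

lemma bd_bd {z : ℕ →₀ R} (hz : ∀ m, z m ≠ 0 → m < 128) : bd (bd z) = 0 := by
  rw [← LinearMap.comp_apply]
  refine eq_zero_of_single fun m hm => ?_
  rw [LinearMap.comp_apply, lin_single, one_smul, lin_vec]
  exact vec_eq_zero (faces_faces m (hz m hm))

lemma homotopy {d : ℕ} (hd : d ∈ indices) {z : ℕ →₀ R} (hz : ∀ m, z m ≠ 0 → m < 128) :
    bd (lin (contr d) z) + lin (contr d) (bd z) = z := by
  have : (bd ∘ₗ lin (contr d) + lin (contr d) ∘ₗ bd - LinearMap.id :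
      (ℕ →₀ R) →ₗ[R] (ℕ →₀ R)) z = 0 := by
    refine eq_zero_of_single fun m hm => ?_
    have h := homotopyCheck_all d hd m (hz m hm)
    simp only [homotopyCheck, List.all_eq_true, beq_iff_eq] at h
    have h := vec_eq_zero h
    rw [vec_cons, vec_append] at h
    simp only [LinearMap.sub_apply, LinearMap.add_apply, LinearMap.comp_apply, lin_single,
      one_smul, lin_vec, LinearMap.id_apply]
    have hneg : Finsupp.single m ((-1 : ℤ) : R) = -Finsupp.single m 1 := by simp
    rw [← h, hneg]
    abel
  simpa [sub_eq_zero] using this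

/-- The prime-to-`Φ_d` part of the largest weight. -/
noncomputable def cofactor (d : ℕ) : R := ∏ e ∈ indices \ {d}, cyc e ^ wt e 127

lemma weight_eq_mul {d : ℕ} (hd : d ∈ indices) (m : ℕ) :
    weight m = (∏ e ∈ indices \ {d}, cyc e ^ wt e m) * cyc d ^ wt d m := by
  rw [weight, ← Finset.prod_sdiff (Finset.singleton_subset_iff.2 hd), Finset.prod_singleton]

lemma weight_dvd_cofactor_mul {d m : ℕ} (hd : d ∈ indices) (hm : m < 128) {a : R}
    (ha : cyc d ^ wt d m ∣ a) : weight m ∣ cofactor d * a := by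
  rw [weight_eq_mul hd]
  refine mul_dvd_mul (Finset.prod_dvd_prod_of_dvd _ _ fun e he => ?_) ha
  exact pow_dvd_pow _ (wt_le e (Finset.mem_sdiff.1 he).1 m hm)

lemma isCoprime_cofactor (d : ℕ) : IsCoprime (cofactor d) (cyc d) := by
  refine IsCoprime.prod_left fun e he => (isCoprime_cyc ?_).pow_left
  simpa using (Finset.mem_sdiff.1 he).2

theorem cofactor_smul_mem {k d : ℕ} (hd : d ∈ indices) {z : ℕ →₀ R} (hz : z ∈ cyclesC k)
    (h : ∀ m, z m ≠ 0 → ∀ p ∈ contr d m, cyc d ^ wt d p.2 ∣ z m) :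
    cofactor d • z ∈ boundariesC k := by
  refine ⟨cofactor d • lin (contr d) z, smul_lin_mem_chains fun m hm p hp => ?_, ?_⟩
  · obtain ⟨h1, h2⟩ := (hz.1 m).1 hm
    obtain ⟨h3, h4⟩ := contr_size d hd m h1 p hp
    exact ⟨h3, by omega, weight_dvd_cofactor_mul hd h3 (h m hm p hp)⟩
  · have := homotopy hd fun m hm => ((hz.1 m).1 hm).1
    rw [LinearMap.mem_ker.1 hz.2, map_zero, add_zero] at this
    rw [map_smul, this]

theorem mem_boundariesC_of_cofactor {k : ℕ} {z : ℕ →₀ R}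
    (h : ∀ d ∈ indices, cofactor d • z ∈ boundariesC k) : z ∈ boundariesC k := by
  obtain ⟨μ, hμ⟩ := (exists_sum_eq_one_iff_pairwise_coprime (s := fun d => cyc d ^ wt d 127)
    (t := indices) ⟨2, by decide⟩).2 fun i j hij =>
      (isCoprime_cyc fun h => hij (Subtype.ext h)).pow
  have : z = ∑ d ∈ indices, μ d • cofactor d • z := by
    simp_rw [smul_smul, ← Finset.sum_smul]
    rw [show ∑ d ∈ indices, μ d * cofactor d = 1 from hμ, one_smul]
  rw [this]
  exact Submodule.sum_mem _ fun d hd => Submodule.smul_mem _ _ (h d hd)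

lemma wt_contr_sixty : ∀ p ∈ contr 6 60, wt 6 p.2 ≤ 1 := by decide +kernel

lemma wt_contr_sixty_two : ∀ p ∈ contr 6 62, wt 6 p.2 ≤ 2 := by decide +kernel

theorem mem_boundariesC {k : ℕ} (h0 : k ≠ 0) (h6 : k ≠ 6) {z : ℕ →₀ R} (hz : z ∈ cyclesC k)
    (h60 : cyc 6 ∣ z 60) (h62 : cyc 6 ^ 2 ∣ z 62) : z ∈ boundariesC k := by
  refine mem_boundariesC_of_cofactor fun d hd => cofactor_smul_mem hd hz fun m hm p hp => ?_
  obtain ⟨h1, h2⟩ := (hz.1 m).1 hm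
  rcases wt_contr d hd m h1 p hp with h | ⟨rfl, rfl⟩ | ⟨rfl, rfl⟩ | rfl | rfl
  · exact (pow_dvd_pow _ h).trans ((cyc_pow_dvd_weight hd m).trans (hz.1 m).2)
  · exact ((pow_dvd_pow _ (wt_contr_sixty p hp)).trans (by simp)).trans h60
  · exact (pow_dvd_pow _ (wt_contr_sixty_two p hp)).trans h62
  · exact absurd h2.symm h0
  · exact absurd h2.symm h6

lemma apply_eq_zero {k m : ℕ} {z : ℕ →₀ R} (hz : z ∈ cyclesC k) (hk : size m ≠ k) : z m = 0 := by
  by_contra h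
  exact hk ((hz.1 m).1 h).2

theorem mem_boundariesC_of_acyclic {k : ℕ} (h0 : k ≠ 0) (h4 : k ≠ 4) (h5 : k ≠ 5) (h6 : k ≠ 6)
    {z : ℕ →₀ R} (hz : z ∈ cyclesC k) : z ∈ boundariesC k := by
  refine mem_boundariesC h0 h6 hz ?_ ?_
  · rw [apply_eq_zero hz (show size 60 ≠ k from h4.symm)]
    exact dvd_zero _
  · rw [apply_eq_zero hz (show size 62 ≠ k from h5.symm)]
    exact dvd_zero _

lemma dvd_bd_apply {k n : ℕ} {c : R} {z : ℕ →₀ R} (hz : z ∈ chains k)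
    (h : ∀ m < 128, size m = k → ∀ p ∈ faces m, p.2 = n → c ∣ weight m) : c ∣ bd z n := by
  rw [lin_apply_eq, Finsupp.sum, Finsupp.finsetSum_apply]
  refine Finset.dvd_sum fun m hm => ?_
  rw [Finsupp.smul_apply, smul_eq_mul, vec_apply]
  obtain ⟨h1, h2⟩ := (hz m).1 (by simpa using hm)
  by_cases hn : ∃ p ∈ faces m, p.2 = n
  · obtain ⟨p, hp, hpn⟩ := hn
    exact ((h m h1 h2 p hp hpn).trans (hz m).2).mul_right _
  · push Not at hn
    simp [coeffAt_of_notMem hn]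

/-- The homology of the weighted chains in degree `k` is generated by the class of `z` with
annihilator generated by `c`. -/
def IsGenerator (k : ℕ) (c : R) (z : ℕ →₀ R) : Prop :=
  z ∈ cyclesC k ∧ (∀ y ∈ cyclesC k, ∃ r : R, y - r • z ∈ boundariesC k) ∧
    ∀ r : R, r • z ∈ boundariesC k ↔ c ∣ r

end WeightedChains

end E7

namespace E7

section Generators

lemma isGenerator_zero : IsGenerator 0 (cyc 2) (Finsupp.single 0 1) := by
  have hw : weight 1 = cyc 2 := by
    rw [weight_eq_mul (d := 2) (by decide), Finset.prod_eq_one fun e he => ?_, one_mul,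
      show wt 2 1 = 1 by decide, pow_one]
    rw [(by decide : ∀ e ∈ indices \ {2}, wt e 1 = 0) e he, pow_zero]
  refine ⟨⟨single_mem_chains (by norm_num) rfl ?_, ?_⟩, fun y hy => ⟨y 0, ?_⟩,
    fun r => ⟨?_, ?_⟩⟩
  · have : weight 0 = 1 := Finset.prod_eq_one fun e he => by
      rw [(by decide : ∀ e ∈ indices, wt e 0 = 0) e he, pow_zero]
    rw [this]
  · rw [SetLike.mem_coe, LinearMap.mem_ker, lin_single, show faces 0 = [] by decide,
      vec_nil, smul_zero]
  · have : y - y 0 • Finsupp.single 0 1 = 0 := by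
      ext1 m
      by_cases hm : m = 0
      · simp [hm]
      · have : y m = 0 := by
          by_contra h
          obtain ⟨h1, h2⟩ := (hy.1 m).1 h
          exact hm ((by decide +kernel : ∀ m < 128, size m = 0 → m = 0) m h1 h2)
        simp [this, Ne.symm hm]
    rw [this]
    exact zero_mem _
  · rintro ⟨b, hb, h⟩
    have h0 : bd b 0 = r := by
      rw [h]
      simp
    rw [← h0]
    refine dvd_bd_apply hb fun m hm hs _ _ _ => ?_
    have h2 := cyc_pow_dvd_weight (d := 2) (by decide) m
    rwa [(by decide +kernel : ∀ m < 128, size m = 0 + 1 → wt 2 m = 1) m hm hs, pow_one] at h2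
  · intro h
    refine ⟨Finsupp.single 1 r, single_mem_chains (by norm_num) rfl (by rwa [hw]), ?_⟩
    rw [lin_single, show faces 1 = [(1, 0)] by decide]
    simp [vec]

theorem isGenerator_of_face {k m₀ n₀ j : ℕ} (hm₀ : m₀ < 128) (hs : size m₀ = k + 1)
    (hc : coeffAt n₀ (faces m₀) = 1) (hw : ∀ p ∈ faces m₀, wt 6 p.2 ≤ j)
    (hm : wt 6 m₀ = j + 1) (hn : wt 6 n₀ = j)
    (hcof : ∀ m < 128, size m = k + 1 → ∀ p ∈ faces m, p.2 = n₀ → j + 1 ≤ wt 6 m)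
    (hB : ∀ z ∈ cyclesC k, cyc 6 ^ (j + 1) ∣ z n₀ → z ∈ boundariesC k) :
    IsGenerator k (cyc 6) ((cofactor 6 * cyc 6 ^ j) • vec (faces m₀)) := by
  have h6 : 6 ∈ indices := by decide
  have hbd (a : R) : bd (Finsupp.single m₀ a) = a • vec (faces m₀) := lin_single _ _ _
  have hz : (cofactor 6 * cyc 6 ^ j) • vec (faces m₀) ∈ cyclesC k := by
    refine ⟨smul_vec_mem_chains fun p hp => ?_, ?_⟩
    · obtain ⟨h1, h2⟩ := faces_size m₀ hm₀ p hp
      exact ⟨h1, by omega, weight_dvd_cofactor_mul h6 h1 (pow_dvd_pow _ (hw p hp))⟩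
    · rw [SetLike.mem_coe, LinearMap.mem_ker, ← hbd]
      refine bd_bd fun m h => ?_
      rw [Finsupp.single_apply] at h
      split_ifs at h with h'
      · exact h' ▸ hm₀
      · exact absurd rfl h
  refine ⟨hz, fun y hy => ?_, fun r => ⟨?_, ?_⟩⟩
  · obtain ⟨a, ha⟩ := (cyc_pow_dvd_weight h6 n₀).trans (hy.1 n₀).2
    obtain ⟨u, v, huv⟩ := isCoprime_cofactor 6
    refine ⟨u * a, hB _ (sub_mem hy (Submodule.smul_mem _ _ hz)) ⟨a * v, ?_⟩⟩
    rw [Finsupp.sub_apply, Finsupp.smul_apply, Finsupp.smul_apply, vec_apply, hc, ha, hn]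
    simp only [smul_eq_mul, Int.cast_one]
    linear_combination (-(cyc 6 ^ j * a)) * huv
  · rintro ⟨b, hb, h⟩
    have h1 : cyc 6 ^ (j + 1) ∣ bd b n₀ := dvd_bd_apply hb fun m hm hs p hp hpn =>
      (pow_dvd_pow _ (hcof m hm hs p hp hpn)).trans (cyc_pow_dvd_weight h6 m)
    rw [h, Finsupp.smul_apply, Finsupp.smul_apply, vec_apply, hc] at h1
    have h2 : cyc 6 ^ j * cyc 6 ∣ cyc 6 ^ j * (r * cofactor 6) := by
      rw [← pow_succ]
      convert h1 using 1
      simp only [smul_eq_mul, Int.cast_one]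
      ring
    exact (isCoprime_cofactor 6).symm.dvd_of_dvd_mul_right
      ((mul_dvd_mul_iff_left (pow_ne_zero _ (cyc_ne_zero 6))).1 h2)
  · rintro ⟨a, rfl⟩
    refine ⟨Finsupp.single m₀ (cofactor 6 * (cyc 6 ^ (j + 1) * a)),
      single_mem_chains hm₀ hs (weight_dvd_cofactor_mul h6 hm₀ ?_), ?_⟩
    · rw [hm]
      exact dvd_mul_right _ _
    · rw [hbd, smul_smul]
      congr 1
      ring

lemma isGenerator_four :
    IsGenerator 4 (cyc 6) ((cofactor 6 * cyc 6 ^ 0) • vec (faces 61)) := by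
  refine isGenerator_of_face (n₀ := 60) (by decide) (by decide) (by decide) (by decide)
    (by decide) (by decide) (by decide +kernel) fun z hz h => mem_boundariesC (by decide)
      (by decide) hz (by simpa using h) ?_
  rw [apply_eq_zero hz (by decide)]
  exact dvd_zero _

lemma isGenerator_five :
    IsGenerator 5 (cyc 6) ((cofactor 6 * cyc 6 ^ 1) • vec (faces 63)) := by
  refine isGenerator_of_face (n₀ := 62) (by decide) (by decide) (by decide) (by decide)
    (by decide) (by decide) (by decide +kernel) fun z hz h => mem_boundariesC (by decide)
      (by decide) hz ?_ h
  rw [apply_eq_zero hz (by decide)]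
  exact dvd_zero _

/-- The maximal `Φ_d`-weight of a facet of the full simplex. -/
def facetWt (d : ℕ) : ℕ := if d ∈ [2, 6, 14, 18] then wt d 127 - 1 else wt d 127

/-- The least common multiple of the weights of the facets of the full simplex. -/
noncomputable def facetWeight : R := ∏ d ∈ indices, cyc d ^ facetWt d

lemma facetWeight_ne_zero : facetWeight ≠ 0 :=
  Finset.prod_ne_zero_iff.2 fun d _ => pow_ne_zero _ (cyc_ne_zero d)

lemma weight_full : weight 127 = (cyc 2 * (cyc 6 * (cyc 14 * cyc 18))) * facetWeight := by
  have h : ∏ d ∈ indices, cyc d ^ (wt d 127 - facetWt d) =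
      cyc 2 * (cyc 6 * (cyc 14 * cyc 18)) := by
    have : ∏ d ∈ ({2, 6, 14, 18} : Finset ℕ), cyc d ^ (wt d 127 - facetWt d) =
        ∏ d ∈ indices, cyc d ^ (wt d 127 - facetWt d) :=
      Finset.prod_subset (by decide) fun d hd hd' => by
        rw [(by decide : ∀ d ∈ indices, d ∉ ({2, 6, 14, 18} : Finset ℕ) →
          wt d 127 - facetWt d = 0) d hd hd', pow_zero]
    rw [← this, Finset.prod_congr rfl fun d hd => by
      rw [(by decide : ∀ d ∈ ({2, 6, 14, 18} : Finset ℕ), wt d 127 - facetWt d = 1) d hd,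
        pow_one]]
    simp
  rw [← h, facetWeight, ← Finset.prod_mul_distrib, weight]
  refine Finset.prod_congr rfl fun d hd => ?_
  rw [← pow_add, Nat.sub_add_cancel ((by decide : ∀ d ∈ indices, facetWt d ≤ wt d 127) d hd)]

lemma eq_single_of_mem_chains {b : ℕ →₀ R} (hb : ∀ m, b m ≠ 0 → m < 128 ∧ size m = 7) :
    b = Finsupp.single 127 (b 127) := by
  ext1 m
  rw [Finsupp.single_apply]
  split_ifs with h
  · rw [h]
  · by_contra h0
    obtain ⟨h1, h2⟩ := hb m h0
    exact h ((by decide +kernel : ∀ m < 128, size m = 7 → m = 127) m h1 h2).symm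

lemma isGenerator_six : IsGenerator 6 (cyc 2 * (cyc 6 * (cyc 14 * cyc 18)))
    (facetWeight • vec (faces 127)) := by
  have hbd (a : R) : bd (Finsupp.single 127 a) = a • vec (faces 127) := lin_single _ _ _
  have h127 : ∀ a : R, ∀ m, Finsupp.single 127 a m ≠ 0 → m < 128 := fun a m h => by
    rw [Finsupp.single_apply] at h
    split_ifs at h with h'
    · omega
    · exact absurd rfl h
  refine ⟨⟨smul_vec_mem_chains fun p hp => ?_, ?_⟩, fun y hy => ?_, fun r => ⟨?_, ?_⟩⟩
  · obtain ⟨h1, h2⟩ := faces_size 127 (by norm_num) p hp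
    refine ⟨h1, by simpa using h2.trans (by decide : size 127 = 7),
      Finset.prod_dvd_prod_of_dvd _ _ fun d hd => pow_dvd_pow _ ?_⟩
    exact (by decide +kernel : ∀ d ∈ indices, ∀ p ∈ faces 127, wt d p.2 ≤ facetWt d) d hd p hp
  · rw [SetLike.mem_coe, LinearMap.mem_ker, ← hbd]
    exact bd_bd (h127 _)
  · have hy' := homotopy (d := 14) (by decide) fun m hm => ((hy.1 m).1 hm).1
    rw [LinearMap.mem_ker.1 hy.2, map_zero, add_zero] at hy'
    have hb := eq_single_of_mem_chains (b := lin (contr 14) y) fun m hm => by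
      by_contra h
      refine hm ?_
      rw [lin_apply_eq, Finsupp.sum, Finsupp.finsetSum_apply]
      refine Finset.sum_eq_zero fun n hn => ?_
      obtain ⟨h1, h2⟩ := (hy.1 n).1 (by simpa using hn)
      rw [Finsupp.smul_apply, vec_apply, coeffAt_of_notMem, Int.cast_zero, smul_zero]
      rintro p hp rfl
      obtain ⟨h3, h4⟩ := contr_size 14 (by decide) n h1 p hp
      exact h ⟨h3, by omega⟩
    generalize lin (contr 14) y 127 = a at hb
    rw [hb, hbd] at hy'
    have ha : facetWeight ∣ a := by
      refine Finset.prod_dvd_of_coprime (fun i _ j _ hij => (isCoprime_cyc hij).pow) fun d hd => ?_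
      obtain ⟨p, hp, h1, h2⟩ := (by decide +kernel : ∀ d ∈ indices, ∃ p ∈ faces 127,
        wt d p.2 = facetWt d ∧ (coeffAt p.2 (faces 127) = 1 ∨ coeffAt p.2 (faces 127) = -1)) d hd
      have h3 := (cyc_pow_dvd_weight hd p.2).trans (hy.1 p.2).2
      rw [← hy', h1, Finsupp.smul_apply, vec_apply] at h3
      rcases h2 with h2 | h2 <;> simpa [h2] using h3
    obtain ⟨c, rfl⟩ := ha
    refine ⟨c, ?_⟩
    rw [← hy', smul_smul, mul_comm c, sub_self]
    exact zero_mem _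
  · rintro ⟨b, hb, h⟩
    have hb' := eq_single_of_mem_chains fun m hm => (hb m).1 hm
    have hw := (hb 127).2
    generalize b 127 = a at hb' hw
    rw [hb', hbd, smul_smul] at h
    have h := DFunLike.congr_fun h 126
    rw [Finsupp.smul_apply, Finsupp.smul_apply, vec_apply,
      (by decide : coeffAt 126 (faces 127) = 1)] at h
    simp only [smul_eq_mul, Int.cast_one, mul_one] at h
    rw [h, weight_full] at hw
    exact (mul_dvd_mul_iff_right facetWeight_ne_zero).1 hw
  · intro h
    refine ⟨Finsupp.single 127 (r * facetWeight),
      single_mem_chains (by norm_num) (by decide) ?_, ?_⟩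
    · rw [weight_full]
      exact mul_dvd_mul_right h _
    · rw [hbd, smul_smul]

lemma eq_zero_of_mem_cyclesC {k : ℕ} (hk : 7 ≤ k) {z : ℕ →₀ R} (hz : z ∈ cyclesC k) : z = 0 := by
  have hz' := homotopy (d := 14) (by decide) fun m hm => ((hz.1 m).1 hm).1
  rw [LinearMap.mem_ker.1 hz.2, map_zero, add_zero] at hz'
  rw [← hz', lin_apply_eq (contr 14), Finsupp.sum, Finset.sum_eq_zero, map_zero]
  intro m hm
  obtain ⟨h1, h2⟩ := (hz.1 m).1 (by simpa using hm)
  rw [(by decide +kernel : ∀ m < 128, 7 ≤ size m → contr 14 m = []) m h1 (by omega), vec_nil,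
    smul_zero]

end Generators

end E7

namespace E7

section Transfer

lemma size_mask (σ : Finset (Fin 7)) : size (mask σ) = σ.card := by
  revert σ; decide +kernel

lemma mem_bits_mask {σ : Finset (Fin 7)} {s : Fin 7} : s ∈ bits (mask σ) ↔ s ∈ σ := by
  rw [← List.mem_toFinset, bits_mask]

lemma mask_erase {σ : Finset (Fin 7)} {s : Fin 7} (hs : s ∈ σ) :
    mask (σ.erase s) = mask σ - 2 ^ s.val := by
  rw [mask, mask, ← Finset.add_sum_erase σ _ hs, Nat.add_sub_cancel_left]

lemma countP_bits_mask (σ : Finset (Fin 7)) (s : Fin 7) :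
    (bits (mask σ)).countP (· < s) = (σ.filter (fun t => t < s)).card := by
  revert σ s; decide +kernel

lemma vec_faces_mask (σ : Finset (Fin 7)) :
    vec (faces (mask σ)) = ∑ s ∈ σ, Finsupp.single (mask (σ.erase s))
      ((-1 : R) ^ (σ.filter (fun t => t < s)).card) := by
  have h : (bits (mask σ)).Nodup := (List.nodup_finRange 7).filter _
  conv_rhs => enter [1]; rw [← bits_mask σ]
  rw [List.sum_toFinset _ h, vec, faces, List.map_map]
  congr 1
  refine List.map_congr_left fun s hs => ?_
  simp only [Function.comp_apply]
  rw [countP_bits_mask, mask_erase (mem_bits_mask.1 hs)]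
  simp

variable {W : Type*} [Group W] {M : CoxeterMatrix (Fin 7)}
  (cs : CoxeterSystem M W)

lemma poin_eq_prod (hM : IsE7 M) (σ : Finset (Fin 7)) :
    poin cs σ = ∏ d ∈ indices, cyclotomic d ℚ ^ wt d (mask σ) := by
  refine Polynomial.toLaurent_injective ?_
  rw [(poin_mask cs hM σ).2, weight, map_prod]
  simp_rw [map_pow]
  rfl

lemma weight_mul_toLaurent_div (hM : IsE7 M) {σ : Finset (Fin 7)} {s : Fin 7} (hs : s ∈ σ) :
    weight (mask (σ.erase s)) * Polynomial.toLaurent (poin cs σ / poin cs (σ.erase s)) =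
      weight (mask σ) := by
  rw [← (poin_mask cs hM σ).2, ← (poin_mask cs hM (σ.erase s)).2, ← map_mul,
    EuclideanDomain.mul_div_cancel']
  · intro h
    refine weight_ne_zero (mask (σ.erase s)) ?_
    rw [← (poin_mask cs hM _).2, h, map_zero]
  · rw [poin_eq_prod cs hM, poin_eq_prod cs hM]
    refine Finset.prod_dvd_prod_of_dvd _ _ fun d hd => pow_dvd_pow _ ?_
    rw [mask_erase hs]
    exact wt_faces d hd _ (mask_lt σ) _ (List.mem_map_of_mem (mem_bits_mask.2 hs))

/-- The embedding of the weighted complex in the simplicial chain complex which rescales each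
simplex by its weight. -/
noncomputable def toChain (k : ℕ) : (KW cs k → R) →ₗ[R] (ℕ →₀ R) :=
  Fintype.linearCombination R fun σ : KW cs k => Finsupp.single (mask σ.1) (weight (mask σ.1))

lemma toChain_eq {k : ℕ} (c : KW cs k → R) :
    toChain cs k c = ∑ σ : KW cs k, Finsupp.single (mask σ.1) (c σ * weight (mask σ.1)) := by
  simp [toChain, Fintype.linearCombination_apply]

lemma toChain_apply_mask {k : ℕ} (c : KW cs k → R) (σ : KW cs k) :
    toChain cs k c (mask σ.1) = c σ * weight (mask σ.1) := by
  rw [toChain_eq, Finsupp.finsetSum_apply, Finset.sum_eq_single σ]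
  · simp
  · intro τ _ h
    rw [Finsupp.single_apply, if_neg fun h' => h (Subtype.ext (mask_injective h'))]
  · simp

lemma toChain_apply_of_ne {k : ℕ} (c : KW cs k → R) {m : ℕ} (hm : ∀ σ : KW cs k, mask σ.1 ≠ m) :
    toChain cs k c m = 0 := by
  rw [toChain_eq, Finsupp.finsetSum_apply]
  exact Finset.sum_eq_zero fun σ _ => by rw [Finsupp.single_apply, if_neg (hm σ)]

lemma toChain_injective (k : ℕ) : Function.Injective (toChain cs k) := by
  intro c c' h
  ext1 σ
  have := DFunLike.congr_fun h (mask σ.1)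
  rw [toChain_apply_mask, toChain_apply_mask] at this
  exact mul_right_cancel₀ (weight_ne_zero _) this

lemma toChain_mem (k : ℕ) (c : KW cs k → R) : toChain cs k c ∈ chains k := by
  rw [toChain_eq]
  refine Submodule.sum_mem _ fun σ _ => single_mem_chains (mask_lt _) ?_ (dvd_mul_left _ _)
  rw [size_mask, σ.2.1]

lemma exists_toChain_eq (hM : IsE7 M) {k : ℕ} {z : ℕ →₀ R} (hz : z ∈ chains k) :
    ∃ c, toChain cs k c = z := by
  choose c hc using fun σ : KW cs k => (hz (mask σ.1)).2
  refine ⟨c, ?_⟩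
  ext1 m
  by_cases hm : ∃ σ : KW cs k, mask σ.1 = m
  · obtain ⟨σ, rfl⟩ := hm
    rw [toChain_apply_mask, hc, mul_comm]
  · push Not at hm
    rw [toChain_apply_of_ne cs c hm]
    by_contra h
    obtain ⟨h1, h2⟩ := (hz m).1 (Ne.symm h)
    refine hm ⟨(bits m).toFinset, ?_, (poin_mask cs hM _).1⟩ (mask_bits m h1)
    rw [← size_mask, mask_bits m h1, h2]

lemma toChain_bdry (hM : IsE7 M) (k : ℕ) (c : KW cs (k + 1) → R) :
    toChain cs k (bdry cs k c) = bd (toChain cs (k + 1) c) := by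
  suffices h : toChain cs k ∘ₗ bdry cs k = bd ∘ₗ toChain cs (k + 1) from
    LinearMap.congr_fun h c
  refine LinearMap.pi_ext' fun σ => LinearMap.ext_ring ?_
  have h1 : bdry cs k (Pi.single σ 1) = fun τ : KW cs k => bcoeff cs σ.1 τ.1 := by
    ext1 τ
    simp [bdry]
  have h2 : toChain cs (k + 1) (Pi.single σ 1) =
      Finsupp.single (mask σ.1) (weight (mask σ.1)) := by
    rw [toChain, Fintype.linearCombination_apply_single, one_smul]
  simp only [LinearMap.comp_apply, LinearMap.coe_single]
  rw [h1, h2, lin_single, vec_faces_mask, Finset.smul_sum, toChain_eq]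
  simp_rw [bcoeff, Finset.sum_mul, Finsupp.single_finsetSum]
  rw [Finset.sum_comm]
  refine Finset.sum_congr rfl fun s hs => ?_
  rw [Finset.sum_eq_single (⟨σ.1.erase s, by rw [Finset.card_erase_of_mem hs, σ.2.1]; rfl,
    (poin_mask cs hM _).1⟩ : KW cs k)]
  · rw [if_pos rfl, Finsupp.smul_single, smul_eq_mul, mul_assoc,
      mul_comm (Polynomial.toLaurent _), weight_mul_toLaurent_div cs hM hs, mul_comm]
  · intro τ _ h
    rw [if_neg fun h' => h (Subtype.ext h'), zero_mul, Finsupp.single_zero]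
  · simp

lemma toChain_mem_cyclesC (hM : IsE7 M) {k : ℕ} (c : KW cs k → R) :
    toChain cs k c ∈ cyclesC k ↔ c ∈ cycles cs k := by
  cases k with
  | zero =>
    refine ⟨fun _ => Submodule.mem_top, fun _ => ⟨toChain_mem cs 0 c, ?_⟩⟩
    rw [SetLike.mem_coe, LinearMap.mem_ker]
    refine eq_zero_of_single fun m hm => ?_
    obtain ⟨h1, h2⟩ := (toChain_mem cs 0 c m).1 hm
    have : faces m = [] := by simpa [faces, size] using h2
    rw [lin_single, this, vec_nil, smul_zero]
  | succ k =>
    rw [cyclesC, Submodule.mem_inf, and_iff_right (toChain_mem cs _ c), LinearMap.mem_ker,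
      ← toChain_bdry cs hM, cycles, LinearMap.mem_ker, map_eq_zero_iff _ (toChain_injective cs k)]

lemma toChain_mem_boundariesC (hM : IsE7 M) {k : ℕ} (c : KW cs k → R) :
    toChain cs k c ∈ boundariesC k ↔ c ∈ LinearMap.range (bdry cs k) := by
  constructor
  · rintro ⟨b, hb, h⟩
    obtain ⟨b, rfl⟩ := exists_toChain_eq cs hM hb
    rw [← toChain_bdry cs hM] at h
    exact ⟨b, toChain_injective cs k h⟩
  · rintro ⟨b, rfl⟩
    exact ⟨toChain cs (k + 1) b, toChain_mem cs _ b, (toChain_bdry cs hM k b).symm⟩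

theorem subsingleton_Hgy (hM : IsE7 M) {k : ℕ} (h : ∀ z ∈ cyclesC k, z ∈ boundariesC k) :
    Subsingleton (Hgy cs k) := by
  refine Submodule.Quotient.subsingleton_iff.2 (eq_top_iff.2 ?_)
  intro c _
  exact (toChain_mem_boundariesC cs hM c.1).1 (h _ ((toChain_mem_cyclesC cs hM c.1).2 c.2))

theorem nonempty_Hgy_equiv (hM : IsE7 M) {k : ℕ} {a : R} {z : ℕ →₀ R} (h : IsGenerator k a z) :
    Nonempty (Hgy cs k ≃ₗ[R] R ⧸ Ideal.span {a}) := by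
  obtain ⟨hz, h1, h2⟩ := h
  obtain ⟨c, rfl⟩ := exists_toChain_eq cs hM hz.1
  let v : cycles cs k := ⟨c, (toChain_mem_cyclesC cs hM c).1 hz⟩
  let N := Submodule.comap (cycles cs k).subtype (LinearMap.range (bdry cs k))
  let f : R →ₗ[R] Hgy cs k := LinearMap.toSpanSingleton R _ (N.mkQ v)
  have hf (r : R) : f r = N.mkQ (r • v) := by simp [f]
  have hsurj : Function.Surjective f := by
    intro x
    obtain ⟨y, rfl⟩ := N.mkQ_surjective x
    obtain ⟨r, hr⟩ := h1 _ ((toChain_mem_cyclesC cs hM y.1).2 y.2)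
    refine ⟨r, ?_⟩
    rw [hf, eq_comm, ← sub_eq_zero, ← map_sub, Submodule.mkQ_apply, Submodule.Quotient.mk_eq_zero]
    rw [← map_smul, ← map_sub, toChain_mem_boundariesC cs hM] at hr
    exact hr
  have hker : LinearMap.ker f = Ideal.span {a} := by
    ext r
    rw [LinearMap.mem_ker, hf, Submodule.mkQ_apply, Submodule.Quotient.mk_eq_zero,
      Ideal.mem_span_singleton, ← h2 r, ← map_smul, toChain_mem_boundariesC cs hM]
    rfl
  exact ⟨(f.quotKerEquivOfSurjective hsurj).symm.trans (Submodule.quotEquivOfEq _ _ hker)⟩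

/-- The Chinese remainder theorem for principal ideals, as a linear equivalence. -/
theorem nonempty_quotient_mul_equiv {A : Type*} [CommRing A] {a b : A} (h : IsCoprime a b) :
    Nonempty ((A ⧸ Ideal.span {a * b}) ≃ₗ[A] (A ⧸ Ideal.span {a}) × (A ⧸ Ideal.span {b})) := by
  let f : A →ₗ[A] (A ⧸ Ideal.span {a}) × (A ⧸ Ideal.span {b}) :=
    (Submodule.mkQ (Ideal.span {a})).prod (Submodule.mkQ (Ideal.span {b}))
  have hsurj : Function.Surjective f := by
    rintro ⟨x, y⟩
    obtain ⟨x, rfl⟩ := Submodule.mkQ_surjective _ x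
    obtain ⟨y, rfl⟩ := Submodule.mkQ_surjective _ y
    obtain ⟨u, v, huv⟩ := h
    refine ⟨x * (v * b) + y * (u * a), Prod.ext ?_ ?_⟩
    · refine (Submodule.Quotient.eq _).2 (Ideal.mem_span_singleton.2 ⟨u * (y - x), ?_⟩)
      linear_combination x * huv
    · refine (Submodule.Quotient.eq _).2 (Ideal.mem_span_singleton.2 ⟨v * (x - y), ?_⟩)
      linear_combination y * huv
  have hker : LinearMap.ker f = Ideal.span {a * b} := by
    rw [LinearMap.ker_prod, Submodule.ker_mkQ, Submodule.ker_mkQ]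
    ext x
    simp only [Submodule.mem_inf, Ideal.mem_span_singleton]
    exact ⟨fun hx => h.mul_dvd hx.1 hx.2,
      fun hx => ⟨(dvd_mul_right a b).trans hx, (dvd_mul_left b a).trans hx⟩⟩
  exact ⟨(Submodule.quotEquivOfEq _ _ hker.symm).trans (f.quotKerEquivOfSurjective hsurj)⟩

end Transfer

end E7

/-- Homology of the weighted complex for the Coxeter system of type `E₇` (generators indexed by `0,…,6` corresponding to `1,…,7`). -/
theorem homology_E7 {W : Type*} [Group W] {Mat : CoxeterMatrix (Fin 7)}
    (cs : CoxeterSystem Mat W)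
    (hM : ∀ i j : Fin 7, i.val < j.val →
      Mat.M i j = (if (i.val, j.val) ∈ ([(0, 2), (1, 3), (2, 3), (3, 4), (4, 5), (5, 6)] : List (ℕ × ℕ)) then 3 else 2)) :
    Nonempty (Hgy cs 0 ≃ₗ[R] (CycQuot 2)) ∧
    Subsingleton (Hgy cs 1) ∧
    Subsingleton (Hgy cs 2) ∧
    Subsingleton (Hgy cs 3) ∧
    Nonempty (Hgy cs 4 ≃ₗ[R] (CycQuot 6)) ∧
    Nonempty (Hgy cs 5 ≃ₗ[R] (CycQuot 6)) ∧
    Nonempty (Hgy cs 6 ≃ₗ[R] (CycQuot 2 × CycQuot 6 × CycQuot 14 × CycQuot 18)) ∧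
    (∀ k, 7 ≤ k → Subsingleton (Hgy cs k)) := by
  have hE : E7.IsE7 Mat := hM
  refine ⟨E7.nonempty_Hgy_equiv cs hE E7.isGenerator_zero,
    E7.subsingleton_Hgy cs hE fun z hz => E7.mem_boundariesC_of_acyclic
      (by decide) (by decide) (by decide) (by decide) hz,
    E7.subsingleton_Hgy cs hE fun z hz => E7.mem_boundariesC_of_acyclic
      (by decide) (by decide) (by decide) (by decide) hz,
    E7.subsingleton_Hgy cs hE fun z hz => E7.mem_boundariesC_of_acyclic
      (by decide) (by decide) (by decide) (by decide) hz,
    E7.nonempty_Hgy_equiv cs hE E7.isGenerator_four,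
    E7.nonempty_Hgy_equiv cs hE E7.isGenerator_five, ?_,
    fun k hk => E7.subsingleton_Hgy cs hE fun z hz => ?_⟩
  · have h (d e : ℕ) (hde : d ≠ e) : IsCoprime (cyc d) (cyc e) := E7.isCoprime_cyc hde
    obtain ⟨e₆⟩ := E7.nonempty_Hgy_equiv cs hE E7.isGenerator_six
    obtain ⟨f₁⟩ := E7.nonempty_quotient_mul_equiv ((h 2 6 (by decide)).mul_right
      ((h 2 14 (by decide)).mul_right (h 2 18 (by decide))))
    obtain ⟨f₂⟩ := E7.nonempty_quotient_mul_equiv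
      ((h 6 14 (by decide)).mul_right (h 6 18 (by decide)))
    obtain ⟨f₃⟩ := E7.nonempty_quotient_mul_equiv (h 14 18 (by decide))
    exact ⟨e₆.trans (f₁.trans ((LinearEquiv.refl R _).prodCongr
      (f₂.trans ((LinearEquiv.refl R _).prodCongr f₃))))⟩
  · rw [E7.eq_zero_of_mem_cyclesC hk hz]
    exact zero_mem _
end

section
/- Let (W,S) be the Coxeter system of type E_8: S = {1,...,8} with m(1,3) = m(3,4) = m(4,5) = m(5,6) = m(6,7) = m(7,8) = m(2,4) = 3 and all other pairs commuting (m = 2). Then the homology of the weighted complex C_*(W) is: H_0 ≅ R/(Φ_2); H_1 = H_2 = H_3 = 0; H_4 ≅ R/(Φ_4); H_5 = 0; H_6 ≅ R/(Φ_8) ⊕ R/(Φ_12); H_7 ≅ R/(Φ_2) ⊕ R/(Φ_3) ⊕ R/(Φ_4) ⊕ R/(Φ_5) ⊕ R/(Φ_6) ⊕ R/(Φ_8) ⊕ R/(Φ_10) ⊕ R/(Φ_12) ⊕ R/(Φ_15) ⊕ R/(Φ_20) ⊕ R/(Φ_24) ⊕ R/(Φ_30); and H_k = 0 for all k ≥ 8.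 -/
open Polynomial CoxeterSystem

set_option synthInstance.maxHeartbeats 1000000
set_option maxHeartbeats 1000000

section SimplexChains

variable {B : Type*} [LinearOrder B] {A : Type*} [CommRing A]

/-- The sign with which `τ` occurs in the simplicial boundary of `insert s τ`. -/
def faceSign (A : Type*) [CommRing A] (τ : Finset B) (s : B) : A :=
  (-1) ^ (τ.filter (fun t => t < s)).card

theorem faceSign_mul_self (τ : Finset B) (s : B) : faceSign A τ s * faceSign A τ s = 1 := by
  unfold faceSign
  rw [← mul_pow]; simp

theorem faceSign_insert (τ : Finset B) {s t : B} (hs : s ∉ τ) :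
    faceSign A (insert s τ) t = (if s < t then -1 else 1) * faceSign A τ t := by
  unfold faceSign
  rw [Finset.filter_insert]
  split_ifs with h
  · rw [Finset.card_insert_of_notMem (by simp [hs]), pow_succ]; ring
  · simp

variable [Fintype B]

/-- The boundary map of the augmented chain complex of the full simplex on `B`, on chains of
all degrees simultaneously. -/
def simplexBoundary : (Finset B → A) →ₗ[A] (Finset B → A) where
  toFun c τ := ∑ s ∈ τᶜ, faceSign A τ s * c (insert s τ)
  map_add' c c' := by
    ext τ
    simp [mul_add, Finset.sum_add_distrib]
  map_smul' r c := by
    ext τ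
    simp only [Pi.smul_apply, smul_eq_mul, RingHom.id_apply, Finset.mul_sum]
    exact Finset.sum_congr rfl fun s _ => by ring

theorem simplexBoundary_apply (c : Finset B → A) (τ : Finset B) :
    simplexBoundary c τ = ∑ s ∈ τᶜ, faceSign A τ s * c (insert s τ) := rfl

theorem simplexBoundary_simplexBoundary [NoZeroDivisors A] [CharZero A] (c : Finset B → A) :
    simplexBoundary (simplexBoundary c) = 0 := by
  ext ρ
  let f : B → B → A := fun s t =>
    if s ∉ ρ ∧ t ∉ ρ ∧ s ≠ t then
      faceSign A ρ s * (faceSign A (insert s ρ) t * c (insert t (insert s ρ))) else 0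
  have hf : simplexBoundary (simplexBoundary c) ρ = ∑ s, ∑ t, f s t := by
    rw [simplexBoundary_apply, ← Finset.sum_subset (Finset.subset_univ ρᶜ)]
    · refine Finset.sum_congr rfl fun s hs => ?_
      rw [Finset.mem_compl] at hs
      rw [simplexBoundary_apply, Finset.mul_sum,
        ← Finset.sum_subset (Finset.subset_univ (insert s ρ)ᶜ)]
      · refine Finset.sum_congr rfl fun t ht => ?_
        simp only [Finset.mem_compl, Finset.mem_insert, not_or] at ht
        simp [f, hs, ht.2, Ne.symm ht.1]
      · intro t _ ht
        simp only [Finset.mem_compl, Finset.mem_insert, not_not] at ht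
        rcases ht with rfl | ht <;> simp [f, *]
    · intro s _ hs
      simp only [Finset.mem_compl, not_not] at hs
      simp [f, hs]
  have hanti : ∀ s t, f s t = - f t s := by
    intro s t
    by_cases h : s ∉ ρ ∧ t ∉ ρ ∧ s ≠ t
    · have h' : t ∉ ρ ∧ s ∉ ρ ∧ t ≠ s := ⟨h.2.1, h.1, h.2.2.symm⟩
      simp only [f, if_pos h, if_pos h']
      rw [faceSign_insert ρ h.1, faceSign_insert ρ h.2.1, Finset.insert_comm s t]
      rcases lt_or_gt_of_ne h.2.2 with hlt | hlt
      · rw [if_pos hlt, if_neg hlt.asymm]; ring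
      · rw [if_pos hlt, if_neg hlt.asymm]; ring
    · have h' : ¬ (t ∉ ρ ∧ s ∉ ρ ∧ t ≠ s) := fun h' => h ⟨h'.2.1, h'.1, h'.2.2.symm⟩
      simp only [f, if_neg h, if_neg h', neg_zero]
  have h2 : (∑ s, ∑ t, f s t) = - ∑ s, ∑ t, f s t := by
    conv_rhs => rw [Finset.sum_comm]
    simp only [← Finset.sum_neg_distrib]
    exact Finset.sum_congr rfl fun s _ => Finset.sum_congr rfl fun t _ => hanti s t
  rw [hf]
  exact self_eq_neg.mp h2

/-- A perfect acyclic matching on the face poset of the full simplex: the simplex `τ` is matched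
with the simplex obtained by adding or removing the vertex `bit τ`, and acyclicity is witnessed
by a rank function that increases along gradient paths. -/
structure SimplexMatching (B : Type*) [DecidableEq B] where
  /-- The vertex added to or removed from a simplex. -/
  bit : Finset B → B
  /-- The rank function. -/
  rank : Finset B → ℕ
  bit_erase : ∀ σ, bit σ ∈ σ → bit (σ.erase (bit σ)) = bit σ
  bit_insert : ∀ τ, bit τ ∉ τ → bit (insert (bit τ) τ) = bit τ
  rank_lt : ∀ τ, bit τ ∉ τ → ∀ s ∈ τ, bit ((insert (bit τ) τ).erase s) ∉
    (insert (bit τ) τ).erase s → rank τ < rank ((insert (bit τ) τ).erase s)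

namespace SimplexMatching

variable (m : SimplexMatching B)

/-- The chain supported on the upper simplices of the matching with prescribed coefficients,
indexed by the lower simplices. -/
def lift (g : Finset B → A) : Finset B → A := fun σ =>
  if m.bit σ ∈ σ then faceSign A (σ.erase (m.bit σ)) (m.bit σ) * g (σ.erase (m.bit σ)) else 0

omit [Fintype B] in
/-- If `τ` is a face of the upper simplex `insert s τ` but not its partner, then the partner has
smaller rank. -/
theorem rank_partner_lt {τ : Finset B} (hτ : m.bit τ ∉ τ) {s : B} (hs : s ∉ τ)
    (hne : s ≠ m.bit τ) (hup : m.bit (insert s τ) ∈ insert s τ) :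
    m.rank ((insert s τ).erase (m.bit (insert s τ))) < m.rank τ := by
  set σ := insert s τ with hσ
  have hb : m.bit σ ≠ s := by
    intro h
    have := m.bit_erase σ hup
    rw [h, hσ, Finset.erase_insert hs] at this
    exact hne this.symm
  have h1 := m.bit_erase σ hup
  have hins : insert (m.bit σ) (σ.erase (m.bit σ)) = σ := Finset.insert_erase hup
  have h3 : σ.erase s = τ := by rw [hσ, Finset.erase_insert hs]
  have h2 := m.rank_lt (σ.erase (m.bit σ)) (by rw [h1]; simp) s
    (by rw [Finset.mem_erase]; exact ⟨hb.symm, by simp [hσ]⟩)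
  rw [h1, hins, h3] at h2
  exact h2 hτ

theorem simplexBoundary_lift {n : ℕ} {g : Finset B → A} (hg : ∀ τ, m.rank τ < n → g τ = 0)
    {τ : Finset B} (hτ : m.bit τ ∉ τ) (hr : m.rank τ ≤ n) :
    simplexBoundary (m.lift g) τ = g τ := by
  rw [simplexBoundary_apply, Finset.sum_eq_single (m.bit τ)]
  · have h := m.bit_insert τ hτ
    rw [lift, if_pos (by rw [h]; simp), h, Finset.erase_insert hτ, ← mul_assoc,
      faceSign_mul_self, one_mul]
  · intro s hs hne
    rw [Finset.mem_compl] at hs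
    rw [lift]
    split_ifs with hup
    · rw [hg _ ((m.rank_partner_lt hτ hs hne hup).trans_le hr)]; simp
    · simp
  · intro h
    exact absurd (Finset.mem_compl.2 hτ) h

/-- Triangular elimination: the equations `∂ x = g` on a set `E` of lower simplices can be solved
within a submodule `X` closed under the elementary elimination steps. -/
theorem exists_simplexBoundary_eq (E : Finset B → Prop) [DecidablePred E]
    (hE : ∀ τ, E τ → m.bit τ ∉ τ) (g : Finset B → A) (X : Submodule A (Finset B → A))
    (hX : ∀ x ∈ X, ∀ n, m.lift (fun τ => if E τ ∧ m.rank τ = n then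
      g τ - simplexBoundary x τ else 0) ∈ X) :
    ∃ x ∈ X, ∀ τ, E τ → simplexBoundary x τ = g τ := by
  have key : ∀ n, ∃ x ∈ X, ∀ τ, E τ → m.rank τ < n → simplexBoundary x τ = g τ := by
    intro n
    induction n with
    | zero => exact ⟨0, X.zero_mem, fun τ _ h => absurd h (Nat.not_lt_zero _)⟩
    | succ n ih =>
      obtain ⟨x, hx, hxg⟩ := ih
      refine ⟨_, X.add_mem hx (hX x hx n), fun τ hτ hr => ?_⟩
      rw [map_add, Pi.add_apply, m.simplexBoundary_lift (n := n) _ (hE τ hτ) (by omega)]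
      · split_ifs with h
        · ring
        · rw [add_zero]
          exact hxg τ hτ (by
            have : m.rank τ ≠ n := fun h' => h ⟨hτ, h'⟩
            omega)
      · intro ρ hρ
        rw [if_neg (by omega)]
  obtain ⟨x, hx, h⟩ := key (Finset.univ.sup m.rank + 1)
  exact ⟨x, hx, fun τ hτ => h τ hτ (Nat.lt_succ_of_le (Finset.le_sup (Finset.mem_univ τ)))⟩

/-- The coefficients of a cycle are controlled by its coefficients on the lower simplices. -/
theorem apply_mem_of_cycle (J : Finset B → Ideal A) (hJ : ∀ τ s, J (insert s τ) ≤ J τ)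
    {c : Finset B → A} (hc : simplexBoundary c = 0) {k : ℕ}
    (hlow : ∀ τ, τ.card = k → m.bit τ ∉ τ → c τ ∈ J τ)
    (hup : ∀ σ, σ.card = k → m.bit σ ∈ σ → J (σ.erase (m.bit σ)) ≤ J σ ∨ c σ ∈ J σ) :
    ∀ σ, σ.card = k → c σ ∈ J σ := by
  have key : ∀ n σ, σ.card = k → m.bit σ ∈ σ → m.rank (σ.erase (m.bit σ)) = n → c σ ∈ J σ := by
    intro n
    induction n using Nat.strong_induction_on with
    | _ n ih =>
      intro σ hσ hb hn
      rcases hup σ hσ hb with hle | h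
      swap
      · exact h
      refine hle ?_
      set τ := σ.erase (m.bit σ) with hτ
      have hbτ : m.bit τ = m.bit σ := m.bit_erase σ hb
      have hdown : m.bit τ ∉ τ := by rw [hbτ, hτ]; simp
      have hins : insert (m.bit τ) τ = σ := by rw [hbτ, hτ]; exact Finset.insert_erase hb
      have h0 : simplexBoundary c τ = 0 := by rw [hc]; rfl
      rw [simplexBoundary_apply, ← Finset.add_sum_erase _ _ (Finset.mem_compl.2 hdown),
        hins] at h0
      have hsum : ∑ s ∈ τᶜ.erase (m.bit τ), faceSign A τ s * c (insert s τ) ∈ J τ := by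
        refine Ideal.sum_mem _ fun s hs => Ideal.mul_mem_left _ _ ?_
        rw [Finset.mem_erase, Finset.mem_compl] at hs
        have hcard : (insert s τ).card = k := by
          rw [Finset.card_insert_of_notMem hs.2, ← hσ, ← hins,
            Finset.card_insert_of_notMem hdown]
        by_cases hs' : m.bit (insert s τ) ∈ insert s τ
        · exact hJ τ s (ih _ (hn ▸ m.rank_partner_lt hdown hs.2 hs.1 hs') _ hcard hs' rfl)
        · exact hJ τ s (hlow _ hcard hs')
      have h1 : faceSign A τ (m.bit τ) * c σ ∈ J τ := by
        rw [eq_neg_of_add_eq_zero_left h0]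
        exact (J τ).neg_mem hsum
      have h2 := (J τ).mul_mem_left (faceSign A τ (m.bit τ)) h1
      rwa [← mul_assoc, faceSign_mul_self, one_mul] at h2
  intro σ hσ
  by_cases hb : m.bit σ ∈ σ
  · exact key _ σ hσ hb rfl
  · exact hlow σ hσ hb

end SimplexMatching

end SimplexChains

section FilteredChains

variable {B : Type*} {A : Type*} [CommRing A]

/-- The chains of degree `k` whose coefficient at each `τ` is divisible by `p ^ v τ`. -/
def filteredChains (p : A) (v : Finset B → ℕ) (k : ℕ) : Submodule A (Finset B → A) where
  carrier := {c | (∀ τ, τ.card ≠ k → c τ = 0) ∧ ∀ τ, p ^ v τ ∣ c τ}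
  add_mem' := by
    rintro a b ⟨ha, ha'⟩ ⟨hb, hb'⟩
    exact ⟨fun τ h => by simp [ha τ h, hb τ h], fun τ => dvd_add (ha' τ) (hb' τ)⟩
  zero_mem' := ⟨fun _ _ => rfl, fun _ => dvd_zero _⟩
  smul_mem' := by
    rintro r a ⟨ha, ha'⟩
    exact ⟨fun τ h => by simp [ha τ h], fun τ => (ha' τ).mul_left r⟩

variable [Fintype B] [LinearOrder B] {p : A} {v : Finset B → ℕ} {k : ℕ}

theorem simplexBoundary_mem_filteredChains (hv : ∀ τ s, v τ ≤ v (insert s τ))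
    {c : Finset B → A} (hc : c ∈ filteredChains p v (k + 1)) :
    simplexBoundary c ∈ filteredChains p v k := by
  refine ⟨fun τ h => ?_, fun τ => ?_⟩
  · rw [simplexBoundary_apply]
    refine Finset.sum_eq_zero fun s hs => ?_
    rw [hc.1 _ (by rw [Finset.card_insert_of_notMem (Finset.mem_compl.1 hs)]; omega), mul_zero]
  · rw [simplexBoundary_apply]
    exact Finset.dvd_sum fun s _ => ((pow_dvd_pow p (hv τ s)).trans (hc.2 _)).mul_left _

namespace SimplexMatching

variable (m : SimplexMatching B)

omit [Fintype B] in
theorem lift_mem_filteredChains {g : Finset B → A} (hg : ∀ τ, τ.card ≠ k → g τ = 0)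
    (hdvd : ∀ τ, m.bit τ ∉ τ → p ^ v (insert (m.bit τ) τ) ∣ g τ) :
    m.lift g ∈ filteredChains p v (k + 1) := by
  refine ⟨fun σ h => ?_, fun σ => ?_⟩
  · rw [lift]
    split_ifs with hb
    · rw [hg _ (by rw [Finset.card_erase_of_mem hb]; have := Finset.card_pos.2 ⟨_, hb⟩; omega),
        mul_zero]
    · rfl
  · rw [lift]
    split_ifs with hb
    · refine Dvd.dvd.mul_left ?_ _
      have h1 := m.bit_erase σ hb
      have := hdvd (σ.erase (m.bit σ)) (by rw [h1]; simp)
      rwa [h1, Finset.insert_erase hb] at this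
    · exact dvd_zero _

theorem eq_zero_of_cycle {c : Finset B → A} (hc : simplexBoundary c = 0)
    (hk : ∀ τ, τ.card ≠ k → c τ = 0) (hlow : ∀ τ, τ.card = k → m.bit τ ∉ τ → c τ = 0) :
    c = 0 := by
  ext σ
  by_cases hσ : σ.card = k
  · have := m.apply_mem_of_cycle (fun _ => (⊥ : Ideal A)) (fun _ _ => le_rfl) hc
      (fun τ h h' => by simpa using hlow τ h h') (fun _ _ _ => Or.inl le_rfl) σ hσ
    simpa using this
  · exact hk σ hσ

/-- If every lower simplex `τ` of degree `k` has the same weight as its partner, then the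
filtered complex is exact in degree `k`. -/
theorem exists_boundary_of_equal_weights [NoZeroDivisors A] [CharZero A]
    (hv : ∀ τ s, v τ ≤ v (insert s τ))
    (hw : ∀ τ, τ.card = k → m.bit τ ∉ τ → v (insert (m.bit τ) τ) ≤ v τ)
    {c : Finset B → A} (hc : c ∈ filteredChains p v k) (hz : simplexBoundary c = 0) :
    ∃ x ∈ filteredChains p v (k + 1), simplexBoundary x = c := by
  classical
  obtain ⟨x, hx, h⟩ := m.exists_simplexBoundary_eq (fun τ => τ.card = k ∧ m.bit τ ∉ τ)
    (fun τ h => h.2) c (filteredChains p v (k + 1)) (by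
      intro x hx n
      have hb := simplexBoundary_mem_filteredChains hv hx
      refine m.lift_mem_filteredChains (fun τ h => if_neg fun h' => h h'.1.1) fun τ hτ => ?_
      split_ifs with h
      · exact (pow_dvd_pow p (hw τ h.1.1 hτ)).trans (dvd_sub (hc.2 τ) (hb.2 τ))
      · exact dvd_zero _)
  refine ⟨x, hx, ?_⟩
  have hb := simplexBoundary_mem_filteredChains hv hx
  refine sub_eq_zero.1 (m.eq_zero_of_cycle (k := k) ?_ ?_ ?_)
  · rw [map_sub, simplexBoundary_simplexBoundary, hz, sub_zero]
  · intro τ h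
    rw [Pi.sub_apply, hb.1 τ h, hc.1 τ h, sub_zero]
  · intro τ hk h'
    rw [Pi.sub_apply, h τ ⟨hk, h'⟩, sub_self]

/-- If exactly one lower simplex `τ₀` of degree `k` has a weight different from that of its
partner, and that weight is smaller by one, then the homology of the filtered complex in degree `k`
is cyclic of order exactly `p`. -/
theorem exists_generator_of_defect [IsDomain A] [CharZero A] (hp : p ≠ 0)
    (hv : ∀ τ s, v τ ≤ v (insert s τ)) {τ₀ : Finset B} (hcard : τ₀.card = k)
    (hτ₀ : m.bit τ₀ ∉ τ₀) (hv₀ : v (insert (m.bit τ₀) τ₀) = v τ₀ + 1)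
    (hw : ∀ τ, τ.card = k → m.bit τ ∉ τ → τ ≠ τ₀ → v (insert (m.bit τ) τ) ≤ v τ)
    (hup : ∀ σ, σ.card = k → m.bit σ ∈ σ → v σ ≤ v (σ.erase (m.bit σ)) ∨ v σ ≤ v τ₀)
    (hface : ∀ τ, τ.card = k + 1 → m.bit τ ∉ τ →
      ∀ s ∈ τ, v ((insert (m.bit τ) τ).erase s) ≤ v τ) :
    ∃ z ∈ filteredChains p v k, simplexBoundary z = 0 ∧
      (∀ c ∈ filteredChains p v k, simplexBoundary c = 0 →
        ∃ r : A, ∃ x ∈ filteredChains p v (k + 1), c = r • z + simplexBoundary x) ∧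
      (∃ x ∈ filteredChains p v (k + 1), simplexBoundary x = p • z) ∧
      ∀ u : A, ∀ x ∈ filteredChains p v (k + 1), simplexBoundary x = u • z → p ∣ u := by
  classical
  let a := v τ₀
  let E₀ : Finset B → Prop := fun τ => (τ.card = k ∧ m.bit τ ∉ τ) ∧ τ ≠ τ₀
  let δ : Finset B → A := Pi.single τ₀ 1
  have hδ : ∀ τ, τ ≠ τ₀ → δ τ = 0 := fun τ h => by simp [δ, h]
  have hδ₀ : δ τ₀ = 1 := by simp [δ]
  -- the cycle `z₁` whose only nonzero lower coefficient is the one at `τ₀`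
  obtain ⟨x₁, hx₁, h₁⟩ := m.exists_simplexBoundary_eq (fun τ => τ.card = k ∧ m.bit τ ∉ τ)
    (fun τ h => h.2) δ (filteredChains (1 : A) v (k + 1)) (by
      intro x hx n
      refine m.lift_mem_filteredChains (fun τ h => if_neg fun h' => h h'.1.1) fun τ _ => ?_
      rw [one_pow]; exact one_dvd _)
  have hb₁ := simplexBoundary_mem_filteredChains hv hx₁
  set z₁ := simplexBoundary x₁ with hz₁
  have hz₁c : simplexBoundary z₁ = 0 := simplexBoundary_simplexBoundary _
  have hz₁₀ : z₁ τ₀ = 1 := by rw [h₁ τ₀ ⟨hcard, hτ₀⟩, hδ₀]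
  have hz₁E : ∀ τ, E₀ τ → z₁ τ = 0 := fun τ h => by rw [h₁ τ h.1, hδ τ h.2]
  set z := p ^ a • z₁ with hz
  have hzc : simplexBoundary z = 0 := by rw [hz, map_smul, hz₁c, smul_zero]
  have hzF : z ∈ filteredChains p v k := by
    refine ⟨fun τ h => by simp [hz, hb₁.1 τ h], fun τ => ?_⟩
    by_cases hτ : τ.card = k
    · have := m.apply_mem_of_cycle (fun τ => Ideal.span {p ^ v τ})
        (fun τ s => Ideal.span_singleton_le_span_singleton.2 (pow_dvd_pow p (hv τ s))) hzc
        (k := k) ?_ ?_ τ hτ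
      · exact Ideal.mem_span_singleton.1 this
      · intro τ h h'
        rw [Ideal.mem_span_singleton]
        by_cases h0 : τ = τ₀
        · subst h0; simp [hz, a]
        · simp [hz, hz₁E τ ⟨⟨h, h'⟩, h0⟩]
      · intro σ hσ hb
        rcases hup σ hσ hb with h | h
        · exact Or.inl (Ideal.span_singleton_le_span_singleton.2 (pow_dvd_pow p h))
        · refine Or.inr (Ideal.mem_span_singleton.2 ?_)
          exact (pow_dvd_pow p h).trans (Dvd.intro _ rfl)
    · simp [hz, hb₁.1 τ hτ]
  have eq_of_lower : ∀ c ∈ filteredChains p v k, simplexBoundary c = 0 →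
      (∀ τ, E₀ τ → c τ = 0) → c τ₀ = 0 → c = 0 := by
    intro c hc hcz hcE hc₀
    refine m.eq_zero_of_cycle (k := k) hcz hc.1 fun τ h h' => ?_
    by_cases h0 : τ = τ₀
    · rw [h0, hc₀]
    · exact hcE τ ⟨⟨h, h'⟩, h0⟩
  refine ⟨z, hzF, hzc, ?_, ?_, ?_⟩
  · intro c hc hcz
    obtain ⟨x, hx, h⟩ := m.exists_simplexBoundary_eq E₀ (fun τ h => h.1.2) c
      (filteredChains p v (k + 1)) (by
        intro x hx n
        have hb := simplexBoundary_mem_filteredChains hv hx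
        refine m.lift_mem_filteredChains (fun τ h => if_neg fun h' => h h'.1.1.1) fun τ hτ => ?_
        split_ifs with h
        · exact (pow_dvd_pow p (hw τ h.1.1.1 hτ h.1.2)).trans (dvd_sub (hc.2 τ) (hb.2 τ))
        · exact dvd_zero _)
    have hb := simplexBoundary_mem_filteredChains hv hx
    obtain ⟨r, hr⟩ : p ^ a ∣ (c - simplexBoundary x) τ₀ := dvd_sub (hc.2 τ₀) (hb.2 τ₀)
    refine ⟨r, x, hx, ?_⟩
    have := eq_of_lower (c - simplexBoundary x - r • z)
      (sub_mem (sub_mem hc hb) (Submodule.smul_mem _ _ hzF))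
      (by rw [map_sub, map_sub, map_smul, hcz, hzc, simplexBoundary_simplexBoundary]; simp)
      (fun τ hτ => by simp [h τ hτ, hz, hz₁E τ hτ])
      (by rw [Pi.sub_apply, hr]; simp [hz, hz₁₀, mul_comm])
    rw [sub_eq_zero, sub_eq_iff_eq_add] at this
    exact this
  · let y := m.lift (p ^ (a + 1) • δ)
    have hy : y ∈ filteredChains p v (k + 1) := by
      refine m.lift_mem_filteredChains (fun τ h => ?_) fun τ _ => ?_
      · simp [hδ τ (fun h' => h (h' ▸ hcard))]
      · by_cases h0 : τ = τ₀
        · subst h0; simp [hδ₀, hv₀, a]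
        · simp [hδ τ h0]
    have hyb : ∀ τ, m.bit τ ∉ τ → m.rank τ ≤ m.rank τ₀ →
        simplexBoundary y τ = (p ^ (a + 1) • δ) τ := by
      intro τ h h'
      refine m.simplexBoundary_lift (n := m.rank τ₀) (fun ρ hρ => ?_) h h'
      have : ρ ≠ τ₀ := by rintro rfl; exact lt_irrefl _ hρ
      simp [hδ ρ this]
    have hyF := simplexBoundary_mem_filteredChains hv hy
    set c := p • z - simplexBoundary y with hc
    have hcF : c ∈ filteredChains p v k := sub_mem (Submodule.smul_mem _ _ hzF) hyF
    have hcz : simplexBoundary c = 0 := by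
      rw [hc, map_sub, map_smul, hzc, simplexBoundary_simplexBoundary]; simp
    have hclow : ∀ τ, τ.card = k → m.bit τ ∉ τ → m.rank τ ≤ m.rank τ₀ → c τ = 0 := by
      intro τ h h' hr
      rw [hc, Pi.sub_apply, hyb τ h' hr]
      by_cases h0 : τ = τ₀
      · subst h0; simp [hz, hz₁₀, hδ₀, pow_succ, mul_comm]
      · simp [hz, hz₁E τ ⟨⟨h, h'⟩, h0⟩, hδ τ h0]
    let X : Submodule A (Finset B → A) :=
      { carrier := {x | x ∈ filteredChains p v (k + 1) ∧ ∀ τ, m.bit τ ∉ τ →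
          m.rank τ ≤ m.rank τ₀ → simplexBoundary x τ = 0}
        add_mem' := fun {s t} hs ht => ⟨add_mem hs.1 ht.1, fun τ h h' => by
          rw [map_add, Pi.add_apply, hs.2 τ h h', ht.2 τ h h', add_zero]⟩
        zero_mem' := ⟨zero_mem _, fun τ _ _ => by simp⟩
        smul_mem' := fun r s hs => ⟨Submodule.smul_mem _ _ hs.1, fun τ h h' => by
          rw [map_smul, Pi.smul_apply, hs.2 τ h h', smul_zero]⟩ }
    obtain ⟨x, hx, h⟩ := m.exists_simplexBoundary_eq E₀ (fun τ h => h.1.2) c X (by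
        rintro x ⟨hx, hx'⟩ n
        have hb := simplexBoundary_mem_filteredChains hv hx
        refine ⟨m.lift_mem_filteredChains (fun τ h => if_neg fun h' => h h'.1.1.1)
          fun τ hτ => ?_, fun τ hτ hr => ?_⟩
        · split_ifs with h
          · exact (pow_dvd_pow p (hw τ h.1.1.1 hτ h.1.2)).trans (dvd_sub (hcF.2 τ) (hb.2 τ))
          · exact dvd_zero _
        · have hg : ∀ ρ, m.rank ρ < max n (m.rank τ₀) →
              (if E₀ ρ ∧ m.rank ρ = n then c ρ - simplexBoundary x ρ else 0) = 0 := by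
            intro ρ hρ
            split_ifs with h
            · have hr' : m.rank ρ ≤ m.rank τ₀ := by
                rcases lt_max_iff.1 hρ with h' | h' <;> omega
              rw [hclow ρ h.1.1.1 h.1.1.2 hr', hx' ρ h.1.1.2 hr', sub_zero]
            · rfl
          rw [m.simplexBoundary_lift hg hτ (hr.trans (le_max_right _ _))]
          split_ifs with h
          · rw [hclow τ h.1.1.1 hτ hr, hx' τ hτ hr, sub_zero]
          · rfl)
    have hxF := simplexBoundary_mem_filteredChains hv hx.1
    have h0 := eq_of_lower (c - simplexBoundary x) (sub_mem hcF hxF)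
      (by rw [map_sub, hcz, simplexBoundary_simplexBoundary, sub_zero])
      (fun τ hτ => by rw [Pi.sub_apply, h τ hτ, sub_self])
      (by rw [Pi.sub_apply, hclow τ₀ hcard hτ₀ le_rfl, hx.2 τ₀ hτ₀ le_rfl, sub_zero])
    refine ⟨y + x, add_mem hy hx.1, ?_⟩
    rw [map_add, ← sub_eq_zero.1 h0, hc]
    abel
  · intro u x hx hxu
    let X : Submodule A (Finset B → A) :=
      (filteredChains p v (k + 1)).comap simplexBoundary
    obtain ⟨w, hw', h⟩ := m.exists_simplexBoundary_eq
      (fun τ => τ.card = k + 1 ∧ m.bit τ ∉ τ) (fun τ h => h.2) x X (by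
        intro w hw n
        rw [Submodule.mem_comap] at hw ⊢
        have hF : x - simplexBoundary w ∈ filteredChains p v (k + 1) := sub_mem hx hw
        have hlift := m.lift_mem_filteredChains (p := (1 : A)) (v := v) (k := k + 1)
          (g := fun τ => if (τ.card = k + 1 ∧ m.bit τ ∉ τ) ∧ m.rank τ = n then
            x τ - simplexBoundary w τ else 0)
          (fun τ h => if_neg fun h' => h h'.1.1) (fun τ _ => by rw [one_pow]; exact one_dvd _)
        refine ⟨(simplexBoundary_mem_filteredChains hv hlift).1, fun ρ => ?_⟩
        rw [simplexBoundary_apply]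
        refine Finset.dvd_sum fun s hs => Dvd.dvd.mul_left ?_ _
        rw [Finset.mem_compl] at hs
        rw [lift]
        split_ifs with hb h'
        · refine Dvd.dvd.mul_left ?_ _
          refine dvd_trans (pow_dvd_pow p ?_) (hF.2 _)
          set σ := insert s ρ with hσ
          have hbσ := m.bit_erase σ hb
          by_cases hs' : s = m.bit σ
          · rw [← hs', hσ, Finset.erase_insert hs]
          · have := hface (σ.erase (m.bit σ)) h'.1.1 h'.1.2 s
              (Finset.mem_erase.2 ⟨hs', by simp [hσ]⟩)
            rw [hbσ, Finset.insert_erase hb] at this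
            rwa [show σ.erase s = ρ by rw [hσ, Finset.erase_insert hs]] at this
        · rw [mul_zero]; exact dvd_zero _
        · exact dvd_zero _)
    set y := x - simplexBoundary w with hy
    have hyF : y ∈ filteredChains p v (k + 1) := sub_mem hx hw'
    have hylow : ∀ τ, m.bit τ ∉ τ → y τ = 0 := by
      intro τ hτ
      by_cases hk : τ.card = k + 1
      · rw [hy, Pi.sub_apply, h τ ⟨hk, hτ⟩, sub_self]
      · exact hyF.1 τ hk
    have hyu : simplexBoundary y = u • z := by
      rw [hy, map_sub, hxu, simplexBoundary_simplexBoundary, sub_zero]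
    have hyup : ∀ n, ∀ τ, τ.card = k → m.bit τ ∉ τ → m.rank τ = n → m.rank τ < m.rank τ₀ →
        y (insert (m.bit τ) τ) = 0 := by
      intro n
      induction n using Nat.strong_induction_on with
      | _ n ih =>
        intro τ hk hτ hn hlt
        have h1 : simplexBoundary y τ = 0 := by
          rw [hyu, hz]
          simp [hz₁E τ ⟨⟨hk, hτ⟩, by rintro rfl; exact lt_irrefl _ hlt⟩]
        rw [simplexBoundary_apply, Finset.sum_eq_single (m.bit τ)] at h1
        · have h2 := congrArg (faceSign A τ (m.bit τ) * ·) h1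
          simpa [← mul_assoc, faceSign_mul_self] using h2
        · intro s hs hne
          rw [Finset.mem_compl] at hs
          by_cases hb : m.bit (insert s τ) ∈ insert s τ
          · have hr := m.rank_partner_lt hτ hs hne hb
            have hbe := m.bit_erase _ hb
            have := ih _ (hn ▸ hr) ((insert s τ).erase (m.bit (insert s τ)))
              (by rw [Finset.card_erase_of_mem hb, Finset.card_insert_of_notMem hs]; omega)
              (by rw [hbe]; simp) rfl (hr.trans hlt)
            rw [hbe, Finset.insert_erase hb] at this
            rw [this, mul_zero]
          · rw [hylow _ hb, mul_zero]
        · intro h'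
          exact absurd (Finset.mem_compl.2 hτ) h'
    have h1 : simplexBoundary y τ₀ = u * p ^ a := by
      rw [hyu, hz]; simp [hz₁₀]
    rw [simplexBoundary_apply, Finset.sum_eq_single (m.bit τ₀)] at h1
    · have h2 := (hyF.2 (insert (m.bit τ₀) τ₀)).mul_left (faceSign A τ₀ (m.bit τ₀))
      rw [h1, hv₀, pow_succ, mul_comm u] at h2
      exact (mul_dvd_mul_iff_left (pow_ne_zero _ hp)).1 h2
    · intro s hs hne
      rw [Finset.mem_compl] at hs
      by_cases hb : m.bit (insert s τ₀) ∈ insert s τ₀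
      · have hr := m.rank_partner_lt hτ₀ hs hne hb
        have hbe := m.bit_erase _ hb
        have := hyup _ ((insert s τ₀).erase (m.bit (insert s τ₀)))
          (by rw [Finset.card_erase_of_mem hb, Finset.card_insert_of_notMem hs]; omega)
          (by rw [hbe]; simp) rfl hr
        rw [hbe, Finset.insert_erase hb] at this
        rw [this, mul_zero]
      · rw [hylow _ hb, mul_zero]
    · intro h'
      exact absurd (Finset.mem_compl.2 hτ₀) h'

end SimplexMatching

end FilteredChains

section Glueing

variable {A : Type*} [CommRing A] {ι : Type*}

theorem Ideal.eq_top_of_coprime_mem {I : Ideal A} {D : Finset ι} {p : ι → A} {n : ι → ℕ}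
    (hN : ∏ d ∈ D, p d ^ n d ∈ I) (hu : ∀ d ∈ D, ∃ u ∈ I, IsCoprime u (p d)) : I = ⊤ := by
  by_contra hI
  obtain ⟨P, hP, hle⟩ := Ideal.exists_le_maximal I hI
  have := hP.isPrime
  obtain ⟨d, hd, hdP⟩ := (Ideal.IsPrime.prod_mem_iff).1 (hle hN)
  obtain ⟨u, huI, a, b, hab⟩ := hu d hd
  refine hP.ne_top ((Ideal.eq_top_iff_one P).2 (hab ▸ ?_))
  exact P.add_mem (P.mul_mem_left _ (hle huI))
    (P.mul_mem_left _ (this.mem_of_pow_mem _ hdP))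

/-- A module which is killed by a product of powers of pairwise coprime elements `p d` and which
locally at each `p d` is either zero or cyclic of order `p d` is globally cyclic. -/
theorem nonempty_quotient_prod_equiv {H : Type*} [AddCommGroup H] [Module A H]
    {D T : Finset ι} (hTD : T ⊆ D) {p : ι → A}
    (hp : ∀ d ∈ D, ∀ e ∈ D, d ≠ e → IsCoprime (p d) (p e)) {n : ι → ℕ}
    (hN : ∀ c : H, (∏ d ∈ D, p d ^ n d) • c = 0)
    (h0 : ∀ d ∈ D, d ∉ T → ∃ u, IsCoprime u (p d) ∧ ∀ c : H, u • c = 0)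
    (h1 : ∀ d ∈ T, ∃ u, ∃ z : H, IsCoprime u (p d) ∧ (∀ c : H, ∃ r : A, u • c = r • z) ∧
      p d • z = 0 ∧ ∀ r : A, r • z = 0 → p d ∣ r) :
    Nonempty (H ≃ₗ[A] A ⧸ Ideal.span {∏ d ∈ T, p d}) := by
  classical
  choose! u z hu hz hpz hann using h1
  set g := ∏ d ∈ T, p d with hg
  have hgc : ∀ c : H, g • c = 0 := by
    intro c
    have htop : LinearMap.ker (LinearMap.toSpanSingleton A H (g • c)) = ⊤ := by
      refine Ideal.eq_top_of_coprime_mem (D := D) (p := p) (n := n) ?_ fun d hd => ?_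
      · simpa using hN (g • c)
      · by_cases hdT : d ∈ T
        · refine ⟨u d, ?_, hu d hdT⟩
          obtain ⟨r, hr⟩ := hz d hdT c
          rw [LinearMap.mem_ker, LinearMap.toSpanSingleton_apply, smul_comm, hr, hg,
            ← Finset.prod_erase_mul _ _ hdT, mul_smul, smul_comm (p d) r, hpz d hdT]
          simp
        · obtain ⟨w, hw, hw'⟩ := h0 d hd hdT
          exact ⟨w, by simpa using hw' (g • c), hw⟩
    have : (1 : A) ∈ LinearMap.ker (LinearMap.toSpanSingleton A H (g • c)) := htop ▸ trivial
    simpa using this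
  let P : ι → A := fun d => ∏ e ∈ T.erase d, p e
  have hPcop : ∀ d ∈ T, IsCoprime (P d) (p d) := fun d hd =>
    IsCoprime.prod_left fun e he => hp e (hTD (Finset.mem_of_mem_erase he)) d (hTD hd)
      (Finset.ne_of_mem_erase he)
  have hgP : ∀ d ∈ T, g = P d * p d := fun d hd => (Finset.prod_erase_mul _ _ hd).symm
  let y : H := ∑ d ∈ T, P d • z d
  have hPy : ∀ d ∈ T, P d • y = (P d * P d) • z d := by
    intro d hd
    rw [Finset.smul_sum, Finset.sum_eq_single d, mul_smul]
    · intro e he hne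
      have : p e ∣ P d := Finset.dvd_prod_of_mem _ (Finset.mem_erase.2 ⟨hne, he⟩)
      obtain ⟨w, hw⟩ := this
      rw [hw, mul_comm, mul_smul, smul_comm (p e), hpz e he]
      simp
    · intro h; exact absurd hd h
  let φ : A →ₗ[A] H := LinearMap.toSpanSingleton A H y
  have hker : LinearMap.ker φ = Ideal.span {g} := by
    ext r
    rw [LinearMap.mem_ker, Ideal.mem_span_singleton, LinearMap.toSpanSingleton_apply]
    constructor
    · intro hr
      refine Finset.prod_dvd_of_coprime
        (fun d hd e he hne => hp d (hTD hd) e (hTD he) hne) fun d hd => ?_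
      have h2 : (r * (P d * P d)) • z d = 0 := by
        rw [mul_smul, ← hPy d hd, smul_comm, hr, smul_zero]
      have hc := hPcop d hd
      exact (hc.mul_left hc).symm.dvd_of_dvd_mul_right (hann d hd _ h2)
    · rintro ⟨w, rfl⟩
      rw [mul_smul, hgc]
  have hsurj : LinearMap.range φ = ⊤ := by
    rw [eq_top_iff]
    intro c _
    have htop : (LinearMap.range φ).comap (LinearMap.toSpanSingleton A H c) = ⊤ := by
      refine Ideal.eq_top_of_coprime_mem (D := D) (p := p) (n := n) ?_ fun d hd => ?_
      · rw [Submodule.mem_comap, LinearMap.toSpanSingleton_apply, hN c]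
        exact zero_mem _
      · by_cases hdT : d ∈ T
        · have hc := hPcop d hdT
          refine ⟨(P d * P d) * u d, ?_, (hc.mul_left hc).mul_left (hu d hdT)⟩
          obtain ⟨r, hr⟩ := hz d hdT c
          rw [Submodule.mem_comap, LinearMap.toSpanSingleton_apply, mul_smul, hr, smul_comm,
            ← hPy d hdT]
          exact Submodule.smul_mem _ _ (Submodule.smul_mem _ _ ⟨1, by simp [φ]⟩)
        · obtain ⟨w, hw, hw'⟩ := h0 d hd hdT
          refine ⟨w, ?_, hw⟩
          rw [Submodule.mem_comap, LinearMap.toSpanSingleton_apply, hw' c]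
          exact zero_mem _
    have : (1 : A) ∈ (LinearMap.range φ).comap (LinearMap.toSpanSingleton A H c) :=
      htop ▸ Submodule.mem_top
    simpa using this
  exact ⟨((Submodule.quotEquivOfEq _ _ hker.symm).trans
    (φ.quotKerEquivOfSurjective (LinearMap.range_eq_top.1 hsurj))).symm⟩

/-- The Chinese remainder theorem for a product of two coprime elements, as a linear
equivalence. -/
noncomputable def quotientSpanMulEquiv {a b : A} (h : IsCoprime a b) :
    (A ⧸ Ideal.span {a * b}) ≃ₗ[A] (A ⧸ Ideal.span {a}) × (A ⧸ Ideal.span {b}) :=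
  (Submodule.quotEquivOfEq _ _ (Ideal.span_singleton_mul_span_singleton a b).symm).trans
    { Ideal.quotientMulEquivQuotientProd (Ideal.span {a}) (Ideal.span {b})
        ((Ideal.isCoprime_span_singleton_iff a b).2 h) with
      map_smul' := by
        rintro r ⟨x⟩
        rfl }

end Glueing

section NumbersGame

variable {B : Type*} {W : Type*} [Group W] {M : CoxeterMatrix B}

/-- A Coxeter matrix is simply laced if its off-diagonal entries are `2` or `3`. -/
def CoxeterMatrix.IsSimplyLaced (M : CoxeterMatrix B) : Prop :=
  ∀ i j, i ≠ j → M i j = 2 ∨ M i j = 3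

variable [DecidableEq B]

/-- The Cartan matrix attached to a simply laced Coxeter matrix. -/
def cartanEntry (M : CoxeterMatrix B) (i j : B) : ℤ :=
  if i = j then 2 else if M i j = 3 then -1 else 0

/-- The reflection `s i` acting on weights written in the basis of fundamental weights. -/
def fire (M : CoxeterMatrix B) (i : B) (x : B → ℤ) : B → ℤ :=
  fun j => x j - x i * cartanEntry M i j

lemma fire_self (i : B) (x : B → ℤ) : fire M i x i = -x i := by
  simp [fire, cartanEntry]; ring

lemma fire_of_eq_two {i j : B} (hij : i ≠ j) (h : M i j = 2) (x : B → ℤ) :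
    fire M i x j = x j := by
  simp [fire, cartanEntry, hij, h]

lemma fire_of_eq_three {i j : B} (hij : i ≠ j) (h : M i j = 3) (x : B → ℤ) :
    fire M i x j = x j + x i := by
  simp [fire, cartanEntry, hij, h]

@[simp] lemma fire_fire (i : B) (x : B → ℤ) : fire M i (fire M i x) = x := by
  funext j
  have := fire_self (M := M) i x
  rw [fire, this, fire]
  ring

lemma fire_comm {i j : B} (hij : i ≠ j) (h : M i j = 2) (x : B → ℤ) :
    fire M i (fire M j x) = fire M j (fire M i x) := by
  have h' : M j i = 2 := by rw [M.symmetric]; exact h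
  funext l
  rw [fire, fire_of_eq_two hij.symm h', fire, fire, fire_of_eq_two hij h, fire]
  ring

lemma fire_braid {i j : B} (hij : i ≠ j) (h : M i j = 3) (x : B → ℤ) :
    fire M i (fire M j (fire M i x)) = fire M j (fire M i (fire M j x)) := by
  have h' : M j i = 3 := by rw [M.symmetric]; exact h
  funext l
  have e1 : ∀ y l, fire M i y l = y l - y i * cartanEntry M i l := fun _ _ => rfl
  have e2 : ∀ y l, fire M j y l = y l - y j * cartanEntry M j l := fun _ _ => rfl
  rw [e1 _ l, e2 _ l, e1 x l, e2 _ l, e1 _ l, e2 x l]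
  simp only [fire_of_eq_three hij h, fire_of_eq_three hij.symm h', fire_self]
  ring

/-- The reflection `s i` as a permutation of the weights. -/
def firePerm (M : CoxeterMatrix B) (i : B) : Equiv.Perm (B → ℤ) :=
  Function.Involutive.toPerm (fire M i) (fire_fire i)

@[simp] lemma firePerm_apply (i : B) (x : B → ℤ) : firePerm M i x = fire M i x := rfl

lemma isLiftable_firePerm (hM : M.IsSimplyLaced) : M.IsLiftable (firePerm M) := by
  intro i j
  ext1 x
  rcases eq_or_ne i j with rfl | hij
  · simp
  · rcases hM i j hij with h | h
    · simp only [h, pow_two, Equiv.Perm.mul_apply, firePerm_apply, Equiv.Perm.one_apply]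
      rw [fire_comm hij h, fire_fire, fire_fire]
    · simp only [h, pow_succ, pow_zero, one_mul, Equiv.Perm.mul_apply, firePerm_apply, Equiv.Perm.one_apply]
      rw [fire_braid hij h, fire_fire, fire_fire, fire_fire]

/-- The action of a simply laced Coxeter group on its weights. -/
noncomputable def weightAction (cs : CoxeterSystem M W) (hM : M.IsSimplyLaced) :
    W →* Equiv.Perm (B → ℤ) :=
  cs.lift ⟨firePerm M, isLiftable_firePerm hM⟩

variable {cs : CoxeterSystem M W}

lemma weightAction_simple (hM : M.IsSimplyLaced) (i : B) (x : B → ℤ) :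
    weightAction cs hM (cs.simple i) x = fire M i x := by
  simp [weightAction]

omit [DecidableEq B] in
lemma simple_comm {i j : B} (h : M i j = 2) (w : W) :
    cs.simple i * (cs.simple j * w) = cs.simple j * (cs.simple i * w) := by
  have := cs.simple_mul_simple_pow i j
  rw [h, pow_two, mul_eq_one_iff_eq_inv] at this
  rw [← mul_assoc, this]
  simp [mul_assoc]

omit [DecidableEq B] in
lemma simple_braid {i j : B} (h : M i j = 3) (w : W) :
    cs.simple i * (cs.simple j * (cs.simple i * w)) =
      cs.simple j * (cs.simple i * (cs.simple j * w)) := by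
  have := cs.simple_mul_simple_pow i j
  rw [h, pow_succ, pow_two] at this
  have h3 : cs.simple i * cs.simple j * cs.simple i *
      (cs.simple j * (cs.simple i * cs.simple j)) = 1 := by
    simpa [mul_assoc] using this
  rw [mul_eq_one_iff_eq_inv] at h3
  have h4 : cs.simple i * cs.simple j * cs.simple i =
      cs.simple j * cs.simple i * cs.simple j := by
    rw [h3]; simp [mul_assoc]
  simpa [mul_assoc] using congrArg (· * w) h4

variable (cs) in
/-- `Reach cs σ a k x r` says that the weight `x` is obtained from the fundamental weight of `a`
by playing `k` moves of the numbers game inside `σ`, with `r` the product of the moves. -/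
inductive Reach (σ : Finset B) (a : B) : ℕ → (B → ℤ) → W → Prop
  | base : Reach σ a 0 (Pi.single a 1) 1
  | step {k x r i} : Reach σ a k x r → i ∈ σ → 0 < x i →
      Reach σ a (k + 1) (fire M i x) (cs.simple i * r)

namespace Reach

variable {σ : Finset B} {a : B}

lemma exists_neg {k : ℕ} {x : B → ℤ} {r : W} (h : Reach cs σ a (k + 1) x r) :
    ∃ j ∈ σ, x j < 0 ∧ Reach cs σ a k (fire M j x) (cs.simple j * r) := by
  cases h with
  | @step _ y r' j h' hj hy =>
    refine ⟨j, hj, ?_, ?_⟩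
    · rw [fire_self]; omega
    · simpa using h'

lemma of_zero {x : B → ℤ} {r : W} (h : Reach cs σ a 0 x r) : x = Pi.single a 1 ∧ r = 1 := by
  cases h; exact ⟨rfl, rfl⟩

lemma single_nonneg (i : B) : (0 : ℤ) ≤ (Pi.single a 1 : B → ℤ) i := by
  by_cases h : i = a
  · subst h; simp
  · simp [h]

lemma down (hM : M.IsSimplyLaced) {k : ℕ} : ∀ {x : B → ℤ} {r : W} {i : B},
    Reach cs σ a k x r → i ∈ σ → x i < 0 →
      ∃ k', k = k' + 1 ∧ Reach cs σ a k' (fire M i x) (cs.simple i * r) := by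
  induction k using Nat.strong_induction_on with
  | _ k ih =>
    intro x r i h hi hx
    cases h with
    | base => exact absurd hx (not_lt.2 (single_nonneg i))
    | @step k y r j h hj hy =>
      refine ⟨k, rfl, ?_⟩
      rcases eq_or_ne j i with rfl | hji
      · simpa using h
      · rcases hM j i hji with m | m
        · have m' : M i j = 2 := by rw [M.symmetric]; exact m
          rw [fire_of_eq_two hji m] at hx
          obtain ⟨k', rfl, h1⟩ := ih k (by omega) h hi hx
          have h2 := h1.step hj (by rwa [fire_of_eq_two hji.symm m'])
          rwa [fire_comm hji m, simple_comm m] at h2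
        · have m' : M i j = 3 := by rw [M.symmetric]; exact m
          rw [fire_of_eq_three hji m] at hx
          obtain ⟨k', rfl, h1⟩ := ih k (by omega) h hi (by omega)
          obtain ⟨k'', rfl, h2⟩ := ih k' (by omega) h1 hj (by
            rw [fire_of_eq_three hji.symm m']; omega)
          have v2 : fire M j (fire M i y) i = y j := by
            rw [fire_of_eq_three hji m, fire_self, fire_of_eq_three hji.symm m']; ring
          have h3 := h2.step hi (by rw [v2]; exact hy)
          have h4 := h3.step hj (by
            rw [fire_of_eq_three hji.symm m', v2, fire_self, fire_of_eq_three hji.symm m']; omega)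
          rw [fire_braid hji m, simple_braid m] at h4
          simpa using h4

lemma exists_simple_mul_eq (hM : M.IsSimplyLaced) {k : ℕ} : ∀ {x : B → ℤ} {r : W} {i : B},
    Reach cs σ a k x r → i ∈ σ → x i = 0 →
      ∃ t ∈ σ.erase a, cs.simple i * r = r * cs.simple t := by
  induction k using Nat.strong_induction_on with
  | _ k ih =>
    intro x r i h hi hx
    cases h with
    | base =>
      refine ⟨i, Finset.mem_erase.2 ⟨?_, hi⟩, by simp⟩
      rintro rfl
      simp at hx
    | @step k y r j h hj hy =>
      have hji : j ≠ i := by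
        rintro rfl
        rw [fire_self] at hx
        omega
      rcases hM j i hji with m | m
      · rw [fire_of_eq_two hji m] at hx
        obtain ⟨t, ht, e⟩ := ih k (by omega) h hi hx
        exact ⟨t, ht, by rw [← simple_comm m, e, mul_assoc]⟩
      · have m' : M i j = 3 := by rw [M.symmetric]; exact m
        rw [fire_of_eq_three hji m] at hx
        obtain ⟨k', rfl, h1⟩ := h.down hM hi (by omega)
        obtain ⟨t, ht, e⟩ := ih k' (by omega) h1 hj (by
          rw [fire_of_eq_three hji.symm m']; omega)
        refine ⟨t, ht, ?_⟩
        have e' := simple_braid (cs := cs) m' (cs.simple i * r)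
        rw [cs.simple_mul_simple_cancel_left, e] at e'
        rw [e']
        simp [mul_assoc]

lemma unique (hM : M.IsSimplyLaced) {k : ℕ} : ∀ {x : B → ℤ} {r : W} {k' : ℕ} {r' : W},
    Reach cs σ a k x r → Reach cs σ a k' x r' → k = k' ∧ r = r' := by
  induction k with
  | zero =>
    intro x r k' r' h h'
    obtain ⟨rfl, rfl⟩ := h.of_zero
    cases k' with
    | zero => exact ⟨rfl, h'.of_zero.2.symm⟩
    | succ k' =>
      obtain ⟨j, -, hj, -⟩ := h'.exists_neg
      exact absurd hj (not_lt.2 (single_nonneg j))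
  | succ k ih =>
    intro x r k' r' h h'
    obtain ⟨j, hj, hx, h1⟩ := h.exists_neg
    obtain ⟨k'', rfl, h2⟩ := h'.down hM hj hx
    obtain ⟨rfl, e⟩ := ih h1 h2
    exact ⟨rfl, mul_left_cancel e⟩

lemma weightAction_eq (hM : M.IsSimplyLaced) {k : ℕ} {x : B → ℤ} {r : W}
    (h : Reach cs σ a k x r) : weightAction cs hM r (Pi.single a 1) = x := by
  induction h with
  | base => simp
  | step _ _ _ ih => rw [map_mul, Equiv.Perm.mul_apply, ih, weightAction_simple]

lemma mem_parabolic {k : ℕ} {x : B → ℤ} {r : W}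
    (h : Reach cs σ a k x r) : r ∈ parabolic cs σ := by
  induction h with
  | base => exact one_mem _
  | @step _ _ _ i _ hi _ ih =>
    exact mul_mem (Subgroup.subset_closure ⟨i, hi, rfl⟩) ih

lemma length_le {k : ℕ} {x : B → ℤ} {r : W} (h : Reach cs σ a k x r) : cs.length r ≤ k := by
  induction h with
  | base => simp
  | @step k _ r i _ _ _ ih =>
    have := cs.length_mul_le (cs.simple i) r
    rw [cs.length_simple] at this
    omega

end Reach

variable {σ : Finset B} {a : B}

lemma exists_reach_mul_wordProd (hM : M.IsSimplyLaced) (l : List B) (hl : ∀ i ∈ l, i ∈ σ) :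
    ∃ (k : ℕ) (x : B → ℤ) (r : W) (l' : List B), Reach cs σ a k x r ∧
      (∀ i ∈ l', i ∈ σ.erase a) ∧ k + l'.length ≤ l.length ∧
      cs.wordProd l = r * cs.wordProd l' := by
  induction l with
  | nil => exact ⟨0, _, 1, [], .base, by simp, by simp, by simp⟩
  | cons i l ih =>
    obtain ⟨k, x, r, l', h, hl', hk, e⟩ := ih fun j hj => hl j (List.mem_cons_of_mem _ hj)
    have hi := hl i List.mem_cons_self
    rw [cs.wordProd_cons, e, ← mul_assoc]
    rcases lt_trichotomy (x i) 0 with hx | hx | hx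
    · obtain ⟨k', rfl, h'⟩ := h.down hM hi hx
      exact ⟨k', _, _, l', h', hl', by simp; omega, rfl⟩
    · obtain ⟨t, ht, e'⟩ := h.exists_simple_mul_eq hM hi hx
      refine ⟨k, x, r, t :: l', h, ?_, by simp; omega, ?_⟩
      · rintro j (_ | ⟨_, hj⟩)
        exacts [ht, hl' j hj]
      · rw [e', cs.wordProd_cons, mul_assoc]
    · exact ⟨k + 1, _, _, l', h.step hi hx, hl', by simp; omega, rfl⟩

lemma weightAction_of_mem_parabolic (hM : M.IsSimplyLaced) (ha : a ∉ σ) {w : W}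
    (hw : w ∈ parabolic cs σ) : weightAction cs hM w (Pi.single a 1) = Pi.single a 1 := by
  induction hw using Subgroup.closure_induction with
  | mem w hw =>
    obtain ⟨i, hi, rfl⟩ := hw
    rw [weightAction_simple]
    have hia : i ≠ a := fun h => ha (h ▸ hi)
    funext j
    simp [fire, hia]
  | one => simp
  | mul u w _ _ hu hw => rw [map_mul, Equiv.Perm.mul_apply, hw, hu]
  | inv w _ hw => rw [map_inv, Equiv.Perm.inv_eq_iff_eq, hw]

omit [DecidableEq B] in
lemma wordProd_mem_parabolic {l : List B} (hl : ∀ i ∈ l, i ∈ σ) :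
    cs.wordProd l ∈ parabolic cs σ := by
  induction l with
  | nil => simp
  | cons i l ih =>
    rw [cs.wordProd_cons]
    exact mul_mem (Subgroup.subset_closure ⟨i, hl i List.mem_cons_self, rfl⟩)
      (ih fun j hj => hl j (List.mem_cons_of_mem _ hj))

variable [Fintype B]

/-- An element of a standard parabolic subgroup has a reduced word in that subgroup. -/
theorem exists_reduced_word_of_mem_parabolic (hM : M.IsSimplyLaced) (σ : Finset B) :
    ∀ w ∈ parabolic cs σ, ∃ l : List B, (∀ i ∈ l, i ∈ σ) ∧ l.length = cs.length w ∧
      cs.wordProd l = w := by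
  induction hn : σᶜ.card generalizing σ with
  | zero =>
    intro w _
    obtain ⟨l, hl, rfl⟩ := cs.exists_isReduced w
    have : σ = Finset.univ := by
      rwa [Finset.card_eq_zero, Finset.compl_eq_empty_iff] at hn
    exact ⟨l, by simp [this], hl.eq.symm, rfl⟩
  | succ n ih =>
    intro w hw
    obtain ⟨a, ha⟩ : σᶜ.Nonempty := by
      rw [← Finset.card_pos]; omega
    have ha' : a ∉ σ := Finset.mem_compl.1 ha
    have hcard : (insert a σ)ᶜ.card = n := by
      rw [Finset.compl_insert, Finset.card_erase_of_mem ha]; omega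
    have hw' : w ∈ parabolic cs (insert a σ) :=
      Subgroup.closure_mono (Set.image_mono (by simp)) hw
    obtain ⟨l, hl, hlen, rfl⟩ := ih (insert a σ) hcard w hw'
    obtain ⟨k, x, r, l', h, hl', hk, e⟩ :=
      exists_reach_mul_wordProd (cs := cs) (a := a) hM l hl
    rw [Finset.erase_insert ha'] at hl'
    have hx : x = Pi.single a 1 := by
      have h1 := weightAction_of_mem_parabolic hM ha' hw
      rw [e, map_mul, Equiv.Perm.mul_apply,
        weightAction_of_mem_parabolic hM ha' (wordProd_mem_parabolic hl'),
        h.weightAction_eq] at h1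
      exact h1
    subst hx
    obtain ⟨rfl, rfl⟩ := h.unique hM .base
    rw [one_mul] at e
    refine ⟨l', hl', le_antisymm (by omega) ?_, e.symm⟩
    rw [e]
    exact cs.length_wordProd_le l'

lemma Reach.length_mul (hM : M.IsSimplyLaced) {k : ℕ} {x : B → ℤ} {r : W}
    (h : Reach cs σ a k x r) {u : W} (hu : u ∈ parabolic cs (σ.erase a)) :
    cs.length (r * u) = k + cs.length u := by
  have hu' : u ∈ parabolic cs σ :=
    Subgroup.closure_mono (Set.image_mono (by simp)) hu
  obtain ⟨l, hl, hlen, e⟩ :=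
    exists_reduced_word_of_mem_parabolic hM σ _ (mul_mem h.mem_parabolic hu')
  obtain ⟨k', x', r', l', h', hl', hk, e'⟩ :=
    exists_reach_mul_wordProd (cs := cs) (a := a) hM l hl
  have hx : x = x' := by
    have h1 := congrArg (fun w => weightAction cs hM w (Pi.single a 1)) (e.symm.trans e')
    simpa only [map_mul, Equiv.Perm.mul_apply, h.weightAction_eq, h'.weightAction_eq,
      weightAction_of_mem_parabolic hM (Finset.notMem_erase a σ) hu,
      weightAction_of_mem_parabolic hM (Finset.notMem_erase a σ)
        (wordProd_mem_parabolic hl')] using h1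
  subst hx
  obtain ⟨rfl, rfl⟩ := h.unique hM h'
  have hul : u = cs.wordProd l' := mul_left_cancel (e.symm.trans e')
  have h2 := cs.length_wordProd_le l'
  have h3 := cs.length_mul_le r u
  have h4 := h.length_le
  rw [← hul] at h2
  omega

variable (M) in
/-- The weights reached after `k` moves of the numbers game inside `σ`. -/
def weightLayer (σ : Finset B) (a : B) : ℕ → Finset (B → ℤ)
  | 0 => {Pi.single a 1}
  | k + 1 => (weightLayer σ a k).biUnion fun x =>
      (σ.filter fun i => 0 < x i).image fun i => fire M i x

lemma mem_weightLayer {k : ℕ} {x : B → ℤ} :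
    x ∈ weightLayer M σ a k ↔ ∃ r, Reach cs σ a k x r := by
  induction k generalizing x with
  | zero =>
    simp only [weightLayer, Finset.mem_singleton]
    exact ⟨fun h => h ▸ ⟨1, .base⟩, fun ⟨_, h⟩ => h.of_zero.1⟩
  | succ k ih =>
    simp only [weightLayer, Finset.mem_biUnion, Finset.mem_image, Finset.mem_filter]
    constructor
    · rintro ⟨y, hy, i, ⟨hi, hpos⟩, rfl⟩
      obtain ⟨r, hr⟩ := ih.1 hy
      exact ⟨_, hr.step hi hpos⟩
    · rintro ⟨r, hr⟩
      cases hr with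
      | @step _ y r i h hi hpos => exact ⟨y, ih.2 ⟨r, h⟩, i, ⟨hi, hpos⟩, rfl⟩

lemma weightLayer_eq_empty {N : ℕ} (hN : weightLayer M σ a N = ∅) {k : ℕ} (hk : N ≤ k) :
    weightLayer M σ a k = ∅ := by
  induction k, hk using Nat.le_induction with
  | base => exact hN
  | succ k _ ih => simp [weightLayer, ih]

omit [DecidableEq B] [Fintype B] in
lemma poin_eq_sum {σ : Finset B} (s : Finset W) (hs : ∀ w, w ∈ s ↔ w ∈ parabolic cs σ) :
    (parabolic cs σ : Set W).Finite ∧ poin cs σ = ∑ w ∈ s, X ^ cs.length w := by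
  have hf : (parabolic cs σ : Set W).Finite :=
    s.finite_toSet.subset fun w hw => (hs w).2 hw
  refine ⟨hf, ?_⟩
  rw [poin, dif_pos hf]
  refine Finset.sum_congr ?_ fun _ _ => rfl
  ext w
  simp [hs]

/-- The Poincaré polynomial of `W_σ` is that of `W_{σ∖{a}}` times the generating function of the
layers of the orbit of the fundamental weight of `a`. -/
theorem poin_eq_mul_of_layers (hM : M.IsSimplyLaced) {N : ℕ}
    (hN : weightLayer M σ a N = ∅) (hf : (parabolic cs (σ.erase a) : Set W).Finite) :
    (parabolic cs σ : Set W).Finite ∧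
      poin cs σ = (∑ k ∈ Finset.range N, ((weightLayer M σ a k).card : ℚ[X]) * X ^ k) *
        poin cs (σ.erase a) := by
  classical
  have hrep : ∀ p : Σ _ : ℕ, (B → ℤ), ∃ r, p.2 ∈ weightLayer M σ a p.1 →
      Reach cs σ a p.1 p.2 r := by
    intro p
    by_cases hp : p.2 ∈ weightLayer M σ a p.1
    · obtain ⟨r, hr⟩ := (mem_weightLayer (cs := cs)).1 hp
      exact ⟨r, fun _ => hr⟩
    · exact ⟨1, fun h => absurd h hp⟩
  choose ρ hρ using hrep
  have hle : parabolic cs (σ.erase a) ≤ parabolic cs σ :=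
    Subgroup.closure_mono (Set.image_mono (by simp))
  set P : Finset ((Σ _ : ℕ, (B → ℤ)) × W) :=
    ((Finset.range N).sigma fun k => weightLayer M σ a k) ×ˢ hf.toFinset with hP
  have memP : ∀ p ∈ P, Reach cs σ a p.1.1 p.1.2 (ρ p.1) ∧ p.2 ∈ parabolic cs (σ.erase a) := by
    intro p hp
    rw [hP, Finset.mem_product, Finset.mem_sigma] at hp
    exact ⟨hρ _ hp.1.2, by simpa using hp.2⟩
  have hinj : Set.InjOn (fun p : (Σ _ : ℕ, (B → ℤ)) × W => ρ p.1 * p.2) P := by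
    rintro ⟨⟨k, x⟩, u⟩ hp ⟨⟨k', x'⟩, u'⟩ hp' h
    obtain ⟨h1, hu⟩ := memP _ hp
    obtain ⟨h1', hu'⟩ := memP _ hp'
    simp only at h h1 h1' hu hu'
    have hx : x = x' := by
      have h2 := congrArg (fun w => weightAction cs hM w (Pi.single a 1)) h
      simpa only [map_mul, Equiv.Perm.mul_apply, h1.weightAction_eq, h1'.weightAction_eq,
        weightAction_of_mem_parabolic hM (Finset.notMem_erase a σ) hu,
        weightAction_of_mem_parabolic hM (Finset.notMem_erase a σ) hu'] using h2
    subst hx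
    obtain ⟨rfl, -⟩ := h1.unique hM h1'
    rw [mul_left_cancel h]
  have himg : ∀ w, w ∈ P.image (fun p => ρ p.1 * p.2) ↔ w ∈ parabolic cs σ := by
    intro w
    rw [Finset.mem_image]
    constructor
    · rintro ⟨p, hp, rfl⟩
      exact mul_mem (memP p hp).1.mem_parabolic (hle (memP p hp).2)
    · intro hw
      obtain ⟨l, hl, -, rfl⟩ := exists_reduced_word_of_mem_parabolic hM σ w hw
      obtain ⟨k, x, r, l', h, hl', -, e⟩ :=
        exists_reach_mul_wordProd (cs := cs) (a := a) hM l hl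
      have hx : x ∈ weightLayer M σ a k := mem_weightLayer.2 ⟨r, h⟩
      have hk : k < N := by
        by_contra hk
        rw [weightLayer_eq_empty hN (not_lt.1 hk)] at hx
        simp at hx
      refine ⟨⟨⟨k, x⟩, cs.wordProd l'⟩, ?_, ?_⟩
      · rw [hP, Finset.mem_product, Finset.mem_sigma]
        exact ⟨⟨Finset.mem_range.2 hk, hx⟩, by simpa using wordProd_mem_parabolic hl'⟩
      · rw [e, ((hρ ⟨k, x⟩ hx).unique hM h).2]
  obtain ⟨hfin, hsum⟩ := poin_eq_sum _ himg
  refine ⟨hfin, ?_⟩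
  rw [hsum, Finset.sum_image hinj, poin, dif_pos hf, Finset.sum_mul, hP,
    Finset.sum_product, Finset.sum_sigma]
  refine Finset.sum_congr rfl fun k hk => ?_
  rw [mul_assoc, ← nsmul_eq_mul, ← Finset.sum_const]
  refine Finset.sum_congr rfl fun x hx => ?_
  rw [Finset.mul_sum]
  refine Finset.sum_congr rfl fun u hu => ?_
  rw [← pow_add, (hρ ⟨k, x⟩ hx).length_mul hM (by simpa using hu)]

end NumbersGame

section PoincareE8

/-- The bit mask of a set of vertices of the `E₈` diagram. -/
def bitMask (σ : Finset (Fin 8)) : ℕ := ∑ i ∈ σ, 2 ^ (i : ℕ)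

lemma bitMask_lt : ∀ σ : Finset (Fin 8), bitMask σ < 256 := by decide +kernel

lemma testBit_bitMask : ∀ (σ : Finset (Fin 8)) (i : Fin 8),
    (bitMask σ).testBit i = decide (i ∈ σ) := by decide +kernel

lemma log2_bitMask_mem : ∀ σ : Finset (Fin 8), σ.Nonempty →
    ∃ a ∈ σ, (a : ℕ) = Nat.log2 (bitMask σ) := by decide +kernel

lemma bitMask_erase {σ : Finset (Fin 8)} {a : Fin 8} (ha : a ∈ σ) :
    bitMask (σ.erase a) = bitMask σ - 2 ^ (a : ℕ) := by
  rw [bitMask, bitMask, ← Finset.add_sum_erase σ _ ha, Nat.add_sub_cancel_left]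

/-- Rows of the Cartan matrix of type `E₈`. -/
def e8Row (i : ℕ) : List ℤ :=
  [[2, 0, -1, 0, 0, 0, 0, 0],
    [0, 2, 0, -1, 0, 0, 0, 0],
    [-1, 0, 2, -1, 0, 0, 0, 0],
    [0, -1, -1, 2, -1, 0, 0, 0],
    [0, 0, 0, -1, 2, -1, 0, 0],
    [0, 0, 0, 0, -1, 2, -1, 0],
    [0, 0, 0, 0, 0, -1, 2, -1],
    [0, 0, 0, 0, 0, 0, -1, 2]].getD i []
def fireList (i : ℕ) (x : List ℤ) : List ℤ :=
  List.zipWith (fun a c => a - x.getD i 0 * c) x (e8Row i)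

def nextLayer (m : ℕ) (L : List (List ℤ)) : List (List ℤ) :=
  (L.flatMap fun x => ((List.range 8).filter fun i => m.testBit i && decide (0 < x.getD i 0)).map
    fun i => fireList i x).dedup

def layerSizes (m : ℕ) : ℕ → List (List ℤ) → Option (List ℕ)
  | _, [] => some []
  | 0, _ :: _ => none
  | n + 1, x :: L => (layerSizes m n (nextLayer m (x :: L))).map ((x :: L).length :: ·)

def degreesE8 (m : ℕ) : List ℕ :=
  [[], [2], [2], [2, 2],
    [2], [2, 3], [2, 2], [2, 2, 3],
    [2], [2, 2], [2, 3], [2, 2, 3],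
    [2, 3], [2, 3, 4], [2, 3, 4], [2, 3, 4, 5],
    [2], [2, 2], [2, 2], [2, 2, 2],
    [2, 2], [2, 2, 3], [2, 2, 2], [2, 2, 2, 3],
    [2, 3], [2, 2, 3], [2, 3, 4], [2, 2, 3, 4],
    [2, 3, 4], [2, 3, 4, 5], [2, 4, 4, 6], [2, 4, 5, 6, 8],
    [2], [2, 2], [2, 2], [2, 2, 2],
    [2, 2], [2, 2, 3], [2, 2, 2], [2, 2, 2, 3],
    [2, 2], [2, 2, 2], [2, 2, 3], [2, 2, 2, 3],
    [2, 2, 3], [2, 2, 3, 4], [2, 2, 3, 4], [2, 2, 3, 4, 5],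
    [2, 3], [2, 2, 3], [2, 2, 3], [2, 2, 2, 3],
    [2, 2, 3], [2, 2, 3, 3], [2, 2, 2, 3], [2, 2, 2, 3, 3],
    [2, 3, 4], [2, 2, 3, 4], [2, 3, 4, 5], [2, 2, 3, 4, 5],
    [2, 3, 4, 5], [2, 3, 4, 5, 6], [2, 4, 5, 6, 8], [2, 5, 6, 8, 9, 12],
    [2], [2, 2], [2, 2], [2, 2, 2],
    [2, 2], [2, 2, 3], [2, 2, 2], [2, 2, 2, 3],
    [2, 2], [2, 2, 2], [2, 2, 3], [2, 2, 2, 3],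
    [2, 2, 3], [2, 2, 3, 4], [2, 2, 3, 4], [2, 2, 3, 4, 5],
    [2, 2], [2, 2, 2], [2, 2, 2], [2, 2, 2, 2],
    [2, 2, 2], [2, 2, 2, 3], [2, 2, 2, 2], [2, 2, 2, 2, 3],
    [2, 2, 3], [2, 2, 2, 3], [2, 2, 3, 4], [2, 2, 2, 3, 4],
    [2, 2, 3, 4], [2, 2, 3, 4, 5], [2, 2, 4, 4, 6], [2, 2, 4, 5, 6, 8],
    [2, 3], [2, 2, 3], [2, 2, 3], [2, 2, 2, 3],
    [2, 2, 3], [2, 2, 3, 3], [2, 2, 2, 3], [2, 2, 2, 3, 3],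
    [2, 2, 3], [2, 2, 2, 3], [2, 2, 3, 3], [2, 2, 2, 3, 3],
    [2, 2, 3, 3], [2, 2, 3, 3, 4], [2, 2, 3, 3, 4], [2, 2, 3, 3, 4, 5],
    [2, 3, 4], [2, 2, 3, 4], [2, 2, 3, 4], [2, 2, 2, 3, 4],
    [2, 2, 3, 4], [2, 2, 3, 3, 4], [2, 2, 2, 3, 4], [2, 2, 2, 3, 3, 4],
    [2, 3, 4, 5], [2, 2, 3, 4, 5], [2, 3, 4, 5, 6], [2, 2, 3, 4, 5, 6],
    [2, 3, 4, 5, 6], [2, 3, 4, 5, 6, 7], [2, 4, 6, 6, 8, 10], [2, 6, 8, 10, 12, 14, 18],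
    [2], [2, 2], [2, 2], [2, 2, 2],
    [2, 2], [2, 2, 3], [2, 2, 2], [2, 2, 2, 3],
    [2, 2], [2, 2, 2], [2, 2, 3], [2, 2, 2, 3],
    [2, 2, 3], [2, 2, 3, 4], [2, 2, 3, 4], [2, 2, 3, 4, 5],
    [2, 2], [2, 2, 2], [2, 2, 2], [2, 2, 2, 2],
    [2, 2, 2], [2, 2, 2, 3], [2, 2, 2, 2], [2, 2, 2, 2, 3],
    [2, 2, 3], [2, 2, 2, 3], [2, 2, 3, 4], [2, 2, 2, 3, 4],
    [2, 2, 3, 4], [2, 2, 3, 4, 5], [2, 2, 4, 4, 6], [2, 2, 4, 5, 6, 8],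
    [2, 2], [2, 2, 2], [2, 2, 2], [2, 2, 2, 2],
    [2, 2, 2], [2, 2, 2, 3], [2, 2, 2, 2], [2, 2, 2, 2, 3],
    [2, 2, 2], [2, 2, 2, 2], [2, 2, 2, 3], [2, 2, 2, 2, 3],
    [2, 2, 2, 3], [2, 2, 2, 3, 4], [2, 2, 2, 3, 4], [2, 2, 2, 3, 4, 5],
    [2, 2, 3], [2, 2, 2, 3], [2, 2, 2, 3], [2, 2, 2, 2, 3],
    [2, 2, 2, 3], [2, 2, 2, 3, 3], [2, 2, 2, 2, 3], [2, 2, 2, 2, 3, 3],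
    [2, 2, 3, 4], [2, 2, 2, 3, 4], [2, 2, 3, 4, 5], [2, 2, 2, 3, 4, 5],
    [2, 2, 3, 4, 5], [2, 2, 3, 4, 5, 6], [2, 2, 4, 5, 6, 8], [2, 2, 5, 6, 8, 9, 12],
    [2, 3], [2, 2, 3], [2, 2, 3], [2, 2, 2, 3],
    [2, 2, 3], [2, 2, 3, 3], [2, 2, 2, 3], [2, 2, 2, 3, 3],
    [2, 2, 3], [2, 2, 2, 3], [2, 2, 3, 3], [2, 2, 2, 3, 3],
    [2, 2, 3, 3], [2, 2, 3, 3, 4], [2, 2, 3, 3, 4], [2, 2, 3, 3, 4, 5],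
    [2, 2, 3], [2, 2, 2, 3], [2, 2, 2, 3], [2, 2, 2, 2, 3],
    [2, 2, 2, 3], [2, 2, 2, 3, 3], [2, 2, 2, 2, 3], [2, 2, 2, 2, 3, 3],
    [2, 2, 3, 3], [2, 2, 2, 3, 3], [2, 2, 3, 3, 4], [2, 2, 2, 3, 3, 4],
    [2, 2, 3, 3, 4], [2, 2, 3, 3, 4, 5], [2, 2, 3, 4, 4, 6], [2, 2, 3, 4, 5, 6, 8],
    [2, 3, 4], [2, 2, 3, 4], [2, 2, 3, 4], [2, 2, 2, 3, 4],
    [2, 2, 3, 4], [2, 2, 3, 3, 4], [2, 2, 2, 3, 4], [2, 2, 2, 3, 3, 4],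
    [2, 2, 3, 4], [2, 2, 2, 3, 4], [2, 2, 3, 3, 4], [2, 2, 2, 3, 3, 4],
    [2, 2, 3, 3, 4], [2, 2, 3, 3, 4, 4], [2, 2, 3, 3, 4, 4], [2, 2, 3, 3, 4, 4, 5],
    [2, 3, 4, 5], [2, 2, 3, 4, 5], [2, 2, 3, 4, 5], [2, 2, 2, 3, 4, 5],
    [2, 2, 3, 4, 5], [2, 2, 3, 3, 4, 5], [2, 2, 2, 3, 4, 5], [2, 2, 2, 3, 3, 4, 5],
    [2, 3, 4, 5, 6], [2, 2, 3, 4, 5, 6], [2, 3, 4, 5, 6, 7], [2, 2, 3, 4, 5, 6, 7],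
    [2, 3, 4, 5, 6, 7], [2, 3, 4, 5, 6, 7, 8], [2, 4, 6, 7, 8, 10, 12], [2, 8, 12, 14, 18, 20, 24, 30]].getD m []

/-- Difference of coefficient lists. -/
def subCoeffs : List ℤ → List ℤ → List ℤ
  | l, [] => l
  | [], b :: l => -b :: subCoeffs [] l
  | a :: l, b :: l' => (a - b) :: subCoeffs l l'

/-- The coefficient list of `(X ^ n - 1) * f` from that of `f`. -/
def mulXPowSubOne (n : ℕ) (l : List ℤ) : List ℤ :=
  subCoeffs (List.replicate n 0 ++ l) l

def e8Check (m : ℕ) : Bool :=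
  let a := Nat.log2 m
  let τ := degreesE8 (m - 2 ^ a)
  match layerSizes m 60 [(List.range 8).map fun i => if i = a then 1 else 0] with
  | none => false
  | some c =>
    decide ((degreesE8 m).length = τ.length + 1) &&
    decide (τ.foldr mulXPowSubOne (mulXPowSubOne 1 (c.map Int.ofNat)) =
      (degreesE8 m).foldr mulXPowSubOne [1])

lemma e8Check_eq_true : ∀ m < 256, 0 < m → e8Check m = true := by decide +kernel

variable {Mat : CoxeterMatrix (Fin 8)}

/-- The Coxeter matrix of type `E₈`, described by its Cartan matrix. -/
def IsTypeE8 (Mat : CoxeterMatrix (Fin 8)) : Prop :=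
  Mat.IsSimplyLaced ∧ ∀ i j : Fin 8, cartanEntry Mat i j = (e8Row i).getD j 0

lemma isTypeE8_of_entries
    (hM : ∀ i j : Fin 8, i.val < j.val →
      Mat.M i j = (if (i.val, j.val) ∈ ([(0, 2), (1, 3), (2, 3), (3, 4), (4, 5), (5, 6), (6, 7)] :
        List (ℕ × ℕ)) then 3 else 2)) : IsTypeE8 Mat := by
  refine ⟨fun i j hij => ?_, fun i j => ?_⟩
  · rcases lt_or_gt_of_ne hij with h | h
    · rw [hM i j h]; split_ifs <;> simp
    · rw [Mat.symmetric, hM j i h]; split_ifs <;> simp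
  · rcases lt_trichotomy i j with h | rfl | h
    · rw [cartanEntry, hM i j h]
      revert i j; decide +kernel
    · rw [cartanEntry, if_pos rfl]
      clear hM
      revert i; decide +kernel
    · rw [cartanEntry, Mat.symmetric, hM j i h]
      revert i j; decide +kernel

/-- The weight with a given list of coordinates. -/
def toWeight (x : List ℤ) : Fin 8 → ℤ := fun j => x.getD j 0

lemma toWeight_injOn {x y : List ℤ} (hx : x.length = 8) (hy : y.length = 8)
    (h : toWeight x = toWeight y) : x = y := by
  refine List.ext_getElem (hx.trans hy.symm) fun j h1 h2 => ?_
  have := congrFun h ⟨j, hx ▸ h1⟩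
  simpa [toWeight, h1, h2] using this

lemma length_e8Row : ∀ i : Fin 8, (e8Row i).length = 8 := by decide +kernel

lemma length_fireList {i : Fin 8} {x : List ℤ} (hx : x.length = 8) :
    (fireList i x).length = 8 := by
  simp [fireList, hx, length_e8Row]

lemma toWeight_fireList (hE : IsTypeE8 Mat) {i : Fin 8} {x : List ℤ} (hx : x.length = 8) :
    toWeight (fireList i x) = fire Mat i (toWeight x) := by
  funext j
  have h1 : (j : ℕ) < x.length := by omega
  have h2 : (j : ℕ) < (e8Row i).length := by rw [length_e8Row]; exact j.2
  rw [fire, hE.2]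
  simp [toWeight, fireList, h1, h2]

/-- `L` lists the weights of the `k`-th layer without repetition. -/
def IsLayerList (Mat : CoxeterMatrix (Fin 8)) (σ : Finset (Fin 8)) (a : Fin 8) (k : ℕ)
    (L : List (List ℤ)) : Prop :=
  L.Nodup ∧ (∀ x ∈ L, x.length = 8) ∧
    ∀ w, w ∈ weightLayer Mat σ a k ↔ ∃ x ∈ L, toWeight x = w

lemma IsLayerList.next (hE : IsTypeE8 Mat) {σ : Finset (Fin 8)} {a : Fin 8} {k : ℕ}
    {L : List (List ℤ)} (h : IsLayerList Mat σ a k L) :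
    IsLayerList Mat σ a (k + 1) (nextLayer (bitMask σ) L) := by
  obtain ⟨-, hlen, hmem⟩ := h
  have key : ∀ y, y ∈ nextLayer (bitMask σ) L ↔
      ∃ x ∈ L, ∃ i : Fin 8, (i ∈ σ ∧ 0 < toWeight x i) ∧ fireList i x = y := by
    intro y
    simp only [nextLayer, List.mem_dedup, List.mem_flatMap, List.mem_map, List.mem_filter,
      List.mem_range, Bool.and_eq_true, decide_eq_true_eq]
    refine exists_congr fun x => and_congr_right fun _ => ?_
    constructor
    · rintro ⟨i, ⟨hi, hb, hpos⟩, rfl⟩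
      refine ⟨⟨i, hi⟩, ⟨?_, hpos⟩, rfl⟩
      rw [← decide_eq_true_eq (p := _ ∈ σ), ← testBit_bitMask]
      exact hb
    · rintro ⟨i, ⟨hi, hpos⟩, rfl⟩
      exact ⟨i, ⟨i.2, by rw [testBit_bitMask]; simpa using hi, hpos⟩, rfl⟩
  refine ⟨List.nodup_dedup _, ?_, ?_⟩
  · intro y hy
    obtain ⟨x, hx, i, -, rfl⟩ := (key y).1 hy
    exact length_fireList (hlen x hx)
  · intro w
    simp only [weightLayer, Finset.mem_biUnion, Finset.mem_image, Finset.mem_filter]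
    constructor
    · rintro ⟨v, hv, i, hi, rfl⟩
      obtain ⟨x, hx, rfl⟩ := (hmem v).1 hv
      exact ⟨_, (key _).2 ⟨x, hx, i, hi, rfl⟩, toWeight_fireList hE (hlen x hx)⟩
    · rintro ⟨y, hy, rfl⟩
      obtain ⟨x, hx, i, hi, rfl⟩ := (key y).1 hy
      exact ⟨_, (hmem _).2 ⟨x, hx, rfl⟩, i, hi, (toWeight_fireList hE (hlen x hx)).symm⟩

lemma IsLayerList.card_eq {σ : Finset (Fin 8)} {a : Fin 8} {k : ℕ}
    {L : List (List ℤ)} (h : IsLayerList Mat σ a k L) :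
    (weightLayer Mat σ a k).card = L.length := by
  obtain ⟨hnd, hlen, hmem⟩ := h
  have : weightLayer Mat σ a k = L.toFinset.image toWeight := by
    ext w
    simp [hmem]
  rw [this, Finset.card_image_of_injOn, List.toFinset_card_of_nodup hnd]
  intro x hx y hy
  exact toWeight_injOn (hlen x (by simpa using hx)) (hlen y (by simpa using hy))

/-- The polynomial with a given list of coefficients. -/
noncomputable def ofCoeffs : List ℤ → ℚ[X]
  | [] => 0
  | a :: l => (a : ℚ[X]) + X * ofCoeffs l

lemma ofCoeffs_subCoeffs (l l' : List ℤ) :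
    ofCoeffs (subCoeffs l l') = ofCoeffs l - ofCoeffs l' := by
  fun_induction subCoeffs l l' with
  | case1 l => simp [ofCoeffs]
  | case2 b l ih => simp only [ofCoeffs, ih]; push_cast; ring
  | case3 a l b l' ih => simp only [ofCoeffs, ih]; push_cast; ring

lemma ofCoeffs_mulXPowSubOne (n : ℕ) (l : List ℤ) :
    ofCoeffs (mulXPowSubOne n l) = (X ^ n - 1) * ofCoeffs l := by
  have : ofCoeffs (List.replicate n 0 ++ l) = X ^ n * ofCoeffs l := by
    induction n with
    | zero => simp
    | succ n ih => simp only [List.replicate_succ, List.cons_append, ofCoeffs, ih]; push_cast; ring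
  rw [mulXPowSubOne, ofCoeffs_subCoeffs, this]
  ring

lemma ofCoeffs_foldr (d : List ℕ) (l : List ℤ) :
    ofCoeffs (d.foldr mulXPowSubOne l) =
      (d.map fun n => (X ^ n - 1 : ℚ[X])).prod * ofCoeffs l := by
  induction d with
  | nil => simp
  | cons n d ih => simp [ofCoeffs_mulXPowSubOne, ih, mul_assoc]

lemma exists_sum_layers_eq (hE : IsTypeE8 Mat) {σ : Finset (Fin 8)} {a : Fin 8} (n : ℕ) :
    ∀ {k : ℕ} {L : List (List ℤ)} {c : List ℕ}, IsLayerList Mat σ a k L →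
      layerSizes (bitMask σ) n L = some c → ∃ N, weightLayer Mat σ a (k + N) = ∅ ∧
        ∑ j ∈ Finset.range N, ((weightLayer Mat σ a (k + j)).card : ℚ[X]) * X ^ j =
          ofCoeffs (c.map Int.ofNat) := by
  induction n with
  | zero =>
    intro k L c h hc
    cases L with
    | nil =>
      obtain rfl : [] = c := by simpa [layerSizes] using hc
      exact ⟨0, Finset.card_eq_zero.1 h.card_eq, by simp [ofCoeffs]⟩
    | cons x L => simp [layerSizes] at hc
  | succ n ih =>
    intro k L c h hc
    cases L with
    | nil =>
      obtain rfl : [] = c := by simpa [layerSizes] using hc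
      exact ⟨0, Finset.card_eq_zero.1 h.card_eq, by simp [ofCoeffs]⟩
    | cons x L =>
      rw [layerSizes, Option.map_eq_some_iff] at hc
      obtain ⟨c', hc', rfl⟩ := hc
      obtain ⟨N, hN, hs⟩ := ih (h.next hE) hc'
      refine ⟨N + 1, by rwa [← add_assoc, add_right_comm], ?_⟩
      rw [Finset.sum_range_succ', add_zero, h.card_eq, List.map_cons, ofCoeffs, ← hs,
        Finset.mul_sum, add_comm]
      congr 1
      · simp
      · refine Finset.sum_congr rfl fun j _ => ?_
        rw [add_right_comm, ← add_assoc]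
        ring

theorem poin_mul_pow_eq {W : Type*} [Group W] (cs : CoxeterSystem Mat W) (hE : IsTypeE8 Mat)
    (σ : Finset (Fin 8)) : (parabolic cs σ : Set W).Finite ∧
      (X - 1) ^ (degreesE8 (bitMask σ)).length * poin cs σ =
        ((degreesE8 (bitMask σ)).map fun n => (X ^ n - 1 : ℚ[X])).prod := by
  induction σ using Finset.strongInduction with
  | H σ ih =>
  rcases σ.eq_empty_or_nonempty with rfl | hne
  · have h := poin_eq_sum (cs := cs) (σ := ∅) {1} (by simp [parabolic])
    refine ⟨h.1, ?_⟩
    rw [h.2]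
    have h0 : degreesE8 (bitMask ∅) = [] := by decide +kernel
    simp [h0]
  · obtain ⟨a, ha, hlog⟩ := log2_bitMask_mem σ hne
    have hpos : 0 < bitMask σ :=
      lt_of_lt_of_le (by positivity)
        (Finset.single_le_sum (f := fun i : Fin 8 => 2 ^ (i : ℕ)) (fun _ _ => Nat.zero_le _) ha)
    have hcheck := e8Check_eq_true _ (bitMask_lt σ) hpos
    rw [e8Check, ← hlog, ← bitMask_erase ha] at hcheck
    split at hcheck
    · exact absurd hcheck (by simp)
    rename_i c hc
    rw [Bool.and_eq_true, decide_eq_true_eq, decide_eq_true_eq] at hcheck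
    obtain ⟨hl, hp⟩ := hcheck
    have hbase : IsLayerList Mat σ a 0
        [(List.range 8).map fun i => if i = (a : ℕ) then 1 else 0] := by
      refine ⟨by simp, by simp, fun w => ?_⟩
      simp only [weightLayer, Finset.mem_singleton, List.mem_singleton, exists_eq_left]
      rw [eq_comm]
      suffices h : toWeight ((List.range 8).map fun i => if i = (a : ℕ) then 1 else 0) =
          Pi.single a 1 by rw [h]
      funext j
      simp [toWeight, Pi.single_apply, Fin.ext_iff]
    obtain ⟨N, hN, hs⟩ := exists_sum_layers_eq hE 60 hbase hc
    simp only [zero_add] at hN hs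
    obtain ⟨hf, hτ⟩ := ih _ (Finset.erase_ssubset ha)
    obtain ⟨hf', he⟩ := poin_eq_mul_of_layers (cs := cs) hE.1 hN hf
    refine ⟨hf', ?_⟩
    have hp' := congrArg ofCoeffs hp
    rw [ofCoeffs_foldr, ofCoeffs_foldr, ofCoeffs_mulXPowSubOne, ← hs] at hp'
    simp only [ofCoeffs] at hp'
    rw [he, hl]
    push_cast at hp'
    rw [mul_zero, add_zero, mul_one, ← hτ] at hp'
    rw [← hp']
    ring

end PoincareE8

section WeightedComplex

variable {B : Type*} {W : Type*} [Group W]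
  {M : CoxeterMatrix B}

/-- All standard parabolic subgroups are finite, and `v d σ` is the multiplicity of `Φ_d` in the
Poincaré polynomial of `W_σ`, all factors being cyclotomic with index in `D`. -/
structure IsCyclotomicSystem [DecidableEq B] (cs : CoxeterSystem M W) (D : Finset ℕ)
    (v : ℕ → Finset B → ℕ) : Prop where
  finite : ∀ σ, (parabolic cs σ : Set W).Finite
  mono : ∀ d ∈ D, ∀ τ s, v d τ ≤ v d (insert s τ)
  poin_eq : ∀ σ, poin cs σ = ∏ d ∈ D, cyclotomic d ℚ ^ v d σ

lemma isCoprime_cyc {d e : ℕ} (h : d ≠ e) : IsCoprime (cyc d) (cyc e) :=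
  (cyclotomic.isCoprime_rat h).map (Polynomial.toLaurent : ℚ[X] →+* R)

lemma cyc_ne_zero (d : ℕ) : cyc d ≠ 0 :=
  fun h => cyclotomic_ne_zero d ℚ (Polynomial.toLaurent_injective (by simpa [cyc] using h))

instance : CharZero R := algebraRat.charZero R

namespace IsCyclotomicSystem

variable {cs : CoxeterSystem M W} {D : Finset ℕ} {v : ℕ → Finset B → ℕ}

section Combinatorics

variable [DecidableEq B] (h : IsCyclotomicSystem cs D v)

include h

lemma toLaurent_poin (σ : Finset B) :
    toLaurent (poin cs σ) = ∏ d ∈ D, cyc d ^ v d σ := by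
  rw [h.poin_eq, map_prod]
  simp [cyc]

lemma toLaurent_poin_ne_zero (σ : Finset B) : toLaurent (poin cs σ) ≠ 0 := by
  rw [h.toLaurent_poin]
  exact Finset.prod_ne_zero_iff.2 fun d _ => pow_ne_zero _ (cyc_ne_zero d)

lemma mono_of_subset {d : ℕ} (hd : d ∈ D) {τ σ : Finset B} (hτσ : τ ⊆ σ) : v d τ ≤ v d σ := by
  rw [← Finset.sdiff_union_of_subset hτσ]
  induction σ \ τ using Finset.induction_on with
  | empty => rw [Finset.empty_union]
  | insert s ρ _ ih =>
    rw [Finset.insert_union]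
    exact ih.trans (h.mono d hd _ _)

lemma toLaurent_div_mul {τ : Finset B} (s : B) :
    toLaurent (poin cs (insert s τ) / poin cs τ) * toLaurent (poin cs τ) =
      toLaurent (poin cs (insert s τ)) := by
  have hdvd : poin cs τ ∣ poin cs (insert s τ) := by
    rw [h.poin_eq, h.poin_eq]
    exact Finset.prod_dvd_prod_of_dvd _ _ fun d hd => pow_dvd_pow _ (h.mono d hd τ s)
  have h0 : poin cs τ ≠ 0 := by
    intro h0
    exact h.toLaurent_poin_ne_zero τ (by rw [h0, map_zero])
  rw [← map_mul, mul_comm, EuclideanDomain.mul_div_cancel' h0 hdvd]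

end Combinatorics

variable (cs) in
/-- The weighted complex as a subcomplex of the augmented chain complex of the simplex:
`e_σ` is sent to `W_σ(q)` times the simplex `σ`. -/
noncomputable def toSimplexChains (k : ℕ) : (KW cs k → R) →ₗ[R] (Finset B → R) :=
  LinearMap.pi fun σ => by
    classical exact if hσ : σ.card = k ∧ (parabolic cs σ : Set W).Finite then
      toLaurent (poin cs σ) • LinearMap.proj (⟨σ, hσ⟩ : KW cs k) else 0

lemma toSimplexChains_apply {k : ℕ} (c : KW cs k → R) (σ : KW cs k) :
    toSimplexChains cs k c σ.1 = toLaurent (poin cs σ.1) * c σ := by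
  simp only [toSimplexChains, LinearMap.pi_apply]
  rw [dif_pos σ.2]
  simp

lemma toSimplexChains_of_card_ne {k : ℕ} (c : KW cs k → R) {σ : Finset B} (hσ : σ.card ≠ k) :
    toSimplexChains cs k c σ = 0 := by
  simp only [toSimplexChains, LinearMap.pi_apply]
  rw [dif_neg fun h' => hσ h'.1]
  simp

variable [Fintype B] [LinearOrder B] (h : IsCyclotomicSystem cs D v)

include h

omit [Fintype B] in
lemma toSimplexChains_injective (k : ℕ) : Function.Injective (toSimplexChains cs k) := by
  rw [← LinearMap.ker_eq_bot, LinearMap.ker_eq_bot']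
  intro c hc
  funext σ
  have := congrFun hc σ.1
  rw [toSimplexChains_apply] at this
  exact (mul_eq_zero.1 this).resolve_left (h.toLaurent_poin_ne_zero _)

omit [Fintype B] in
lemma exists_toSimplexChains_eq {k : ℕ} {y : Finset B → R} (hy : ∀ σ, σ.card ≠ k → y σ = 0)
    (hdvd : ∀ σ, toLaurent (poin cs σ) ∣ y σ) : ∃ c, toSimplexChains cs k c = y := by
  choose c hc using hdvd
  refine ⟨fun σ => c σ.1, ?_⟩
  funext σ
  by_cases hσ : σ.card = k
  · rw [toSimplexChains_apply _ ⟨σ, hσ, h.finite σ⟩, hc]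
  · rw [toSimplexChains_of_card_ne _ hσ, hy σ hσ]

lemma simplexBoundary_toSimplexChains {k : ℕ} (c : KW cs (k + 1) → R) :
    simplexBoundary (toSimplexChains cs (k + 1) c) = toSimplexChains cs k (bdry cs k c) := by
  funext τ
  rw [simplexBoundary_apply]
  by_cases hτ : τ.card = k
  · have hcard : ∀ s, s ∉ τ → (insert s τ).card = k + 1 := fun s hs => by
      rw [Finset.card_insert_of_notMem hs, hτ]
    rw [toSimplexChains_apply _ ⟨τ, hτ, h.finite τ⟩, bdry, Matrix.mulVecLin_apply, Matrix.mulVec,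
      dotProduct, Finset.mul_sum]
    simp only [Matrix.of_apply, bcoeff, Finset.sum_mul, Finset.mul_sum]
    rw [Finset.sum_sigma']
    symm
    rw [← Finset.sum_filter_add_sum_filter_not _ (fun p : Σ _ : KW cs (k + 1), B =>
      τ = p.1.1.erase p.2)]
    rw [Finset.sum_eq_zero (s := Finset.filter (fun p => ¬ _) _), add_zero]
    swap
    · intro p hp
      rw [if_neg (Finset.mem_filter.1 hp).2]
      ring
    refine Finset.sum_bij' (fun p _ => p.2)
      (fun s hs => ⟨⟨insert s τ, hcard s (Finset.mem_compl.1 hs), h.finite _⟩, s⟩) ?_ ?_ ?_ ?_ ?_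
    · rintro ⟨⟨σ, hσ⟩, s⟩ hp
      rw [Finset.mem_filter] at hp
      simp [hp.2]
    · intro s hs
      simp [Finset.erase_insert (Finset.mem_compl.1 hs)]
    · rintro ⟨⟨σ, hσ⟩, s⟩ hp
      rw [Finset.mem_filter, Finset.mem_sigma] at hp
      have : insert s τ = σ := by rw [hp.2]; exact Finset.insert_erase hp.1.2
      subst this
      rfl
    · intro s hs
      rfl
    · rintro ⟨⟨σ, hσ⟩, s⟩ hp
      rw [Finset.mem_filter, Finset.mem_sigma] at hp
      obtain ⟨⟨-, hs : s ∈ σ⟩, hτσ : τ = σ.erase s⟩ := hp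
      have hsτ : s ∉ τ := by simp [hτσ]
      obtain rfl : insert s τ = σ := by rw [hτσ]; exact Finset.insert_erase hs
      rw [if_pos hτσ, toSimplexChains_apply _ ⟨insert s τ, hσ⟩, ← h.toLaurent_div_mul, faceSign,
        Finset.filter_insert, if_neg (lt_irrefl s)]
      ring
  · rw [toSimplexChains_of_card_ne _ hτ]
    refine Finset.sum_eq_zero fun s hs => ?_
    rw [toSimplexChains_of_card_ne, mul_zero]
    rw [Finset.card_insert_of_notMem (Finset.mem_compl.1 hs)]
    omega

lemma mem_cycles_iff {k : ℕ} (c : KW cs k → R) :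
    c ∈ cycles cs k ↔ simplexBoundary (toSimplexChains cs k c) = 0 := by
  cases k with
  | zero =>
    refine ⟨fun _ => ?_, fun _ => Submodule.mem_top⟩
    funext τ
    rw [simplexBoundary_apply]
    refine Finset.sum_eq_zero fun s hs => ?_
    rw [toSimplexChains_of_card_ne, mul_zero]
    simp
  | succ k =>
    rw [h.simplexBoundary_toSimplexChains, cycles, LinearMap.mem_ker,
      map_eq_zero_iff _ (h.toSimplexChains_injective k)]

lemma mk_eq_zero_iff {k : ℕ} (c : cycles cs k) :
    (Submodule.Quotient.mk c : Hgy cs k) = 0 ↔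
      ∃ x, simplexBoundary (toSimplexChains cs (k + 1) x) = toSimplexChains cs k c.1 := by
  rw [Submodule.Quotient.mk_eq_zero, Submodule.mem_comap, LinearMap.mem_range]
  refine exists_congr fun x => ?_
  rw [h.simplexBoundary_toSimplexChains, (h.toSimplexChains_injective k).eq_iff]
  rfl

omit [Fintype B] in
lemma toSimplexChains_mem_filteredChains {d k : ℕ} (hd : d ∈ D) (c : KW cs k → R) :
    toSimplexChains cs k c ∈ filteredChains (cyc d) (v d) k := by
  refine ⟨fun τ => toSimplexChains_of_card_ne c, fun τ => ?_⟩
  by_cases hτ : τ.card = k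
  · rw [toSimplexChains_apply c ⟨τ, hτ, h.finite τ⟩, h.toLaurent_poin]
    exact (Finset.dvd_prod_of_mem (fun d => cyc d ^ v d τ) hd).mul_right _
  · rw [toSimplexChains_of_card_ne c hτ]
    exact dvd_zero _

lemma exists_toSimplexChains_eq_smul {d k : ℕ} (hd : d ∈ D) {y : Finset B → R}
    (hy : y ∈ filteredChains (cyc d) (v d) k) :
    ∃ c, toSimplexChains cs k c = (∏ e ∈ D.erase d, cyc e ^ v e Finset.univ) • y := by
  refine h.exists_toSimplexChains_eq (fun σ hσ => by simp [hy.1 σ hσ]) fun σ => ?_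
  rw [h.toLaurent_poin, ← Finset.prod_erase_mul _ _ hd]
  refine mul_dvd_mul (Finset.prod_dvd_prod_of_dvd _ _ fun e he => pow_dvd_pow _ ?_) (hy.2 σ)
  exact h.mono_of_subset (Finset.mem_of_mem_erase he) (Finset.subset_univ σ)

omit h in
lemma isCoprime_prod_erase (d : ℕ) (D : Finset ℕ) (n : ℕ → ℕ) :
    IsCoprime (∏ e ∈ D.erase d, cyc e ^ n e) (cyc d) :=
  IsCoprime.prod_left fun _ he => (isCoprime_cyc (Finset.ne_of_mem_erase he)).pow_left

end IsCyclotomicSystem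

variable [Fintype B] [LinearOrder B]

/-- The matching is weight preserving in degree `k`. -/
def SimplexMatching.IsPerfect (m : SimplexMatching B) (v : Finset B → ℕ) (k : ℕ) : Prop :=
  ∀ τ, τ.card = k → m.bit τ ∉ τ → v (insert (m.bit τ) τ) ≤ v τ

/-- The matching is weight preserving in degree `k` except at one simplex, whose partner
weighs one more; `le_or_le` and `face_le` make the corresponding cycle extendable. -/
structure SimplexMatching.IsDefect (m : SimplexMatching B) (v : Finset B → ℕ) (k : ℕ)
    (τ₀ : Finset B) : Prop where
  card_eq : τ₀.card = k
  notMem : m.bit τ₀ ∉ τ₀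
  weight_eq : v (insert (m.bit τ₀) τ₀) = v τ₀ + 1
  weight_le : ∀ τ, τ.card = k → m.bit τ ∉ τ → τ ≠ τ₀ → v (insert (m.bit τ) τ) ≤ v τ
  le_or_le : ∀ σ, σ.card = k → m.bit σ ∈ σ → v σ ≤ v (σ.erase (m.bit σ)) ∨ v σ ≤ v τ₀
  face_le : ∀ τ, τ.card = k + 1 → m.bit τ ∉ τ →
    ∀ s ∈ τ, v ((insert (m.bit τ) τ).erase s) ≤ v τ

theorem IsCyclotomicSystem.nonempty_hgy_equiv {cs : CoxeterSystem M W} {D : Finset ℕ}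
    {v : ℕ → Finset B → ℕ} (h : IsCyclotomicSystem cs D v) (m₀ : SimplexMatching B) {k : ℕ}
    {T : Finset ℕ} (hTD : T ⊆ D)
    (h0 : ∀ d ∈ D, d ∉ T → ∃ m : SimplexMatching B, m.IsPerfect (v d) k)
    (h1 : ∀ d ∈ T, ∃ (m : SimplexMatching B) (τ₀ : Finset B), m.IsDefect (v d) k τ₀) :
    Nonempty (Hgy cs k ≃ₗ[R] R ⧸ Ideal.span {∏ d ∈ T, cyc d}) := by
  refine nonempty_quotient_prod_equiv hTD (fun d _ e _ hde => isCoprime_cyc hde)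
    (n := fun d => v d Finset.univ) ?_ ?_ ?_
  · intro c
    obtain ⟨c, rfl⟩ := Submodule.Quotient.mk_surjective _ c
    rw [← Submodule.Quotient.mk_smul, h.mk_eq_zero_iff]
    have hc := (h.mem_cycles_iff c.1).1 c.2
    obtain ⟨x, hx, hxc⟩ := m₀.exists_boundary_of_equal_weights (p := (1 : R)) (v := 0)
      (fun _ _ => le_rfl) (fun _ _ _ => le_rfl)
      (show toSimplexChains cs k c.1 ∈ filteredChains 1 0 k from
        ⟨fun τ => IsCyclotomicSystem.toSimplexChains_of_card_ne _, fun τ => by simp⟩) hc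
    obtain ⟨x', hx'⟩ := h.exists_toSimplexChains_eq
      (y := (∏ d ∈ D, cyc d ^ v d Finset.univ) • x)
      (fun σ hσ => by simp [hx.1 σ hσ]) (fun σ => by
        rw [h.toLaurent_poin, Pi.smul_apply, smul_eq_mul]
        exact (Finset.prod_dvd_prod_of_dvd _ _ fun e he => pow_dvd_pow _
          (h.mono_of_subset he (Finset.subset_univ σ))).mul_right _)
    exact ⟨x', by rw [hx', map_smul, hxc, ← map_smul]; rfl⟩
  · intro d hd hdT
    obtain ⟨m, hm⟩ := h0 d hd hdT
    refine ⟨_, IsCyclotomicSystem.isCoprime_prod_erase d D fun e => v e Finset.univ, fun c => ?_⟩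
    obtain ⟨c, rfl⟩ := Submodule.Quotient.mk_surjective _ c
    rw [← Submodule.Quotient.mk_smul, h.mk_eq_zero_iff]
    obtain ⟨x, hx, hxc⟩ := m.exists_boundary_of_equal_weights (h.mono d hd) hm
      (h.toSimplexChains_mem_filteredChains hd c.1) ((h.mem_cycles_iff c.1).1 c.2)
    obtain ⟨x', hx'⟩ := h.exists_toSimplexChains_eq_smul hd hx
    exact ⟨x', by rw [hx', map_smul, hxc, ← map_smul]; rfl⟩
  · intro d hdT
    have hd := hTD hdT
    obtain ⟨m, τ₀, hτ₀⟩ := h1 d hdT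
    obtain ⟨z, hz, hzc, hgen, ⟨x, hx, hxz⟩, hann⟩ :=
      m.exists_generator_of_defect (cyc_ne_zero d) (h.mono d hd) hτ₀.card_eq hτ₀.notMem
        hτ₀.weight_eq hτ₀.weight_le hτ₀.le_or_le hτ₀.face_le
    obtain ⟨z', hz'⟩ := h.exists_toSimplexChains_eq_smul hd hz
    have hcop := IsCyclotomicSystem.isCoprime_prod_erase d D fun e => v e Finset.univ
    set u := ∏ e ∈ D.erase d, cyc e ^ v e Finset.univ
    have hz'c : z' ∈ cycles cs k := by
      rw [h.mem_cycles_iff, hz', map_smul, hzc, smul_zero]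
    refine ⟨u, Submodule.Quotient.mk ⟨z', hz'c⟩, hcop, ?_, ?_, ?_⟩
    · intro c
      obtain ⟨c, rfl⟩ := Submodule.Quotient.mk_surjective _ c
      obtain ⟨r, y, hy, e⟩ := hgen _ (h.toSimplexChains_mem_filteredChains hd c.1)
        ((h.mem_cycles_iff c.1).1 c.2)
      obtain ⟨y', hy'⟩ := h.exists_toSimplexChains_eq_smul hd hy
      refine ⟨r, ?_⟩
      rw [← sub_eq_zero, ← Submodule.Quotient.mk_smul, ← Submodule.Quotient.mk_smul,
        ← Submodule.Quotient.mk_sub, h.mk_eq_zero_iff]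
      refine ⟨y', ?_⟩
      have : ((u • c - r • ⟨z', hz'c⟩ : cycles cs k) : KW cs k → R) = u • c.1 - r • z' := rfl
      rw [hy', this, map_sub, map_smul, map_smul, map_smul, hz', e, smul_add, smul_comm u r]
      exact (add_sub_cancel_left _ _).symm
    · rw [← Submodule.Quotient.mk_smul, h.mk_eq_zero_iff]
      obtain ⟨x', hx'⟩ := h.exists_toSimplexChains_eq_smul hd hx
      refine ⟨x', ?_⟩
      have : ((cyc d • ⟨z', hz'c⟩ : cycles cs k) : KW cs k → R) = cyc d • z' := rfl
      rw [hx', this, map_smul, map_smul, hxz, hz', smul_comm]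
    · intro r hr
      rw [← Submodule.Quotient.mk_smul, h.mk_eq_zero_iff] at hr
      obtain ⟨y, hy⟩ := hr
      have : ((r • ⟨z', hz'c⟩ : cycles cs k) : KW cs k → R) = r • z' := rfl
      rw [this, map_smul, hz', smul_smul] at hy
      exact hcop.symm.dvd_of_dvd_mul_right
        (hann _ _ (h.toSimplexChains_mem_filteredChains hd y) hy)

end WeightedComplex

section CyclotomicE8

/-- The indices of the cyclotomic polynomials dividing Poincaré polynomials of parabolic
subgroups of type `E₈`. -/
def e8Indices : Finset ℕ := {2, 3, 4, 5, 6, 7, 8, 9, 10, 12, 14, 15, 18, 20, 24, 30}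

/-- The multiplicity of `Φ_d` in the Poincaré polynomial of a parabolic subgroup of type `E₈`. -/
def e8Weight (d : ℕ) (σ : Finset (Fin 8)) : ℕ := (degreesE8 (bitMask σ)).countP (d ∣ ·)

lemma e8Weight_mono : ∀ d ∈ e8Indices, ∀ (τ : Finset (Fin 8)) (s : Fin 8),
    e8Weight d τ ≤ e8Weight d (insert s τ) := by decide +kernel

lemma mem_e8Indices_of_mem_degreesE8 : ∀ m < 256, ∀ n ∈ degreesE8 m, n ∈ e8Indices := by
  decide +kernel

lemma divisors_erase_one : ∀ n ∈ e8Indices, n.divisors.erase 1 = e8Indices.filter (· ∣ n) := by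
  decide +kernel

lemma X_pow_sub_one_eq {n : ℕ} (hn : n ∈ e8Indices) :
    (X ^ n - 1 : ℚ[X]) = (X - 1) * ∏ d ∈ e8Indices, if d ∣ n then cyclotomic d ℚ else 1 := by
  have h0 : 0 < n := by
    revert n; decide
  rw [← Finset.prod_filter, ← divisors_erase_one n hn, ← cyclotomic_one,
    Finset.mul_prod_erase _ (fun d => cyclotomic d ℚ) (Nat.one_mem_divisors.2 h0.ne'),
    prod_cyclotomic_eq_X_pow_sub_one h0]

lemma prod_X_pow_sub_one_eq (l : List ℕ) (hl : ∀ n ∈ l, n ∈ e8Indices) :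
    (l.map fun n => (X ^ n - 1 : ℚ[X])).prod =
      (X - 1) ^ l.length * ∏ d ∈ e8Indices, cyclotomic d ℚ ^ l.countP (d ∣ ·) := by
  induction l with
  | nil => simp
  | cons n l ih =>
    rw [List.map_cons, List.prod_cons, ih fun x hx => hl x (List.mem_cons_of_mem _ hx),
      X_pow_sub_one_eq (hl n List.mem_cons_self)]
    have : ∏ d ∈ e8Indices, cyclotomic d ℚ ^ (n :: l).countP (d ∣ ·) =
        (∏ d ∈ e8Indices, if d ∣ n then cyclotomic d ℚ else 1) *
          ∏ d ∈ e8Indices, cyclotomic d ℚ ^ l.countP (d ∣ ·) := by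
      rw [← Finset.prod_mul_distrib]
      refine Finset.prod_congr rfl fun d _ => ?_
      rw [List.countP_cons]
      by_cases h : d ∣ n
      · simp [h, pow_succ, mul_comm]
      · simp [h]
    rw [this, List.length_cons]
    ring

theorem isCyclotomicSystem_e8 {W : Type*} [Group W] {Mat : CoxeterMatrix (Fin 8)}
    (cs : CoxeterSystem Mat W) (hE : IsTypeE8 Mat) :
    IsCyclotomicSystem cs e8Indices e8Weight where
  finite σ := (poin_mul_pow_eq cs hE σ).1
  mono := e8Weight_mono
  poin_eq σ := by
    have h := (poin_mul_pow_eq cs hE σ).2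
    rw [prod_X_pow_sub_one_eq _ (mem_e8Indices_of_mem_degreesE8 _ (bitMask_lt σ))] at h
    exact mul_left_cancel₀ (pow_ne_zero _ (X_sub_C_ne_zero (1 : ℚ))) h

end CyclotomicE8

section MatchingsE8

/-- For each index `d`, a table encoding an acyclic matching: the six binary digits at position
`6 * bitMask σ` hold the matching vertex of `σ` and the rank of `σ`. -/
def matchingCode : ℕ → ℕ
  | 2 => 267765939606426544764623277794949825926584671648654685388632192829418719279170385813342917392094235493171044995463960446531952212456154315021342525052211205974598682549545606394416522758542708878676048645958785215299612007187033199431855953779787933729032215156929490037414527696008549504986087484893936270773614826811520527184584278494063181383103436074164440993490896034598398378282483325527448805084058278597750259241896117032100955754013298402590961609224323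
  | 3 => 228937369223895648123870297118982089094637254267316001911247366720790151629456499942779254014269807897096059668373898005733086384981353441997983096263746793736106933892810771856401636064247269826371509841598720619065075967418715271644384461847770838346601696159266697948752963689045725632143098880181295781303786849374351214324981864240567815789786131138938064585465549300716342517426533355779428747508700211231277739224279569704905863367605570075393470587998977
  | 4 => 37355506581091608326353698321117509976168388645055062512918732126797847329074817055061777683387603298597573096929797420654764021140225504746722743879713727773068195262753681786035750164503946154345502676187060183946265829540365800518523780305157242455893492413511337217852356623923592709053404450063947003968171194801931807349940913941092108747082345334108634867551984329681580362862733315031042911442929114264084971104160485268362294519468431214894893764993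
  | 5 => 229498670728990993039103894446772913885444692170716875256757097163552769565667435174577290187462851076656460759168835255379773633956905996454764897440152214796151272554799892131184544896964683526682789815942602783747357798639320931324603009009909555992207940611670910778379829113629271535341989973650352391083665874706826915141346718312413396606977328431646676973382603273857125112170910219403069558184670894104061669176681595006294006986040831522961529707479106
  | 6 => 267748273256532250023864070458508987992522372937664380090080423133050987373708713328998511087488161259005788341059766842214970111964920882747512637592564041511052418798569424755810011937627310485336381633826616554397981105069220876538813422566409857986120048875034234122838777825687347211008284378144925271068731119281327679331497571031557474989119096759330918864670287678034689230212642033206859939053865092319712717790263105290134406012014670027960796626399299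
  | 7 => 38258925411632616683348884301812002117275350181706799224925343916733701042002801930163426657151954571009693661185197323924509388171429116831670157434051267108791039115480053814689542471672946683708563167717712733290462503917737744113405134919732408946283983072347884426820275277444291389549886850262085111863411483059549183542743557686413818690726065902244318773699235610302950051175787244376472427635790592846337912942071968618668523222179522467652807605621057
  | 8 => 191855654355708154392825958587702046604121621212485374467128852038985485165702664396569240268565630893690025329332422903089319295630163094854038641344717232286900620628207719548536896605972508126555323456943760792995790763713954993848706545784984685426083960868824313077174203673874738274847584773014222636730405917291230419786194312831346514421064360973617111568087682359227127928666992310383409522907995191987690864968043035470900706077976658556399158186492231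
  | 9 => 228385556788660286039141912788904584663909601476571352347338624758382588764130697495438362162780179913930389403110325981403246649631418488895398892916976920178793581797701143017697067005647777412524750035143142222249087887057985384384045260124531656469210638054909182297527572854842193971160877079201357582883282002642162077851589069224976776979315476040582843307510361033736985214983762666116884931866696058988411000245990139955549163857017556197223026625626242
  | 10 => 267812045203744569836659269160048109951236820857789730866354737973055951776027467469885053909732140821519729503956678256103786764348903079539214860398358136079797208784742672299693626984479436173531458345753766975293039326907033437399168675759938802256998635147526736408470203714126729160670123866180937627653841529832695891782568845012659621978983926300081839555113453151876677792634388943489392779721255860553546865519887217860889257784638052181351045826933061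
  | 12 => 15750381627303923881045437780285925303516226965162666842138895153018523183393667094919699560733339409252077816249766500108650507736060003163091572609498429533925745110025522487577943474244399717674545951561514166743267351669310229714317061054672067230193854032109432512349480486063279509346909848958771750205658934050141287097947551848944089619711307871457669131356262619026280148747650928924405222084302493506162931606929324054401781754316587006239199428
  | 14 => 267803153598314955287355299788364162232056305556418076350710795233974658242130509118215063992800303872381551293898482453081969434106731884273997623478045765948831579405426005108821927490846912139580091850650619031357725832548756908056830440744033864858384537659531061020251358866898528355154389492398505821857224872753464682878503154973897226223350148917192138694661820408787724662524775545678248392798648922734455510546654096561901175910477378008140205921149570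
  | 15 => 191839851107735342654871918789857926456179371328857546000649497470105679138200159108998921999568368879111680710482109860416162323569661029556567704814712662526887328226024493910570468170683572141698091031392320591313817251121359256734091174822711936291124388940979464624469660731121686203246544129651490863329263537545362834266569374779792194046647012144974541063211655955493178706178004553517185734012960356119468674395894538679835710606278886191316575364870534
  | 18 => 267205353300451474654312925057111776408534699771952572693244510599556337495533972339052484631479110216181566225536635499391505896132104815862013080348625841443181267741075163242456578374414175818070171703060474124943105459329210048387723610394906086853573952787583639735263447332428333290013994743873378310033628671290357276990897756543906934704582921561195635944970601334337859611643737360995251487305492638574629784649872239706704714725642475936392116114571525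
  | 20 => 265421308916899974139902215670284113012748817622165053510195486573265981105264075113742733215660395035297530336138975422088859719456958426121717246530686941282389494410939647219459342800297408895540058447817719548055354585613485632708387347019520954484430120938877734289142777072316817276044527194513908956760710095585601367846894407667114786905395694405954537749186888311988280300240409475013214404895154762448534551748197631519759779796490585248664724323496903
  | 24 => 228376642811564378168966798113648858303600942182082163809565078406228714768055678942649721644251871647688038420460712726972141339753739491491756294835144581705825552022586247569162807731984139448102381578258393911997632137144802120014392583018604357062934444130888367606118532297144616803687455897648983680604290363488875596452008050511816820192232094502781193503886857307565777382295358907231870210515172401161867132687006324161490097184466716534678157150662919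
  | 30 => 229553553141180635345011909046638421199131994750086594813822833810576057230696902004798026452384809133986096770813418505697623348437145616479497251857270828157601279003255408702527941619500241412257719035508287573678775317201431843211410377255499684592886520325001830680352756814006081803019753032052521478570391867386909378687541522446420504773890910278207306552446389097521472218403207344484255007703736185380514924773959429688794500995316978551019178963787971
  | _ => 0

/-- The vertex by which `σ` is matched. -/
def matchingBit (d : ℕ) (σ : Finset (Fin 8)) : Fin 8 :=
  ⟨(matchingCode d >>> (6 * bitMask σ)) % 8, Nat.mod_lt _ (by norm_num)⟩

/-- The rank function witnessing acyclicity. -/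
def matchingRank (d : ℕ) (σ : Finset (Fin 8)) : ℕ :=
  (matchingCode d >>> (6 * bitMask σ + 3)) % 8

lemma matchingBit_erase : ∀ d ∈ e8Indices, ∀ σ : Finset (Fin 8), matchingBit d σ ∈ σ →
    matchingBit d (σ.erase (matchingBit d σ)) = matchingBit d σ := by decide +kernel

lemma matchingBit_insert : ∀ d ∈ e8Indices, ∀ τ : Finset (Fin 8), matchingBit d τ ∉ τ →
    matchingBit d (insert (matchingBit d τ) τ) = matchingBit d τ := by decide +kernel

lemma matchingRank_lt : ∀ d ∈ e8Indices, ∀ τ : Finset (Fin 8), matchingBit d τ ∉ τ → ∀ s ∈ τ,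
    matchingBit d ((insert (matchingBit d τ) τ).erase s) ∉
      (insert (matchingBit d τ) τ).erase s →
    matchingRank d τ < matchingRank d ((insert (matchingBit d τ) τ).erase s) := by
  decide +kernel

/-- An acyclic matching adapted to the multiplicities of `Φ_d`. -/
def e8Matching (d : ℕ) (hd : d ∈ e8Indices) : SimplexMatching (Fin 8) where
  bit := matchingBit d
  rank := matchingRank d
  bit_erase := matchingBit_erase d hd
  bit_insert := matchingBit_insert d hd
  rank_lt := matchingRank_lt d hd

/-- The indices `d` for which `Φ_d` divides the order of the homology in degree `k`. -/
def defectIndices : ℕ → Finset ℕ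
  | 0 => {2}
  | 4 => {4}
  | 6 => {8, 12}
  | 7 => {2, 3, 4, 5, 6, 8, 10, 12, 15, 20, 24, 30}
  | _ => ∅

/-- The unique lower simplex of dimension `k` in the matching for `d` which is lighter than its
partner. -/
def defectSimplex : ℕ → ℕ → Finset (Fin 8)
  | _, 0 => ∅
  | _, 4 => {0, 3, 5, 6}
  | 8, 6 => {1, 2}ᶜ
  | _, 6 => {3, 6}ᶜ
  | 4, 7 => {0}ᶜ
  | 12, 7 => {0}ᶜ
  | 8, 7 => {5}ᶜ
  | 15, 7 => {5}ᶜ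
  | 3, 7 => {6}ᶜ
  | 5, 7 => {6}ᶜ
  | 24, 7 => {6}ᶜ
  | 30, 7 => {6}ᶜ
  | _, _ => {7}ᶜ

lemma defectIndices_subset (k : ℕ) : defectIndices k ⊆ e8Indices := by
  unfold defectIndices
  split <;> decide

lemma e8Weight_insert_le : ∀ d ∈ e8Indices, ∀ τ : Finset (Fin 8), matchingBit d τ ∉ τ →
    d ∉ defectIndices τ.card ∨ τ ≠ defectSimplex d τ.card →
    e8Weight d (insert (matchingBit d τ) τ) ≤ e8Weight d τ := by
  decide +kernel

lemma defectSimplex_spec : ∀ k < 8, ∀ d ∈ defectIndices k,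
    (defectSimplex d k).card = k ∧
    matchingBit d (defectSimplex d k) ∉ defectSimplex d k ∧
    e8Weight d (insert (matchingBit d (defectSimplex d k)) (defectSimplex d k)) =
      e8Weight d (defectSimplex d k) + 1 := by
  decide +kernel

lemma e8Weight_le_or_le : ∀ d ∈ e8Indices, ∀ σ : Finset (Fin 8), d ∈ defectIndices σ.card →
    matchingBit d σ ∈ σ →
    e8Weight d σ ≤ e8Weight d (σ.erase (matchingBit d σ)) ∨
      e8Weight d σ ≤ e8Weight d (defectSimplex d σ.card) := by
  decide +kernel

lemma e8Weight_face_le : ∀ d ∈ e8Indices, ∀ τ : Finset (Fin 8),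
    d ∈ defectIndices (τ.card - 1) → matchingBit d τ ∉ τ →
    ∀ s ∈ τ, e8Weight d ((insert (matchingBit d τ) τ).erase s) ≤ e8Weight d τ := by
  decide +kernel

lemma isPerfect_e8Matching {d k : ℕ} (hd : d ∈ e8Indices) (h : d ∉ defectIndices k) :
    (e8Matching d hd).IsPerfect (e8Weight d) k := by
  rintro τ rfl hτ
  exact e8Weight_insert_le d hd τ hτ (Or.inl h)

lemma isDefect_e8Matching {d k : ℕ} (hd : d ∈ e8Indices) (hk : k < 8) (h : d ∈ defectIndices k) :
    (e8Matching d hd).IsDefect (e8Weight d) k (defectSimplex d k) where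
  card_eq := (defectSimplex_spec k hk d h).1
  notMem := (defectSimplex_spec k hk d h).2.1
  weight_eq := (defectSimplex_spec k hk d h).2.2
  weight_le τ hτk hτ hne := by
    subst hτk
    exact e8Weight_insert_le d hd τ hτ (Or.inr hne)
  le_or_le σ hσk hσ := by
    subst hσk
    exact e8Weight_le_or_le d hd σ h hσ
  face_le τ hτk hτ := e8Weight_face_le d hd τ (by rwa [hτk]) hτ

theorem nonempty_hgy_e8_equiv {W : Type*} [Group W] {Mat : CoxeterMatrix (Fin 8)}
    (cs : CoxeterSystem Mat W) (hE : IsTypeE8 Mat) (k : ℕ) :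
    Nonempty (Hgy cs k ≃ₗ[R] R ⧸ Ideal.span {∏ d ∈ defectIndices k, cyc d}) := by
  refine (isCyclotomicSystem_e8 cs hE).nonempty_hgy_equiv (e8Matching 2 (by decide))
    (defectIndices_subset k) (fun d hd h => ⟨_, isPerfect_e8Matching hd h⟩) fun d h =>
      ⟨_, _, isDefect_e8Matching (defectIndices_subset k h) ?_ h⟩
  by_contra! hk
  obtain ⟨j, rfl⟩ := Nat.exists_eq_add_of_le' hk
  exact Finset.notMem_empty d h

end MatchingsE8

section Decomposition

lemma subsingleton_of_equiv_span_one {H : Type*} [AddCommGroup H] [Module R H]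
    (h : Nonempty (H ≃ₗ[R] R ⧸ Ideal.span {∏ d ∈ (∅ : Finset ℕ), cyc d})) : Subsingleton H := by
  obtain ⟨e⟩ := h
  have : Subsingleton (R ⧸ Ideal.span {∏ d ∈ (∅ : Finset ℕ), cyc d}) := by
    rw [Finset.prod_empty, Ideal.span_singleton_one]
    exact Ideal.Quotient.subsingleton_iff.2 rfl
  exact e.toEquiv.subsingleton

lemma nonempty_prod_equiv {d : ℕ} {T : Finset ℕ} (hd : d ∉ T) {N : Type*} [AddCommGroup N]
    [Module R N] (h : Nonempty ((R ⧸ Ideal.span {∏ e ∈ T, cyc e}) ≃ₗ[R] N)) :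
    Nonempty ((R ⧸ Ideal.span {∏ e ∈ insert d T, cyc e}) ≃ₗ[R] CycQuot d × N) := by
  obtain ⟨f⟩ := h
  rw [Finset.prod_insert hd]
  have hcop : IsCoprime (cyc d) (∏ e ∈ T, cyc e) :=
    IsCoprime.prod_right fun e he => isCoprime_cyc fun hde => hd (hde ▸ he)
  exact ⟨(quotientSpanMulEquiv hcop).trans ((LinearEquiv.refl R _).prodCongr f)⟩

lemma nonempty_singleton_equiv (d : ℕ) :
    Nonempty ((R ⧸ Ideal.span {∏ e ∈ ({d} : Finset ℕ), cyc e}) ≃ₗ[R] CycQuot d) := by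
  rw [Finset.prod_singleton]
  exact ⟨LinearEquiv.refl R _⟩

lemma nonempty_equiv_trans {H N N' : Type*} [AddCommGroup H] [Module R H] [AddCommGroup N]
    [Module R N] [AddCommGroup N'] [Module R N'] (h : Nonempty (H ≃ₗ[R] N))
    (h' : Nonempty (N ≃ₗ[R] N')) : Nonempty (H ≃ₗ[R] N') :=
  h.elim fun e => h'.map e.trans

end Decomposition

/-- Homology of the weighted complex for the Coxeter system of type `E₈` (generators indexed by `0,…,7` corresponding to `1,…,8`). -/
theorem homology_E8 {W : Type*} [Group W] {Mat : CoxeterMatrix (Fin 8)}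
    (cs : CoxeterSystem Mat W)
    (hM : ∀ i j : Fin 8, i.val < j.val →
      Mat.M i j = (if (i.val, j.val) ∈ ([(0, 2), (1, 3), (2, 3), (3, 4), (4, 5), (5, 6), (6, 7)] : List (ℕ × ℕ)) then 3 else 2)) :
    Nonempty (Hgy cs 0 ≃ₗ[R] (CycQuot 2)) ∧
    Subsingleton (Hgy cs 1) ∧
    Subsingleton (Hgy cs 2) ∧
    Subsingleton (Hgy cs 3) ∧
    Nonempty (Hgy cs 4 ≃ₗ[R] (CycQuot 4)) ∧
    Subsingleton (Hgy cs 5) ∧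
    Nonempty (Hgy cs 6 ≃ₗ[R] (CycQuot 8 × CycQuot 12)) ∧
    Nonempty (Hgy cs 7 ≃ₗ[R] (CycQuot 2 × CycQuot 3 × CycQuot 4 × CycQuot 5 × CycQuot 6 × CycQuot 8 × CycQuot 10 × CycQuot 12 × CycQuot 15 × CycQuot 20 × CycQuot 24 × CycQuot 30)) ∧
    (∀ k, 8 ≤ k → Subsingleton (Hgy cs k)) := by
  have h := nonempty_hgy_e8_equiv cs (isTypeE8_of_entries hM)
  refine ⟨nonempty_equiv_trans (h 0) (nonempty_singleton_equiv 2),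
    subsingleton_of_equiv_span_one (h 1), subsingleton_of_equiv_span_one (h 2),
    subsingleton_of_equiv_span_one (h 3),
    nonempty_equiv_trans (h 4) (nonempty_singleton_equiv 4),
    subsingleton_of_equiv_span_one (h 5),
    nonempty_equiv_trans (h 6) (nonempty_prod_equiv (by decide) (nonempty_singleton_equiv 12)),
    nonempty_equiv_trans (h 7) ?_, fun k hk => ?_⟩
  · change Nonempty ((R ⧸ Ideal.span
      {∏ d ∈ ({2, 3, 4, 5, 6, 8, 10, 12, 15, 20, 24, 30} : Finset ℕ), cyc d}) ≃ₗ[R] _)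
    iterate 11 refine nonempty_prod_equiv (by decide) ?_
    exact nonempty_singleton_equiv 30
  · obtain ⟨j, rfl⟩ := Nat.exists_eq_add_of_le' hk
    exact subsingleton_of_equiv_span_one (h (j + 8))
end
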